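/- Hoffman's conjecture in positive characteristic: for every N ∈ ℕ and every weight w ∈ ℕ, the family of Carlitz multiple polylogarithms at N-th roots of unity {Li(𝛆;𝔰) : 𝔰 ∈ S_w, 𝛆 ∈ Γ_N^{depth(𝔰)}} is a basis of the K_N-vector space CZ_{N,w}: it is K_N-linearly independent and its K_N-span equals CZ_{N,w}. -/

import Mathlib

noncomputable section

open scoped Classical

namespace ZHPC

variable (Fq : Type) [Field Fq] [Fintype Fq]

/-- `q`, the cardinality of the base finite field `𝔽_q`. -/
def qc : ℕ := Fintype.card Fq

/-- A fixed algebraic closure `𝔽̄_q` of `𝔽_q`. -/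
abbrev Fb := AlgebraicClosure Fq

/-- The field `𝔽̄_q((1/θ))` of formal Laurent series in `1/θ` over `𝔽̄_q`, modeled as the
field of formal Laurent series in one variable, `θ` being the inverse of that variable. -/
abbrev Kinf := LaurentSeries (Fb Fq)

/-- The embedding of the constants `𝔽̄_q → 𝔽̄_q((1/θ))`. -/
def cst : Fb Fq →+* Kinf Fq := HahnSeries.C

/-- The element `θ`. -/
def theta : Kinf Fq := HahnSeries.single (-1 : ℤ) 1

/-- `ℓ_d = ∏_{i=1}^{d} (θ - θ^{q^i})`, with `ℓ_0 = 1`. -/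
def ell (d : ℕ) : Kinf Fq := ∏ i ∈ Finset.Icc 1 d, (theta Fq - theta Fq ^ qc Fq ^ i)

/-- Arrays `(𝛆;𝔰)` of some depth `n`. -/
structure PArr (F : Type) where
  depth : ℕ
  s : Fin depth → ℕ
  eps : Fin depth → F

namespace PArr

variable {F : Type}

/-- A *positive array* for level `N`: all entries `sᵢ` are positive integers and all the
characters `εᵢ` are `N`-th roots of unity. -/
def Positive [Monoid F] (N : ℕ) (A : PArr F) : Prop := (∀ i, 0 < A.s i) ∧ ∀ i, A.eps i ^ N = 1

/-- The weight `w(𝔰) = s₁ + ⋯ + s_n`. -/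
def wt (A : PArr F) : ℕ := ∑ i, A.s i

/-- The `i`-th entry of `𝔰` (`0`-indexed), with value `0` beyond the depth. -/
def sAt (A : PArr F) (i : ℕ) : ℕ := if h : i < A.depth then A.s ⟨i, h⟩ else 0

/-- The partial sums `s₁ + ⋯ + s_i` (entries beyond the depth being `0`). -/
def psum (A : PArr F) (i : ℕ) : ℕ := ∑ j ∈ Finset.range i, A.sAt j

/-- The character `χ(𝛆) = ε₁ ⋯ ε_n`. -/
def chi [CommMonoid F] (A : PArr F) : F := ∏ i, A.eps i

end PArr

/-- The Carlitz multiple polylogarithm at roots of unity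
`Li(𝛆;𝔰) = Σ_{d₁ > ⋯ > d_n ≥ 0} ε₁^{d₁}⋯ε_n^{d_n} / (ℓ_{d₁}^{s₁}⋯ℓ_{d_n}^{s_n})`. -/
def Li (A : PArr (Fb Fq)) : Kinf Fq :=
  ∑' d : {f : Fin A.depth → ℕ // StrictAnti f},
    ∏ i, cst Fq (A.eps i ^ d.1 i) / ell Fq (d.1 i) ^ A.s i

/-- `Si_d(𝛆;𝔰)`: same summand as `Li`, over decreasing tuples with `d₁ = d`. -/
def Sid (d : ℤ) (A : PArr (Fb Fq)) : Kinf Fq :=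
  ∑' f : {f : Fin A.depth → ℕ // StrictAnti f ∧ ∀ i : Fin A.depth, i.val = 0 → (f i : ℤ) = d},
    ∏ i, cst Fq (A.eps i ^ f.1 i) / ell Fq (f.1 i) ^ A.s i

/-- `Si_{<d}(𝛆;𝔰)`: same summand as `Li`, over decreasing tuples with `d > d₁`. -/
def SidLt (d : ℤ) (A : PArr (Fb Fq)) : Kinf Fq :=
  ∑' f : {f : Fin A.depth → ℕ // StrictAnti f ∧ ∀ i : Fin A.depth, (f i : ℤ) < d},
    ∏ i, cst Fq (A.eps i ^ f.1 i) / ell Fq (f.1 i) ^ A.s i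

/-- The value at `θ` of the monic polynomial `θ^e + Σ_{j<e} c_j θ^j ∈ A = 𝔽_q[θ]`. -/
def monicVal (e : ℕ) (c : Fin e → Fq) : Kinf Fq :=
  theta Fq ^ e + ∑ j, cst Fq (algebraMap Fq (Fb Fq) (c j)) * theta Fq ^ (j : ℕ)

/-- The power sum `S_d(𝛆;𝔰)`, a sum over tuples of monic polynomials `a₁, …, a_n ∈ A₊`
with `d = deg a₁ > ⋯ > deg a_n ≥ 0`; a monic polynomial of degree `e` is encoded by its
tuple of lower coefficients `c : Fin e → Fq`. -/
def Sd (d : ℤ) (A : PArr (Fb Fq)) : Kinf Fq :=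
  ∑' e : {f : Fin A.depth → ℕ // StrictAnti f ∧ ∀ i : Fin A.depth, i.val = 0 → (f i : ℤ) = d},
    ∑ c : (∀ i, Fin (e.1 i) → Fq),
      ∏ i, cst Fq (A.eps i ^ e.1 i) / monicVal Fq (e.1 i) (c i) ^ A.s i

/-- The `N`-th cyclotomic multiple zeta value `ζ_A(𝛆;𝔰) = Σ_{d ≥ 0} S_d(𝛆;𝔰)`. -/
def zetaA (A : PArr (Fb Fq)) : Kinf Fq := ∑' d : ℕ, Sd Fq (d : ℤ) A

/-- The cyclotomic field `k_N = 𝔽_q(ζ_N) ⊆ 𝔽̄_q`. -/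
def kN (N : ℕ) : Subfield (Fb Fq) :=
  Subfield.closure (Set.range (algebraMap Fq (Fb Fq)) ∪ {x | x ^ N = 1})

/-- The field `K_N = k_N(θ)`, as a subfield of `𝔽̄_q((1/θ))`. -/
def KNf (N : ℕ) : Subfield (Kinf Fq) :=
  Subfield.closure ((cst Fq '' (kN Fq N : Set (Fb Fq))) ∪ {theta Fq})

/-- The ring `A_N = k_N[θ]`, as a subring of `𝔽̄_q((1/θ))`. -/
def AN (N : ℕ) : Subring (Kinf Fq) :=
  Subring.closure ((cst Fq '' (kN Fq N : Set (Fb Fq))) ∪ {theta Fq})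

/-- `CZ_{N,w}`: the `K_N`-span of the `N`-th cyclotomic multiple zeta values of weight `w`. -/
def CZ (N w : ℕ) : Submodule (KNf Fq N) (Kinf Fq) :=
  Submodule.span (KNf Fq N) {x | ∃ A : PArr (Fb Fq), A.Positive N ∧ A.wt = w ∧ x = zetaA Fq A}

/-- `CL_{N,w}`: the `K_N`-span of the CMPL's at `N`-th roots of unity of weight `w`. -/
def CL (N w : ℕ) : Submodule (KNf Fq N) (Kinf Fq) :=
  Submodule.span (KNf Fq N) {x | ∃ A : PArr (Fb Fq), A.Positive N ∧ A.wt = w ∧ x = Li Fq A}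

/-- The index set of pairs `(𝔰,𝛆)` with `𝔰 ∈ S_w` and `𝛆 ∈ Γ_N^{depth 𝔰}`: positive arrays
of weight `w` with `q ∤ sᵢ` for all `i`. -/
def SwIdx (N w : ℕ) : Type :=
  {A : PArr (Fb Fq) // A.Positive N ∧ 0 < A.depth ∧ A.wt = w ∧ ∀ i, ¬ qc Fq ∣ A.s i}

section
open Filter Topology

section Generic
/-- nested sums -/
def SS {α R : Type*} [CommRing R] (e : α → ℕ → R) : List α → ℕ → R
  | [], _ => 1
  | l :: t, D => ∑ d ∈ Finset.range D, e l d * SS e t d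

variable {α R : Type*} [CommRing R]

@[simp] lemma SS_nil (e : α → ℕ → R) (D : ℕ) : SS e [] D = 1 := rfl
lemma SS_cons (e : α → ℕ → R) (l : α) (t : List α) (D : ℕ) :
    SS e (l :: t) D = ∑ d ∈ Finset.range D, e l d * SS e t d := rfl

lemma SS_cons_succ (e : α → ℕ → R) (l : α) (t : List α) (D : ℕ) :
    SS e (l :: t) (D+1) = SS e (l :: t) D + e l D * SS e t D := by
  simp [SS_cons, Finset.sum_range_succ]

lemma SS_cons_zero (e : α → ℕ → R) (l : α) (t : List α) : SS e (l :: t) 0 = 0 := by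
  simp [SS_cons]

lemma SS_map {R' : Type*} [CommRing R'] (f : R →+* R') (e : α → ℕ → R) (v : List α) (D : ℕ) :
    f (SS e v D) = SS (fun l d => f (e l d)) v D := by
  induction v generalizing D with
  | nil => simp
  | cons l t ih => simp [SS_cons, ih]

lemma SS_congr {e e' : α → ℕ → R} (v : List α) (h : ∀ l ∈ v, ∀ d, e l d = e' l d) (D : ℕ) :
    SS e v D = SS e' v D := by
  induction v generalizing D with
  | nil => simp
  | cons l t ih =>
    rw [SS_cons, SS_cons]
    refine Finset.sum_congr rfl fun d _ => ?_
    rw [h l (by simp), ih (fun l' hl' => h l' (by simp [hl']))]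

lemma SS_mapword {β : Type*} (g : β → α) (e : α → ℕ → R) (v : List β) (D : ℕ) :
    SS e (v.map g) D = SS (fun l d => e (g l) d) v D := by
  induction v generalizing D with
  | nil => simp
  | cons l t ih => simp [SS_cons, ih]

lemma SS_scale (e : α → ℕ → R) (γ : α → R) (v : List α) (D : ℕ) :
    SS (fun l d => γ l * e l d) v D = (v.map γ).prod * SS e v D := by
  induction v generalizing D with
  | nil => simp
  | cons l t ih =>
    simp only [SS_cons, ih, List.map_cons, List.prod_cons, Finset.mul_sum]
    refine Finset.sum_congr rfl fun d _ => ?_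
    ring

lemma SS_decon (e : α → ℕ → R) (u : List α) (k D : ℕ) :
    SS e u (k + D) = ∑ i ∈ Finset.range (u.length + 1),
      SS (fun l d => e l (k + d)) (u.take i) D * SS e (u.drop i) k := by
  induction u generalizing D with
  | nil => simp
  | cons l t ih =>
    rw [List.length_cons, Finset.sum_range_succ']
    simp only [List.take_zero, List.drop_zero, List.take_succ_cons, List.drop_succ_cons, SS_nil,
      one_mul]
    rw [SS_cons, Finset.sum_range_add, ← SS_cons, add_comm]
    congr 1
    simp_rw [ih, SS_cons (fun l d => e l (k+d)), Finset.mul_sum, Finset.sum_mul]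
    rw [Finset.sum_comm]
    refine Finset.sum_congr rfl fun i _ => Finset.sum_congr rfl fun d _ => ?_
    ring
end Generic

section Oo
variable {k : Type*} [Field k]

/-- Laurent series of order at least `n`. -/
def oo (n : ℤ) : AddSubgroup (LaurentSeries k) where
  carrier := {x | ∀ m < n, x.coeff m = 0}
  zero_mem' := by intro m _; simp
  add_mem' := by
    intro a b ha hb m hm
    simp [ha m hm, hb m hm]
  neg_mem' := by
    intro a ha m hm
    simp [ha m hm]

lemma mem_oo {n : ℤ} {x : LaurentSeries k} : x ∈ oo n ↔ ∀ m < n, x.coeff m = 0 := Iff.rfl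

lemma mem_oo' {n : ℤ} {x : LaurentSeries k} : x ∈ oo n ↔ (n : WithTop ℤ) ≤ x.orderTop := by
  rw [HahnSeries.le_orderTop_iff_forall, mem_oo]
  simp

lemma oo_mono {a b : ℤ} (h : a ≤ b) {x : LaurentSeries k} (hx : x ∈ oo b) : x ∈ oo a :=
  fun m hm => hx m (lt_of_lt_of_le hm h)

lemma oo_mul {a b : ℤ} {x y : LaurentSeries k} (hx : x ∈ oo a) (hy : y ∈ oo b) :
    x * y ∈ oo (a + b) := by
  rw [mem_oo'] at *
  refine le_trans ?_ HahnSeries.orderTop_add_le_mul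
  push_cast
  exact add_le_add hx hy

lemma oo_one : (1 : LaurentSeries k) ∈ oo 0 := by
  intro m hm
  rw [HahnSeries.coeff_one, if_neg hm.ne]

lemma oo_pow {a : ℤ} {x : LaurentSeries k} (hx : x ∈ oo a) (n : ℕ) : x ^ n ∈ oo (n * a) := by
  induction n with
  | zero => simpa using oo_one
  | succ n ih =>
    rw [pow_succ]
    have := oo_mul ih hx
    convert this using 2
    push_cast; ring

lemma oo_C (c : k) : (HahnSeries.C c : LaurentSeries k) ∈ oo 0 := by
  intro m hm
  rw [HahnSeries.C_apply, HahnSeries.coeff_single_of_ne hm.ne]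

lemma oo_single (n : ℤ) (c : k) : (HahnSeries.single n c : LaurentSeries k) ∈ oo n := by
  intro m hm
  rw [HahnSeries.coeff_single_of_ne hm.ne]

lemma oo_prod {ι : Type*} (s : Finset ι) (f : ι → LaurentSeries k) (a : ι → ℤ)
    (h : ∀ i ∈ s, f i ∈ oo (a i)) : ∏ i ∈ s, f i ∈ oo (∑ i ∈ s, a i) := by
  induction s using Finset.cons_induction with
  | empty => simpa using oo_one
  | cons i s hi ih =>
    rw [Finset.prod_cons, Finset.sum_cons]
    exact oo_mul (h i (by simp)) (ih fun j hj => h j (by simp [hj]))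

lemma eq_zero_of_oo {x : LaurentSeries k} (h : ∀ n : ℕ, x ∈ oo (n : ℤ)) : x = 0 := by
  ext m
  exact h (m.toNat + 1) m (by omega)

lemma oo_inv {a : ℤ} {x : LaurentSeries k} (hx : x ∈ oo a) (hc : x.coeff a ≠ 0) :
    x⁻¹ ∈ oo (-a) := by
  have hx0 : x ≠ 0 := by rintro rfl; simp at hc
  have h1 : x.orderTop = a := by
    apply le_antisymm
    · exact HahnSeries.orderTop_le_of_coeff_ne_zero hc
    · exact mem_oo'.1 hx
  have h2 : x.orderTop + x⁻¹.orderTop = 0 := by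
    rw [← HahnSeries.orderTop_mul, mul_inv_cancel₀ hx0, HahnSeries.orderTop_one]
  rw [mem_oo']
  rw [h1] at h2
  have h3 : x⁻¹.orderTop ≠ ⊤ := by simp [hx0]
  obtain ⟨b, hb⟩ := WithTop.ne_top_iff_exists.1 h3
  rw [← hb] at h2 ⊢
  norm_cast at *
  omega

lemma valued_iff (x : LaurentSeries k) (D : ℤ) :
    Valued.v x ≤ WithZero.exp (-D) ↔ x ∈ oo D :=
  LaurentSeries.valuation_le_iff_coeff_lt_eq_zero k

lemma oo_isOpen (n : ℤ) : IsOpen ((oo n : AddSubgroup (LaurentSeries k)) : Set (LaurentSeries k)) := by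
  have : ((oo n : AddSubgroup (LaurentSeries k)) : Set (LaurentSeries k)) =
      {x | Valued.v.restrict x ≤ Valued.v.restrict (HahnSeries.single n (1 : k) : LaurentSeries k)} := by
    ext x
    refine (valued_iff x n).symm.trans ?_
    rw [← LaurentSeries.valuation_single_zpow k]
    exact Valued.v.restrict_le_iff.symm
  rw [this]
  refine Valued.isOpen_closedBall (LaurentSeries k) ?_
  simp

lemma oo_isClosed (n : ℤ) : IsClosed ((oo n : AddSubgroup (LaurentSeries k)) : Set (LaurentSeries k)) :=
  AddSubgroup.isClosed_of_isOpen _ (oo_isOpen n)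

lemma oo_basis : (𝓝 (0 : LaurentSeries k)).HasBasis (fun _ : ℕ => True)
    (fun n => ((oo (n : ℤ) : AddSubgroup (LaurentSeries k)) : Set (LaurentSeries k))) := by
  refine ⟨fun s => ?_⟩
  constructor
  · intro hs
    rw [Valued.mem_nhds_zero] at hs
    obtain ⟨γ, hγ⟩ := hs
    have h0 : MonoidWithZeroHom.ValueGroup₀.embedding γ.1 ≠ (0 : WithZero (Multiplicative ℤ)) := by
      simp
    obtain ⟨g, hg⟩ : ∃ g : ℤ, WithZero.exp g =
        MonoidWithZeroHom.ValueGroup₀.embedding γ.1 := ⟨_, WithZero.exp_log h0⟩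
    refine ⟨(1 - g).toNat, trivial, fun x hx => hγ ?_⟩
    show Valued.v.restrict x < γ.1
    rw [Valued.v.restrict_lt_iff_lt_embedding, ← hg]
    refine lt_of_le_of_lt ((valued_iff x _).2 hx) ?_
    rw [WithZero.exp_lt_exp]
    omega
  · rintro ⟨n, -, hn⟩
    exact mem_of_superset ((oo_isOpen n).mem_nhds (oo n).zero_mem) hn

lemma tendsto_iff_oo {ι : Type*} {F : Filter ι} (f : ι → LaurentSeries k) (L : LaurentSeries k) :
    Tendsto f F (𝓝 L) ↔ ∀ n : ℕ, ∀ᶠ i in F, f i - L ∈ oo (n : ℤ) := by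
  rw [← tendsto_sub_nhds_zero_iff, oo_basis.tendsto_right_iff]
  simp

lemma tendsto_zero_oo (f : ℕ → LaurentSeries k) (h : ∀ n : ℕ, f n ∈ oo (n : ℤ)) :
    Tendsto f atTop (𝓝 0) := by
  rw [tendsto_iff_oo]
  intro n
  filter_upwards [eventually_ge_atTop n] with i hi
  rw [sub_zero]
  exact oo_mono (by exact_mod_cast hi) (h i)

lemma lim_mem_oo {f : ℕ → LaurentSeries k} {L : LaurentSeries k} (h : Tendsto f atTop (𝓝 L)) {n : ℤ}
    (hf : ∀ᶠ i in atTop, f i ∈ oo n) : L ∈ oo n :=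
  (oo_isClosed n).mem_of_tendsto h hf

instance : NonarchimedeanAddGroup (LaurentSeries k) where
  is_nonarchimedean := by
    intro U hU
    obtain ⟨n, -, hn⟩ := oo_basis.mem_iff.1 hU
    exact ⟨⟨oo n, oo_isOpen n⟩, hn⟩

lemma summable_oo {ι : Type*} (t : ι → LaurentSeries k) (F : ℕ → Finset ι)
    (h : ∀ K : ℕ, ∀ i ∉ F K, t i ∈ oo (K : ℤ)) :
    Summable t ∧ Tendsto (fun K => ∑ i ∈ F K, t i) atTop (𝓝 (∑' i, t i)) := by
  have hs : Summable t := by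
    apply NonarchimedeanAddGroup.summable_of_tendsto_cofinite_zero
    rw [tendsto_iff_oo]
    intro n
    rw [eventually_cofinite]
    refine (F n).finite_toSet.subset fun i hi => ?_
    by_contra h'
    apply hi
    rw [sub_zero]
    exact h n i h'
  refine ⟨hs, ?_⟩
  rw [tendsto_iff_oo]
  intro n
  filter_upwards [eventually_ge_atTop n] with K hK
  rw [← neg_sub]
  refine (oo _).neg_mem ?_
  refine (oo_isClosed (n : ℤ)).mem_of_tendsto (hs.hasSum.sub_const (∑ i ∈ F K, t i)) ?_
  filter_upwards [eventually_ge_atTop (F K)] with G hG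
  rw [← Finset.sum_sdiff hG, add_sub_cancel_right]
  refine sum_mem fun i hi => ?_
  refine oo_mono (by exact_mod_cast hK) (h K i ?_)
  simp at hi; exact hi.2

lemma exists_lim_oo (f : ℕ → LaurentSeries k) (h : ∀ n : ℕ, f (n+1) - f n ∈ oo (n : ℤ)) :
    ∃ L, Tendsto f atTop (𝓝 L) ∧ ∀ n : ℕ, L - f n ∈ oo (n : ℤ) := by
  have h' : ∀ n d : ℕ, f (n + d) - f n ∈ oo (n : ℤ) := by
    intro n d
    induction d with
    | zero => simp [(oo (n : ℤ)).zero_mem]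
    | succ d ih =>
      have := (oo (n:ℤ)).add_mem (oo_mono (by simp) (h (n+d))) ih
      simpa [← add_assoc] using this
  have hs := (summable_oo (fun n => f (n+1) - f n) Finset.range (by
    intro K i hi
    simp at hi
    exact oo_mono (by exact_mod_cast hi) (h i))).2
  simp only [Finset.sum_range_sub] at hs
  have hs' := hs.add_const (f 0)
  simp only [sub_add_cancel] at hs'
  refine ⟨_, hs', fun n => ?_⟩
  refine lim_mem_oo (hs'.sub_const (f n)) ?_
  filter_upwards [eventually_ge_atTop n] with i hi
  obtain ⟨d, rfl⟩ := Nat.exists_eq_add_of_le hi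
  exact h' n d

lemma SS_oo {α : Type*} (e : α → ℕ → LaurentSeries k) (v : List α)
    (he : ∀ l ∈ v, ∀ d : ℕ, e l d ∈ oo (d : ℤ)) (D : ℕ) : SS e v D ∈ oo 0 := by
  induction v generalizing D with
  | nil => simpa using oo_one
  | cons l t ih =>
    rw [SS_cons]
    refine sum_mem fun d _ => ?_
    have := oo_mul (he l (by simp) d) (ih (fun l' h' => he l' (by simp [h'])) d)
    exact oo_mono (by omega) this

lemma SS_lim {α : Type*} (e : α → ℕ → LaurentSeries k) (v : List α)
    (he : ∀ l ∈ v, ∀ d : ℕ, e l d ∈ oo (d : ℤ)) :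
    ∃ L, Tendsto (SS e v) atTop (𝓝 L) ∧ ∀ n : ℕ, L - SS e v n ∈ oo (n : ℤ) := by
  apply exists_lim_oo
  intro n
  cases v with
  | nil => simp [(oo (n : ℤ)).zero_mem]
  | cons l t =>
    rw [SS_cons_succ, add_sub_cancel_left]
    simpa using oo_mul (he l (by simp) n) (SS_oo e t (fun l' h' => he l' (by simp [h'])) n)

end Oo

end

section
open Filter Topology

section Fam
variable {k : Type*} [Field k] {α : Type*}

/-- bounded strictly decreasing tuples -/
def Gfin (n K : ℕ) : Finset (Fin n → ℕ) :=
  (Fintype.piFinset fun _ => Finset.range K).filter StrictAnti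

lemma mem_Gfin {n K : ℕ} {f : Fin n → ℕ} : f ∈ Gfin n K ↔ (∀ i, f i < K) ∧ StrictAnti f := by
  simp [Gfin]

lemma strictAnti_cons {n : ℕ} (d : ℕ) (g : Fin n → ℕ) :
    StrictAnti (Fin.cons d g : Fin (n+1) → ℕ) ↔ (∀ i, g i < d) ∧ StrictAnti g := by
  constructor
  · intro h
    refine ⟨fun i => ?_, fun i j hij => ?_⟩
    · simpa using h (Fin.succ_pos i)
    · simpa using h (Fin.succ_lt_succ_iff.2 hij)
  · rintro ⟨h1, h2⟩ i j hij
    induction i using Fin.cases with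
    | zero =>
      induction j using Fin.cases with
      | zero => simp at hij
      | succ j => simpa using h1 j
    | succ i =>
      induction j using Fin.cases with
      | zero => simp at hij
      | succ j => simpa using h2 (Fin.succ_lt_succ_iff.1 hij)

lemma sum_Gfin {R : Type*} [CommRing R] (e : α → ℕ → R) {n : ℕ} (w : Fin n → α) (K : ℕ) :
    ∑ f ∈ Gfin n K, ∏ i, e (w i) (f i) = SS e (List.ofFn w) K := by
  induction n generalizing K with
  | zero =>
    have : Gfin 0 K = {Fin.elim0} := by
      ext f
      rw [mem_Gfin, Finset.mem_singleton]
      refine ⟨fun _ => Subsingleton.elim _ _, fun _ => ⟨fun i => i.elim0, fun i => i.elim0⟩⟩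
    simp [this]
  | succ n ih =>
    rw [List.ofFn_succ, SS_cons]
    simp_rw [← ih, Finset.mul_sum]
    rw [Finset.sum_sigma']
    refine Finset.sum_bij' (fun f _ => ⟨f 0, Fin.tail f⟩) (fun x _ => Fin.cons x.1 x.2) ?_ ?_ ?_ ?_ ?_
    · intro f hf
      rw [← Fin.cons_self_tail f, mem_Gfin, strictAnti_cons] at hf
      simp only [Finset.mem_sigma, Finset.mem_range, mem_Gfin]
      exact ⟨by simpa using hf.1 0, hf.2⟩
    · rintro ⟨d, g⟩ hx
      simp only [Finset.mem_sigma, Finset.mem_range, mem_Gfin] at hx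
      rw [mem_Gfin, strictAnti_cons]
      refine ⟨fun i => ?_, hx.2⟩
      induction i using Fin.cases with
      | zero => simpa using hx.1
      | succ i => simpa using (hx.2.1 i).trans hx.1
    · intro f _; exact Fin.cons_self_tail f
    · rintro ⟨d, g⟩ _; simp
    · intro f _
      rw [Fin.prod_univ_succ]; rfl

lemma tendsto_tsum_SS (e : α → ℕ → LaurentSeries k) {n : ℕ} (w : Fin n → α)
    (he : ∀ i, ∀ d : ℕ, e (w i) d ∈ oo (d : ℤ)) :
    Tendsto (SS e (List.ofFn w)) atTop
      (𝓝 (∑' f : {f : Fin n → ℕ // StrictAnti f}, ∏ i, e (w i) (f.1 i))) := by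
  have := (summable_oo (fun f : {f : Fin n → ℕ // StrictAnti f} => ∏ i, e (w i) (f.1 i))
    (fun K => (Gfin n K).subtype StrictAnti) (by
      intro K f hf
      rw [Finset.mem_subtype, mem_Gfin] at hf
      have : ∃ i, K ≤ f.1 i := by
        by_contra h
        push Not at h
        exact hf ⟨h, f.2⟩
      obtain ⟨i, hi⟩ := this
      refine oo_mono ?_ (oo_prod Finset.univ _ (fun i => (f.1 i : ℤ)) (fun i _ => he i _))
      rw [← Nat.cast_sum]
      exact_mod_cast hi.trans (Finset.single_le_sum (f := fun i => f.1 i) (fun _ _ => Nat.zero_le _) (Finset.mem_univ i)))).2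
  refine this.congr fun K => ?_
  rw [← sum_Gfin]
  exact Finset.sum_subtype_of_mem (fun f : Fin n → ℕ => ∏ i, e (w i) (f i)) (fun x hx => (mem_Gfin.1 hx).2)

lemma tsum_head_SS (e : α → ℕ → LaurentSeries k) {n : ℕ} (w : Fin (n+1) → α) (d : ℕ) :
    ∑' f : {f : Fin (n+1) → ℕ // StrictAnti f ∧ ∀ i : Fin (n+1), i.val = 0 → (f i : ℤ) = (d : ℤ)},
      ∏ i, e (w i) (f.1 i) = e (w 0) d * SS e (List.ofFn (fun i => w (Fin.succ i))) d := by
  have hset : {f : Fin (n+1) → ℕ | StrictAnti f ∧ ∀ i : Fin (n+1), i.val = 0 → (f i : ℤ) = (d : ℤ)}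
      = ↑((Gfin n d).image (fun g => (Fin.cons d g : Fin (n+1) → ℕ))) := by
    ext f
    simp only [Set.mem_ofPred_eq, Finset.coe_image, Set.mem_image, Finset.mem_coe]
    constructor
    · rintro ⟨h1, h2⟩
      have h3 : f 0 = d := by exact_mod_cast h2 0 rfl
      refine ⟨Fin.tail f, ?_, ?_⟩
      · rw [← Fin.cons_self_tail f, strictAnti_cons, h3] at h1
        exact mem_Gfin.2 h1
      · rw [← h3]; exact Fin.cons_self_tail f
    · rintro ⟨g, hg, rfl⟩
      rw [mem_Gfin] at hg
      refine ⟨(strictAnti_cons d g).2 hg, fun i hi => ?_⟩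
      have : i = 0 := Fin.ext hi
      subst this; simp
  have h1 := tsum_congr_set_coe (fun f : Fin (n+1) → ℕ => ∏ i, e (w i) (f i)) hset
  refine Eq.trans h1 ?_
  rw [Finset.tsum_subtype' _ (fun f : Fin (n+1) → ℕ => ∏ i, e (w i) (f i)), Finset.sum_image, ← sum_Gfin, Finset.mul_sum]
  · refine Finset.sum_congr rfl fun g _ => ?_
    rw [Fin.prod_univ_succ]; simp
  · intro a _ b _ h
    exact Fin.cons_right_injective (α := fun _ => ℕ) d h

end Fam

set_option linter.unusedSectionVars false

lemma qc_gt : 1 < qc Fq := Fintype.one_lt_card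

lemma theta_ne : theta Fq ≠ 0 := by
  rw [theta]; exact HahnSeries.single_ne_zero one_ne_zero

lemma theta_pow (n : ℕ) : theta Fq ^ n = HahnSeries.single (-(n : ℤ)) 1 := by
  rw [theta, HahnSeries.single_pow]; simp

lemma theta_pow_oo (n : ℕ) : theta Fq ^ n ∈ oo (-(n : ℤ)) := by
  rw [theta_pow]; exact oo_single _ _

lemma coeff_theta_pow (n : ℕ) (m : ℤ) : (theta Fq ^ n).coeff m = if m = -(n:ℤ) then 1 else 0 := by
  rw [theta_pow, HahnSeries.coeff_single]
  congr

lemma br_oo {a b : ℕ} (h : a < b) : (theta Fq ^ a - theta Fq ^ b)⁻¹ ∈ oo (b : ℤ) := by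
  have := oo_inv (a := -(b:ℤ)) (x := theta Fq ^ a - theta Fq ^ b)
    ((oo _).sub_mem (oo_mono (by omega) (theta_pow_oo Fq a)) (theta_pow_oo Fq b)) (by
      rw [HahnSeries.coeff_sub, coeff_theta_pow, coeff_theta_pow, if_neg (by omega), if_pos rfl]
      simp)
  simpa using this

lemma br_ne {a b : ℕ} (h : a < b) : (theta Fq ^ a - theta Fq ^ b) ≠ 0 := by
  intro h0
  have := congrArg (fun x => x.coeff (-(b:ℤ))) h0
  rw [HahnSeries.coeff_sub, coeff_theta_pow, coeff_theta_pow, HahnSeries.coeff_zero,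
    if_neg (by omega), if_pos rfl] at this
  simp at this

lemma ell_zero : ell Fq 0 = 1 := by simp [ell]
lemma ell_succ (d : ℕ) : ell Fq (d+1) = ell Fq d * (theta Fq - theta Fq ^ qc Fq ^ (d+1)) := by
  rw [ell, ell, Finset.prod_Icc_succ_top (by omega)]

lemma brk_ne (d : ℕ) : theta Fq - theta Fq ^ qc Fq ^ (d+1) ≠ 0 := by
  have := br_ne Fq (Nat.one_lt_pow (Nat.succ_ne_zero d) (qc_gt Fq))
  simpa using this

lemma ell_ne (d : ℕ) : ell Fq d ≠ 0 := by
  induction d with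
  | zero => simp [ell_zero]
  | succ d ih => rw [ell_succ]; exact mul_ne_zero ih (brk_ne Fq d)

lemma ell_inv_oo (d : ℕ) : (ell Fq d)⁻¹ ∈ oo (d : ℤ) := by
  induction d with
  | zero => simpa [ell_zero] using oo_one
  | succ d ih =>
    rw [ell_succ, mul_inv]
    have h1 := br_oo Fq (Nat.one_lt_pow (Nat.succ_ne_zero d) (qc_gt Fq))
    rw [pow_one] at h1
    refine oo_mono ?_ (oo_mul ih h1)
    have : 0 < qc Fq ^ (d+1) := Nat.pow_pos (by have := qc_gt Fq; omega)
    simp only [Nat.succ_eq_add_one]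
    omega

lemma cst_oo (c : Fb Fq) : cst Fq c ∈ oo 0 := oo_C c

/-- letters -/
abbrev Let := ℕ × Fb Fq

/-- Li letters -/
def eL (l : Let Fq) (d : ℕ) : Kinf Fq := cst Fq (l.2 ^ d) / ell Fq d ^ l.1

/-- zeta letters -/
def eZ (l : Let Fq) (d : ℕ) : Kinf Fq := cst Fq (l.2 ^ d) * ∑ c : Fin d → Fq, ((monicVal Fq d c)⁻¹) ^ l.1

lemma eL_oo {l : Let Fq} (h : 0 < l.1) (d : ℕ) : eL Fq l d ∈ oo (d : ℤ) := by
  rw [eL, div_eq_mul_inv, ← inv_pow]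
  refine oo_mono ?_ (oo_mul (cst_oo Fq _) (oo_pow (ell_inv_oo Fq d) l.1))
  rw [zero_add]
  have : 1 ≤ (l.1 : ℤ) := by exact_mod_cast h
  nlinarith

lemma monic_low_oo (d : ℕ) (c : Fin d → Fq) :
    ∑ j, cst Fq (algebraMap Fq (Fb Fq) (c j)) * theta Fq ^ (j : ℕ) ∈ oo (-(d : ℤ) + 1) := by
  refine sum_mem fun j _ => ?_
  refine oo_mono ?_ (oo_mul (cst_oo Fq _) (theta_pow_oo Fq j))
  have := j.2
  omega

lemma monic_coeff (d : ℕ) (c : Fin d → Fq) : (monicVal Fq d c).coeff (-(d:ℤ)) = 1 := by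
  rw [monicVal, HahnSeries.coeff_add, coeff_theta_pow, if_pos rfl,
    monic_low_oo Fq d c _ (by omega), add_zero]

lemma monic_ne (d : ℕ) (c : Fin d → Fq) : monicVal Fq d c ≠ 0 := by
  intro h
  have := monic_coeff Fq d c
  rw [h] at this
  simp at this

lemma monic_inv_oo (d : ℕ) (c : Fin d → Fq) : (monicVal Fq d c)⁻¹ ∈ oo (d : ℤ) := by
  have := oo_inv (a := -(d:ℤ)) (x := monicVal Fq d c)
    ((oo _).add_mem (theta_pow_oo Fq d) (oo_mono (by omega) (monic_low_oo Fq d c))) (by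
      rw [monic_coeff]; exact one_ne_zero)
  simpa using this

lemma eZ_oo {l : Let Fq} (h : 0 < l.1) (d : ℕ) : eZ Fq l d ∈ oo (d : ℤ) := by
  rw [eZ]
  have : ∑ c : Fin d → Fq, ((monicVal Fq d c)⁻¹) ^ l.1 ∈ oo (d : ℤ) := by
    refine sum_mem fun c _ => ?_
    refine oo_mono ?_ (oo_pow (monic_inv_oo Fq d c) l.1)
    have : 1 ≤ (l.1 : ℤ) := by exact_mod_cast h
    nlinarith
  exact oo_mono (by omega) (oo_mul (cst_oo Fq _) this)

/-- the word of an array -/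
def word {F : Type} (A : PArr F) : List (ℕ × F) := List.ofFn fun i => (A.s i, A.eps i)

lemma tendsto_Li (A : PArr (Fb Fq)) (h : ∀ i, 0 < A.s i) :
    Tendsto (SS (eL Fq) (word A)) atTop (𝓝 (Li Fq A)) :=
  tendsto_tsum_SS (eL Fq) (fun i => (A.s i, A.eps i)) (fun i d => eL_oo Fq (h i) d)

lemma tendsto_zeta (A : PArr (Fb Fq)) (h : ∀ i, 0 < A.s i) (hd : 0 < A.depth) :
    Tendsto (SS (eZ Fq) (word A)) atTop (𝓝 (zetaA Fq A)) := by
  obtain ⟨n, s, ε⟩ := A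
  cases n with
  | zero => simp at hd
  | succ n =>
  simp only at h
  set w : Fin (n+1) → Let Fq := fun i => (s i, ε i) with hw
  have hSd : ∀ d : ℕ, Sd Fq (d : ℤ) ⟨n+1, s, ε⟩ =
      eZ Fq (w 0) d * SS (eZ Fq) (List.ofFn (fun i => w (Fin.succ i))) d := by
    intro d
    rw [← tsum_head_SS (eZ Fq) w d, Sd]
    refine tsum_congr fun f => ?_
    simp only
    refine Eq.trans ?_ ((Fintype.prod_sum (κ := fun i : Fin (n+1) => Fin (f.1 i) → Fq)
      (fun i c => cst Fq (ε i ^ f.1 i) / monicVal Fq (f.1 i) c ^ s i)).symm.trans ?_)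
    · convert rfl
    refine Finset.prod_congr rfl fun i _ => ?_
    rw [eZ, Finset.mul_sum]
    refine Finset.sum_congr rfl fun c _ => ?_
    rw [div_eq_mul_inv, inv_pow]
  have hmem : ∀ d : ℕ, Sd Fq (d : ℤ) ⟨n+1, s, ε⟩ ∈ oo (d : ℤ) := by
    intro d
    rw [hSd]
    have := oo_mul (eZ_oo Fq (l := w 0) (h 0) d) (SS_oo (eZ Fq) (List.ofFn (fun i => w (Fin.succ i))) (by
      intro l hl
      rw [List.mem_ofFn] at hl
      obtain ⟨i, rfl⟩ := hl
      exact eZ_oo Fq (h _)) d)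
    simpa using this
  have := (summable_oo (fun d : ℕ => Sd Fq (d : ℤ) ⟨n+1, s, ε⟩) Finset.range (by
    intro K i hi
    simp at hi
    exact oo_mono (by exact_mod_cast hi) (hmem i))).2
  refine this.congr fun K => ?_
  rw [word, List.ofFn_succ, SS_cons]
  exact Finset.sum_congr rfl fun d _ => hSd d

end

section
open Filter Topology
set_option linter.unusedSectionVars false


/-- valid letters -/
def VL (N : ℕ) (l : Let Fq) : Prop := 0 < l.1 ∧ l.2 ^ N = 1

variable {Fq} in
lemma VL.mul {N : ℕ} {l m : Let Fq} (hl : VL Fq N l) (hm : VL Fq N m) :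
    VL Fq N (l.1 + m.1, l.2 * m.2) := ⟨Nat.add_pos_left hl.1 _, by simp [mul_pow, hl.2, hm.2]⟩

/-- weight of a word -/
def wtw {F : Type*} (v : List (ℕ × F)) : ℕ := (v.map Prod.fst).sum

@[simp] lemma wtw_nil {F : Type*} : wtw ([] : List (ℕ × F)) = 0 := rfl
@[simp] lemma wtw_cons {F : Type*} (l : ℕ × F) (v : List (ℕ × F)) : wtw (l :: v) = l.1 + wtw v := by
  simp [wtw]

lemma eL_mul (l m : Let Fq) (d : ℕ) : eL Fq (l.1 + m.1, l.2 * m.2) d = eL Fq l d * eL Fq m d := by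
  simp only [eL, mul_pow, map_mul, pow_add]
  rw [mul_div_mul_comm]

variable (R : Type) [CommRing R] [Algebra R (Kinf Fq)]

/-- prepending operator -/
def prep (l : Let Fq) : (ℕ → Kinf Fq) →ₗ[R] (ℕ → Kinf Fq) where
  toFun h D := ∑ d ∈ Finset.range D, eL Fq l d * h d
  map_add' f g := by ext D; simp [mul_add, Finset.sum_add_distrib]
  map_smul' r f := by
    ext D
    simp [Finset.smul_sum]

lemma prep_apply (l : Let Fq) (h : ℕ → Kinf Fq) (D : ℕ) :
    prep Fq R l h D = ∑ d ∈ Finset.range D, eL Fq l d * h d := rfl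

lemma prep_SS (l : Let Fq) (v : List (Let Fq)) : prep Fq R l (SS (eL Fq) v) = SS (eL Fq) (l :: v) := rfl

/-- span of nested sums of weight `w` -/
def LL (N w : ℕ) : Submodule R (ℕ → Kinf Fq) :=
  Submodule.span R {f | ∃ v : List (Let Fq), (∀ l ∈ v, VL Fq N l) ∧ wtw v = w ∧ f = SS (eL Fq) v}

variable {N : ℕ}

lemma SS_mem_LL {v : List (Let Fq)} (h : ∀ l ∈ v, VL Fq N l) : SS (eL Fq) v ∈ LL Fq R N (wtw v) :=
  Submodule.subset_span ⟨v, h, rfl, rfl⟩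

lemma one_mem_LL : (1 : ℕ → Kinf Fq) ∈ LL Fq R N 0 :=
  SS_mem_LL Fq R (v := []) (by simp)

lemma prep_mem_LL {l : Let Fq} (hl : VL Fq N l) {a : ℕ} {h : ℕ → Kinf Fq} (hh : h ∈ LL Fq R N a) :
    prep Fq R l h ∈ LL Fq R N (l.1 + a) := by
  have : (LL Fq R N a).map (prep Fq R l) ≤ LL Fq R N (l.1 + a) := by
    rw [LL, Submodule.map_span_le]
    rintro _ ⟨v, hv, rfl, rfl⟩
    rw [prep_SS, ← wtw_cons]
    exact SS_mem_LL Fq R (List.forall_mem_cons.2 ⟨hl, hv⟩)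
  exact this (Submodule.mem_map_of_mem hh)

lemma stuffle (l m : Let Fq) (f g : ℕ → Kinf Fq) :
    prep Fq R l f * prep Fq R m g = prep Fq R l (f * prep Fq R m g) + prep Fq R m (prep Fq R l f * g)
      + prep Fq R (l.1 + m.1, l.2 * m.2) (f * g) := by
  funext D
  simp only [Pi.add_apply, Pi.mul_apply]
  induction D with
  | zero => simp [prep_apply]
  | succ D ih =>
    have hs : ∀ l h, prep Fq R l h (D+1) = prep Fq R l h D + eL Fq l D * h D := by
      intro l h; simp [prep_apply, Finset.sum_range_succ]
    simp only [hs, eL_mul, Pi.mul_apply]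
    linear_combination ih

lemma SS_mul_mem (u v : List (Let Fq)) (hu : ∀ l ∈ u, VL Fq N l) (hv : ∀ l ∈ v, VL Fq N l) :
    SS (eL Fq) u * SS (eL Fq) v ∈ LL Fq R N (wtw u + wtw v) := by
  induction u generalizing v with
  | nil =>
    have : SS (eL Fq) [] = 1 := rfl
    rw [this, one_mul, wtw_nil, zero_add]; exact SS_mem_LL Fq R hv
  | cons l u ihu =>
    induction v with
    | nil =>
      have : SS (eL Fq) [] = 1 := rfl
      rw [this, mul_one, wtw_nil, add_zero]; exact SS_mem_LL Fq R hu
    | cons m v ihv =>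
      simp only [List.mem_cons, forall_eq_or_imp] at hu hv
      rw [← prep_SS Fq R, ← prep_SS Fq R, stuffle]
      refine Submodule.add_mem _ (Submodule.add_mem _ ?_ ?_) ?_
      · have := prep_mem_LL Fq R hu.1 (ihu (m :: v) hu.2 (List.forall_mem_cons.2 hv))
        rw [← prep_SS Fq R] at this
        convert this using 2
        simp; ring
      · have := prep_mem_LL Fq R hv.1 (ihv hv.2)
        rw [← prep_SS Fq R] at this
        convert this using 2
        simp; ring
      · have := prep_mem_LL Fq R (hu.1.mul hv.1) (ihu v hu.2 hv.2)
        convert this using 2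
        simp; ring

lemma mul_mem_LL {a b : ℕ} {f g : ℕ → Kinf Fq} (hf : f ∈ LL Fq R N a) (hg : g ∈ LL Fq R N b) :
    f * g ∈ LL Fq R N (a + b) := by
  have := Submodule.mul_mem_mul hf hg
  rw [LL, LL, Submodule.span_mul_span] at this
  revert this
  apply Submodule.span_le.2
  rintro _ ⟨_, ⟨u, hu, rfl, rfl⟩, _, ⟨v, hv, rfl, rfl⟩, rfl⟩
  exact SS_mul_mem Fq R u v hu hv

lemma pow_mem_LL {a : ℕ} {f : ℕ → Kinf Fq} (hf : f ∈ LL Fq R N a) (n : ℕ) :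
    f ^ n ∈ LL Fq R N (n * a) := by
  induction n with
  | zero => simpa using one_mem_LL Fq R
  | succ n ih =>
    rw [pow_succ]
    have := mul_mem_LL Fq R ih hf
    convert this using 2; ring

/-- functions with limit in a given subspace -/
def limSub (S : Subfield (Kinf Fq)) (hS : ∀ r : R, algebraMap R (Kinf Fq) r ∈ S)
    (M : Submodule S (Kinf Fq)) : Submodule R (ℕ → Kinf Fq) where
  carrier := {f | ∃ L ∈ M, Tendsto f atTop (𝓝 L)}
  zero_mem' := ⟨0, M.zero_mem, tendsto_const_nhds⟩
  add_mem' := by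
    rintro f g ⟨a, ha, hf⟩ ⟨b, hb, hg⟩
    exact ⟨a + b, M.add_mem ha hb, hf.add hg⟩
  smul_mem' := by
    rintro r f ⟨a, ha, hf⟩
    refine ⟨algebraMap R _ r * a, M.smul_mem ⟨_, hS r⟩ ha, ?_⟩
    have := hf.const_mul (algebraMap R (Kinf Fq) r)
    refine this.congr fun D => ?_
    rw [Pi.smul_apply, Algebra.smul_def]

end

section
open Filter Topology
set_option linter.unusedSectionVars false


/-- `1/ℓ_d` -/
def ei (d : ℕ) : Kinf Fq := (ell Fq d)⁻¹

lemma eL_one (s d : ℕ) : eL Fq (s, 1) d = ei Fq d ^ s := by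
  simp [eL, ei]

lemma eL_eq (l : Let Fq) (d : ℕ) : eL Fq l d = cst Fq (l.2 ^ d) * ei Fq d ^ l.1 := by
  simp [eL, ei, div_eq_mul_inv]

lemma ei_zero : ei Fq 0 = 1 := by simp [ei, ell_zero]
lemma ei_ne (d : ℕ) : ei Fq d ≠ 0 := inv_ne_zero (ell_ne Fq d)
lemma ei_succ (d : ℕ) : ei Fq (d+1) * (theta Fq - theta Fq ^ qc Fq ^ (d+1)) = ei Fq d := by
  rw [ei, ei, ell_succ]
  field_simp [ell_ne Fq d, brk_ne Fq d]

/-- coefficient functions -/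
def hc : ℕ → ℕ → Kinf Fq
  | 0, _ => 1
  | i+1, D => - ∑ d ∈ Finset.range D, eL Fq (qc Fq - 1, 1) d * hc i d ^ qc Fq

lemma hc_zero_of_lt (i D : ℕ) (h : D < i) : hc Fq i D = 0 := by
  induction i generalizing D with
  | zero => omega
  | succ i ih =>
    rw [hc, Finset.sum_eq_zero, neg_zero]
    intro d hd
    rw [Finset.mem_range] at hd
    rw [ih d (by omega), zero_pow (by have := qc_gt Fq; omega), mul_zero]

lemma hc_succ (i D : ℕ) : hc Fq (i+1) (D+1) = hc Fq (i+1) D - ei Fq D ^ (qc Fq - 1) * hc Fq i D ^ qc Fq := by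
  rw [hc, hc, Finset.sum_range_succ, eL_one]; ring

/-- the Frobenius -/
def fr : Kinf Fq →+* Kinf Fq :=
  letI : Algebra Fq (Kinf Fq) := ((cst Fq).comp (algebraMap Fq (Fb Fq))).toAlgebra
  (FiniteField.frobeniusAlgHom Fq (Kinf Fq)).toRingHom

lemma fr_apply (x : Kinf Fq) : fr Fq x = x ^ qc Fq := rfl

/-- Carlitz polynomials as maps -/
def EE : ℕ → (Kinf Fq →+ Kinf Fq)
  | 0 => AddMonoidHom.id _
  | d+1 => (AddMonoidHom.mulLeft (theta Fq ^ qc Fq ^ (d+1) - theta Fq)⁻¹).comp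
      ((fr Fq).toAddMonoidHom.comp (EE d) - EE d)

lemma brk_ne' (d : ℕ) : theta Fq ^ qc Fq ^ (d+1) - theta Fq ≠ 0 := by
  rw [← neg_sub]; exact neg_ne_zero.2 (brk_ne Fq d)

lemma EE_succ (d : ℕ) (x : Kinf Fq) :
    (theta Fq ^ qc Fq ^ (d+1) - theta Fq) * EE Fq (d+1) x = EE Fq d x ^ qc Fq - EE Fq d x := by
  simp only [EE, AddMonoidHom.comp_apply, AddMonoidHom.coe_mulLeft, AddMonoidHom.sub_apply]
  rw [mul_inv_cancel_left₀ (brk_ne' Fq d)]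
  rfl

lemma EE_zero (x : Kinf Fq) : EE Fq 0 x = x := rfl

lemma EE_theta (d : ℕ) (x : Kinf Fq) :
    EE Fq (d+1) (theta Fq * x) = theta Fq * EE Fq (d+1) x + EE Fq d x ^ qc Fq := by
  induction d with
  | zero =>
    apply mul_left_cancel₀ (brk_ne' Fq 0)
    rw [mul_add, mul_left_comm, EE_succ, EE_succ, EE_zero, EE_zero]
    ring
  | succ d ih =>
    apply mul_left_cancel₀ (brk_ne' Fq (d+1))
    rw [mul_add, mul_left_comm, EE_succ, EE_succ, ih]
    have h1 := congrArg (fr Fq) (EE_succ Fq d x)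
    rw [map_mul, map_sub, map_sub] at h1
    simp only [fr_apply] at h1
    have h2 : (theta Fq * (EE Fq (d+1)) x + (EE Fq d) x ^ qc Fq) ^ qc Fq =
      theta Fq ^ qc Fq * EE Fq (d+1) x ^ qc Fq + ((EE Fq d) x ^ qc Fq) ^ qc Fq := by
      rw [← fr_apply, map_add, map_mul]; rfl
    rw [h2]
    have h3 : (theta Fq ^ qc Fq ^ (d + 1)) ^ qc Fq = theta Fq ^ qc Fq ^ (d+1+1) := by
      rw [← pow_mul, ← pow_succ]
    rw [h3] at h1
    linear_combination -h1

lemma EE_one (d : ℕ) : EE Fq (d+1) 1 = 0 := by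
  induction d with
  | zero =>
    apply mul_left_cancel₀ (brk_ne' Fq 0)
    rw [EE_succ, EE_zero]; simp
  | succ d ih =>
    apply mul_left_cancel₀ (brk_ne' Fq (d+1))
    rw [EE_succ, ih, zero_pow (by have := qc_gt Fq; omega)]; simp

lemma EE_pow (d : ℕ) : (∀ j < d, EE Fq d (theta Fq ^ j) = 0) ∧ EE Fq d (theta Fq ^ d) = 1 := by
  induction d with
  | zero => simp [EE_zero]
  | succ d ih =>
    have h1 : ∀ j < d+1, EE Fq (d+1) (theta Fq ^ j) = 0 := by
      intro j
      induction j with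
      | zero => intro _; rw [pow_zero]; exact EE_one Fq d
      | succ j ihj =>
        intro hj
        rw [pow_succ', EE_theta, ihj (by omega), ih.1 j (by omega),
          zero_pow (by have := qc_gt Fq; omega)]; simp
    refine ⟨h1, ?_⟩
    rw [pow_succ', EE_theta, h1 d (by omega), ih.2]; simp

lemma EE_smul (d : ℕ) (c : Fq) (x : Kinf Fq) :
    EE Fq d (cst Fq (algebraMap Fq (Fb Fq) c) * x) = cst Fq (algebraMap Fq (Fb Fq) c) * EE Fq d x := by
  induction d with
  | zero => rfl
  | succ d ih =>
    apply mul_left_cancel₀ (brk_ne' Fq d)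
    rw [mul_left_comm, EE_succ, EE_succ, ih, mul_pow, ← map_pow, ← map_pow, qc, FiniteField.pow_card]
    ring

lemma EE_monic (d : ℕ) (c : Fin d → Fq) : EE Fq d (monicVal Fq d c) = 1 := by
  rw [monicVal, map_add, (EE_pow Fq d).2, map_sum, Finset.sum_eq_zero, add_zero]
  intro j _
  rw [EE_smul, (EE_pow Fq d).1 j j.2, mul_zero]

lemma EE_formula (d : ℕ) (x : Kinf Fq) (n : ℕ) (h : d < n) :
    EE Fq d x = ∑ i ∈ Finset.range n, ei Fq d * hc Fq i d * x ^ qc Fq ^ i := by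
  induction d generalizing n with
  | zero =>
    rw [EE_zero, Finset.sum_eq_single 0]
    · simp [ei_zero, hc]
    · intro i _ hi
      rw [hc_zero_of_lt Fq i 0 (by omega)]; simp
    · simp; omega
  | succ d ih =>
    obtain ⟨n, rfl⟩ : ∃ m, n = m + 1 := ⟨n - 1, by omega⟩
    apply mul_left_cancel₀ (brk_ne' Fq d)
    rw [EE_succ]
    nth_rw 2 [ih (n+1) (by omega)]
    rw [ih n (by omega), ← fr_apply, map_sum, Finset.sum_range_succ', Finset.sum_range_succ',
      mul_add, Finset.mul_sum, ← sub_sub, ← Finset.sum_sub_distrib]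
    simp only [fr_apply]
    have he := ei_succ Fq d
    have hq : ei Fq d ^ qc Fq = ei Fq d * ei Fq d ^ (qc Fq - 1) := by
      rw [← pow_succ']; congr 1; have := qc_gt Fq; omega
    rw [sub_eq_add_neg]
    congr 1
    · refine Finset.sum_congr rfl fun i _ => ?_
      rw [hc_succ, mul_pow, mul_pow, ← pow_mul x, ← pow_succ, hq]
      linear_combination ((hc Fq (i+1) d - ei Fq d ^ (qc Fq - 1) * hc Fq i d ^ qc Fq) * x ^ qc Fq ^ (i+1)) * he
    · simp only [hc]
      linear_combination (x ^ qc Fq ^ 0) * he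

lemma monic_inj (d : ℕ) : Function.Injective (monicVal Fq d) := by
  intro c c' h
  funext j
  have := congrArg (fun x => x.coeff (-((j : ℕ) : ℤ))) h
  have key : ∀ c : Fin d → Fq, (monicVal Fq d c).coeff (-((j : ℕ) : ℤ)) = algebraMap Fq (Fb Fq) (c j) := by
    intro c
    rw [monicVal, HahnSeries.coeff_add, coeff_theta_pow, if_neg (by have := j.2; omega), zero_add,
      HahnSeries.coeff_sum, Finset.sum_eq_single j]
    · rw [cst, HahnSeries.C_mul_eq_smul, HahnSeries.coeff_smul, coeff_theta_pow, if_pos rfl]; simp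
    · intro i _ hi
      rw [cst, HahnSeries.C_mul_eq_smul, HahnSeries.coeff_smul, coeff_theta_pow, if_neg]
      · simp
      · intro h; apply hi; apply Fin.ext; omega
    · simp
  simp only [key] at this
  exact (algebraMap Fq (Fb Fq)).injective this

end

section
open Filter Topology
set_option linter.unusedSectionVars false


/-- power sums -/
def Pw (d s : ℕ) : Kinf Fq := ∑ c : Fin d → Fq, ((monicVal Fq d c)⁻¹) ^ s

lemma qc_cast : (qc Fq : Kinf Fq) = 0 := by
  have : ((qc Fq : ℕ) : Fq) = 0 := FiniteField.cast_card_eq_zero Fq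
  have h2 := congrArg (fun x => cst Fq (algebraMap Fq (Fb Fq) x)) this
  simpa using h2

open Polynomial in
lemma Pw_poly (d : ℕ) : (1 - ∑ i ∈ Finset.range (d+1), C (ei Fq d * hc Fq i d) * X ^ qc Fq ^ i : (Kinf Fq)[X])
    = ∏ c : Fin d → Fq, (1 - C (monicVal Fq d c)⁻¹ * X) := by
  set pts : Option (Fin d → Fq) → Kinf Fq := fun o => o.elim 0 (monicVal Fq d) with hpts
  have hinj : Function.Injective pts := by
    rintro (_ | c) (_ | c') h
    · rfl
    · exact absurd h.symm (monic_ne Fq d c')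
    · exact absurd h (monic_ne Fq d c)
    · exact congrArg some (monic_inj Fq d h)
  have hcard : Fintype.card (Option (Fin d → Fq)) = qc Fq ^ d + 1 := by
    simp [qc]
  have hq := qc_gt Fq
  refine Polynomial.eq_of_natDegree_lt_card_of_eval_eq _ _ hinj ?_ ?_
  · rintro (_ | c)
    · simp only [hpts, Option.elim, eval_sub, eval_one, eval_finsetSum, eval_mul, eval_C, eval_pow, eval_X,
        eval_prod]
      rw [Finset.sum_eq_zero, Finset.prod_eq_one]
      · simp
      · simp
      · intro i _
        rw [zero_pow (by positivity), mul_zero]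
    · simp only [hpts, Option.elim, eval_sub, eval_one, eval_finsetSum, eval_mul, eval_C, eval_pow, eval_X,
        eval_prod]
      rw [← EE_formula Fq d _ (d+1) (by omega), EE_monic, sub_self]
      symm
      apply Finset.prod_eq_zero (Finset.mem_univ c)
      rw [inv_mul_cancel₀ (monic_ne Fq d c), sub_self]
  · rw [hcard, max_lt_iff]
    constructor
    · refine Nat.lt_succ_of_le ((natDegree_sub_le _ _).trans (max_le (by simp) ?_))
      refine natDegree_sum_le_of_forall_le _ _ fun i hi => ?_
      refine (natDegree_C_mul_X_pow_le _ _).trans ?_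
      rw [Finset.mem_range] at hi
      exact Nat.pow_le_pow_right (by omega) (by omega)
    · refine Nat.lt_succ_of_le ((natDegree_prod_le _ _).trans ?_)
      refine (Finset.sum_le_card_nsmul _ _ 1 fun c _ => ?_).trans ?_
      · refine (natDegree_sub_le _ _).trans (max_le (by simp) ?_)
        exact (natDegree_C_mul_le _ _).trans natDegree_X_le
      · simp [qc]

open Polynomial in
lemma Pw_deriv (d : ℕ) : (∑ c : Fin d → Fq, (∏ c' ∈ Finset.univ.erase c, (1 - C (monicVal Fq d c')⁻¹ * X)) *
    C (monicVal Fq d c)⁻¹ : (Kinf Fq)[X]) = C (ei Fq d) := by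
  have h := congrArg derivative (Pw_poly Fq d)
  rw [derivative_prod_finset] at h
  simp only [derivative_sub, derivative_one, derivative_C_mul, derivative_X, zero_sub, mul_one] at h
  have h' : (∑ c : Fin d → Fq, (∏ c' ∈ Finset.univ.erase c, (1 - C (monicVal Fq d c')⁻¹ * X)) *
    C (monicVal Fq d c)⁻¹ : (Kinf Fq)[X]) =
    derivative (∑ i ∈ Finset.range (d + 1), C (ei Fq d * hc Fq i d) * X ^ qc Fq ^ i) := by
    rw [← neg_neg (derivative _), h, eq_neg_iff_add_eq_zero, ← Finset.sum_add_distrib]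
    refine Finset.sum_eq_zero fun c _ => ?_
    ring
  rw [h', derivative_sum, Finset.sum_eq_single 0]
  · simp [hc]
  · intro i _ hi
    rw [derivative_C_mul, derivative_X_pow]
    push_cast
    rw [qc_cast, zero_pow hi]; simp
  · simp

lemma Pw_ps (d : ℕ) : (1 - ∑ i ∈ Finset.range (d+1), PowerSeries.C (ei Fq d * hc Fq i d) * PowerSeries.X ^ qc Fq ^ i) *
    (PowerSeries.mk fun n => Pw Fq d (n+1)) = PowerSeries.C (ei Fq d) := by
  have h1 : (1 - ∑ i ∈ Finset.range (d+1), PowerSeries.C (ei Fq d * hc Fq i d) * PowerSeries.X ^ qc Fq ^ i) =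
      ∏ c : Fin d → Fq, (1 - PowerSeries.C (monicVal Fq d c)⁻¹ * PowerSeries.X) := by
    have := congrArg (Polynomial.coeToPowerSeries.ringHom (R := Kinf Fq)) (Pw_poly Fq d)
    simp only [map_sub, map_one, map_sum, map_prod, map_mul, map_pow] at this
    simpa using this
  have h2 : (∑ c : Fin d → Fq, (∏ c' ∈ Finset.univ.erase c, (1 - PowerSeries.C (monicVal Fq d c')⁻¹ * PowerSeries.X)) *
    PowerSeries.C (monicVal Fq d c)⁻¹ ) = PowerSeries.C (ei Fq d) := by
    have := congrArg (Polynomial.coeToPowerSeries.ringHom (R := Kinf Fq)) (Pw_deriv Fq d)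
    simp only [map_sub, map_one, map_sum, map_prod, map_mul, map_pow] at this
    simpa using this
  have h3 : (PowerSeries.mk fun n => Pw Fq d (n+1)) = ∑ c : Fin d → Fq, PowerSeries.C (monicVal Fq d c)⁻¹ *
      PowerSeries.mk (fun n => (monicVal Fq d c)⁻¹ ^ n) := by
    ext1 n
    rw [PowerSeries.coeff_mk, map_sum, Pw]
    refine Finset.sum_congr rfl fun c _ => ?_
    rw [PowerSeries.coeff_C_mul, PowerSeries.coeff_mk, pow_succ']
  have h4 : ∀ b : Kinf Fq, (1 - PowerSeries.C b * PowerSeries.X) * PowerSeries.mk (fun n => b ^ n) = 1 := by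
    intro b
    ext1 n
    rw [sub_mul, one_mul, mul_assoc, map_sub, PowerSeries.coeff_C_mul]
    cases n with
    | zero => simp
    | succ n =>
      rw [PowerSeries.coeff_succ_X_mul, PowerSeries.coeff_mk, PowerSeries.coeff_mk, PowerSeries.coeff_one]
      rw [if_neg (by omega)]; ring
  rw [h1, h3, Finset.mul_sum, ← h2]
  refine Finset.sum_congr rfl fun c _ => ?_
  rw [← Finset.mul_prod_erase Finset.univ _ (Finset.mem_univ c)]
  have := h4 (monicVal Fq d c)⁻¹
  linear_combination ((∏ c' ∈ Finset.univ.erase c, (1 - PowerSeries.C (monicVal Fq d c')⁻¹ * PowerSeries.X)) *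
    PowerSeries.C (monicVal Fq d c)⁻¹) * this

lemma Pw_rec (d n : ℕ) : Pw Fq d (n+1) = (if n = 0 then ei Fq d else 0) +
    ∑ i ∈ Finset.range n, if qc Fq ^ i ≤ n then ei Fq d * hc Fq i d * Pw Fq d (n + 1 - qc Fq ^ i) else 0 := by
  have h := congrArg (PowerSeries.coeff n) (Pw_ps Fq d)
  rw [sub_mul, one_mul, map_sub, PowerSeries.coeff_mk, Finset.sum_mul, map_sum, PowerSeries.coeff_C] at h
  rw [sub_eq_iff_eq_add] at h
  rw [h]
  congr 1
  have hq := qc_gt Fq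
  have h1 : ∀ i, PowerSeries.coeff n (PowerSeries.C (ei Fq d * hc Fq i d) * PowerSeries.X ^ qc Fq ^ i *
      PowerSeries.mk fun n => Pw Fq d (n + 1)) =
      if qc Fq ^ i ≤ n then ei Fq d * hc Fq i d * Pw Fq d (n + 1 - qc Fq ^ i) else 0 := by
    intro i
    rw [mul_assoc, PowerSeries.coeff_C_mul, PowerSeries.coeff_X_pow_mul']
    split_ifs with h
    · rw [PowerSeries.coeff_mk, Nat.sub_add_comm h]
    · simp
  simp only [h1]
  have h2 := Finset.sum_subset (Finset.range_subset_range.2 (show d + 1 ≤ n + d + 1 by omega))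
    (f := fun i => if qc Fq ^ i ≤ n then ei Fq d * hc Fq i d * Pw Fq d (n + 1 - qc Fq ^ i) else 0) (by
      intro i _ hi
      rw [Finset.mem_range] at hi
      rw [hc_zero_of_lt Fq i d (by omega)]; simp)
  have h3 := Finset.sum_subset (Finset.range_subset_range.2 (show n ≤ n + d + 1 by omega))
    (f := fun i => if qc Fq ^ i ≤ n then ei Fq d * hc Fq i d * Pw Fq d (n + 1 - qc Fq ^ i) else 0) (by
      intro i _ hi
      rw [Finset.mem_range] at hi
      rw [if_neg]
      have := Nat.lt_pow_self (n := i) hq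
      omega)
  rw [h2, h3]

end

section
open Filter Topology
set_option linter.unusedSectionVars false

variable (R : Type) [CommRing R] [Algebra R (Kinf Fq)] (N : ℕ)

lemma hc_mem (i : ℕ) : hc Fq i ∈ LL Fq R N (qc Fq ^ i - 1) := by
  have hq := qc_gt Fq
  induction i with
  | zero =>
    have : hc Fq 0 = 1 := by funext D; rfl
    rw [this, pow_zero, Nat.sub_self]; exact one_mem_LL Fq R
  | succ i ih =>
    have h1 := prep_mem_LL Fq R (N := N) (l := (qc Fq - 1, 1)) ⟨by simp; omega, by simp⟩ (pow_mem_LL Fq R ih (qc Fq))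
    have h2 : hc Fq (i+1) = - prep Fq R (qc Fq - 1, 1) (hc Fq i ^ qc Fq) := by
      funext D; rfl
    rw [h2]
    refine Submodule.neg_mem _ ?_
    convert h1 using 2
    have : 1 ≤ qc Fq ^ i := Nat.one_le_pow _ _ (by omega)
    zify [this, show 1 ≤ qc Fq ^ (i+1) from Nat.one_le_pow _ _ (by omega), hq.le]
    ring

/-- lower terms -/
def Low (s : ℕ) : Submodule R (ℕ → Kinf Fq) :=
  Submodule.span R {f | ∃ r h, 1 ≤ r ∧ r < s ∧ h ∈ LL Fq R N (s - r) ∧ f = ei Fq ^ r * h}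

variable {N}

lemma Low_mul {s b : ℕ} {f g : ℕ → Kinf Fq} (hf : f ∈ Low Fq R N s) (hg : g ∈ LL Fq R N b) :
    ei Fq * g * f ∈ Low Fq R N (s + 1 + b) := by
  have : (Low Fq R N s).map (LinearMap.mulLeft R (ei Fq * g)) ≤ Low Fq R N (s + 1 + b) := by
    rw [Low, Submodule.map_span_le]
    rintro _ ⟨r, h, h1, h2, h3, rfl⟩
    refine Submodule.subset_span ⟨r+1, h * g, by omega, by omega, ?_, ?_⟩
    · have := mul_mem_LL Fq R h3 hg
      convert this using 2; omega
    · rw [LinearMap.mulLeft_apply]; ring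
  exact this (Submodule.mem_map_of_mem hf)

lemma Pw_low (n : ℕ) : (fun d => Pw Fq d (n+1)) - ei Fq ^ (n+1) ∈ Low Fq R N (n+1) := by
  induction n using Nat.strong_induction_on with
  | _ n ih =>
  have hq := qc_gt Fq
  rcases Nat.eq_zero_or_pos n with rfl | hn
  · convert Submodule.zero_mem _ using 1
    funext d
    simp [Pw_rec Fq d 0]
  · obtain ⟨n, rfl⟩ : ∃ m, n = m + 1 := ⟨n - 1, by omega⟩
    have h1 : (fun d => Pw Fq d (n+1+1)) - ei Fq ^ (n+1+1) =
        ei Fq * 1 * ((fun d => Pw Fq d (n+1)) - ei Fq ^ (n+1)) +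
        ∑ i ∈ Finset.range n, if qc Fq ^ (i+1) ≤ n+1 then
          ei Fq * hc Fq (i+1) * (fun d => Pw Fq d (n + 1 + 1 - qc Fq ^ (i+1))) else 0 := by
      funext d
      rw [Pi.sub_apply, Pw_rec Fq d (n+1), if_neg (by omega), Finset.sum_range_succ']
      simp only [Pi.add_apply, Pi.mul_apply, Pi.sub_apply, Pi.pow_apply, Pi.one_apply, Finset.sum_apply]
      have : ∀ i, (if qc Fq ^ (i+1) ≤ n+1 then
          ei Fq * hc Fq (i+1) * (fun d => Pw Fq d (n + 1 + 1 - qc Fq ^ (i+1))) else 0) d =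
          if qc Fq ^ (i+1) ≤ n+1 then ei Fq d * hc Fq (i+1) d * Pw Fq d (n + 1 + 1 - qc Fq ^ (i+1)) else 0 := by
        intro i; split_ifs <;> rfl
      have hc0 : ∀ d, hc Fq 0 d = 1 := fun _ => rfl
      simp only [this, hc0, pow_zero]
      rw [if_pos (by omega)]
      simp only [Nat.add_sub_cancel]
      ring
    rw [h1]
    refine Submodule.add_mem _ ?_ (Submodule.sum_mem _ fun i hi => ?_)
    · have := Low_mul Fq R (ih n (by omega)) (one_mem_LL Fq R (N := N))
      simpa only [add_zero] using this
    · split_ifs with hle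
      · have h2 : 2 ≤ qc Fq ^ (i+1) := by
          calc 2 ≤ qc Fq := hq
            _ ≤ qc Fq ^ (i+1) := Nat.le_self_pow (by omega) _
        set Q := qc Fq ^ (i+1) with hQ
        have hh := hc_mem Fq R N (i+1)
        rw [← hQ] at hh
        obtain ⟨m, hm⟩ : ∃ m, n + 1 + 1 - Q = m + 1 := ⟨n + 1 - Q, by omega⟩
        rw [hm]
        have h3 : ei Fq * hc Fq (i+1) * (fun d => Pw Fq d (m+1)) =
          ei Fq * hc Fq (i+1) * ((fun d => Pw Fq d (m+1)) - ei Fq ^ (m+1)) + ei Fq ^ (m+2) * hc Fq (i+1) := by ring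
        rw [h3]
        refine Submodule.add_mem _ ?_ ?_
        · have := Low_mul Fq R (ih m (by omega)) hh
          convert this using 2; omega
        · refine Submodule.subset_span ⟨m+2, _, by omega, by omega, ?_, rfl⟩
          convert hh using 2; omega
      · exact Submodule.zero_mem _

/-- generic summation with character -/
def prepF (ε : Fb Fq) : (ℕ → Kinf Fq) →ₗ[R] (ℕ → Kinf Fq) where
  toFun h D := ∑ d ∈ Finset.range D, cst Fq (ε ^ d) * h d
  map_add' f g := by ext D; simp [mul_add, Finset.sum_add_distrib]
  map_smul' r f := by
    ext D
    simp [Finset.smul_sum]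

lemma prepF_apply (ε : Fb Fq) (h : ℕ → Kinf Fq) (D : ℕ) :
    prepF Fq R ε h D = ∑ d ∈ Finset.range D, cst Fq (ε ^ d) * h d := rfl

lemma prep_eq_prepF (l : Let Fq) (h : ℕ → Kinf Fq) : prep Fq R l h = prepF Fq R l.2 (ei Fq ^ l.1 * h) := by
  funext D
  rw [prep_apply, prepF_apply]
  refine Finset.sum_congr rfl fun d _ => ?_
  rw [eL_eq, Pi.mul_apply, Pi.pow_apply]; ring

lemma SSZ_eq (l : Let Fq) (v : List (Let Fq)) :
    SS (eZ Fq) (l :: v) = prepF Fq R l.2 ((fun d => Pw Fq d l.1) * SS (eZ Fq) v) := by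
  funext D
  rw [SS_cons, prepF_apply]
  refine Finset.sum_congr rfl fun d _ => ?_
  rw [eZ, Pi.mul_apply, Pw]; ring

lemma Low_prepF {s a : ℕ} {ε : Fb Fq} (M : Submodule R (ℕ → Kinf Fq))
    (hM : ∀ r, 1 ≤ r → r < s → ∀ g ∈ LL Fq R N (s - r + a), prep Fq R (r, ε) g ∈ M)
    {f h : ℕ → Kinf Fq} (hf : f ∈ Low Fq R N s) (hh : h ∈ LL Fq R N a) : prepF Fq R ε (f * h) ∈ M := by
  have : (Low Fq R N s).map (prepF Fq R ε ∘ₗ LinearMap.mulRight R h) ≤ M := by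
    rw [Low, Submodule.map_span_le]
    rintro _ ⟨r, g, h1, h2, h3, rfl⟩
    have := hM r h1 h2 (g * h) (mul_mem_LL Fq R h3 hh)
    rw [prep_eq_prepF] at this
    rw [LinearMap.comp_apply, LinearMap.mulRight_apply, mul_assoc]
    exact this
  exact this (Submodule.mem_map_of_mem hf)

variable (N)
/-- span of zeta sums -/
def LZ (w : ℕ) : Submodule R (ℕ → Kinf Fq) :=
  Submodule.span R {f | ∃ v : List (Let Fq), (∀ l ∈ v, VL Fq N l) ∧ wtw v = w ∧ f = SS (eZ Fq) v}
variable {N}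

lemma prepF_Pw (s : ℕ) (ε : Fb Fq) (h : ℕ → Kinf Fq) :
    prepF Fq R ε ((fun d => Pw Fq d s) * h) = prep Fq R (s, ε) h +
      prepF Fq R ε (((fun d => Pw Fq d s) - ei Fq ^ s) * h) := by
  rw [prep_eq_prepF, ← map_add]; congr 1; ring

lemma LZ_le_LL (w : ℕ) : LZ Fq R N w ≤ LL Fq R N w := by
  refine Submodule.span_le.2 ?_
  rintro _ ⟨v, hv, rfl, rfl⟩
  induction v with
  | nil => exact one_mem_LL Fq R
  | cons l t ih =>
    rw [List.forall_mem_cons] at hv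
    have ht := ih hv.2
    obtain ⟨⟨s, ε⟩, hs, hε⟩ : ∃ l' : Let Fq, 0 < l'.1 ∧ l = l' := ⟨l, hv.1.1, rfl⟩
    subst hε
    obtain ⟨s, rfl⟩ : ∃ m, s = m + 1 := ⟨s - 1, by simp at hs; omega⟩
    rw [SSZ_eq Fq R, prepF_Pw]
    refine Submodule.add_mem _ ?_ ?_
    · rw [wtw_cons]; exact prep_mem_LL Fq R hv.1 ht
    · refine Low_prepF Fq R _ ?_ (Pw_low Fq R s) ht
      intro r h1 h2 g hg
      have := prep_mem_LL Fq R (l := (r, ε)) (N := N) ⟨h1, hv.1.2⟩ hg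
      convert this using 2
      simp; omega

lemma LL_le_LZ (w : ℕ) : LL Fq R N w ≤ LZ Fq R N w := by
  induction w using Nat.strong_induction_on with
  | _ w ih =>
  have key : ∀ s a : ℕ, s + 1 + a = w → ∀ ε : Fb Fq, ε ^ N = 1 → ∀ h ∈ LL Fq R N a,
      prep Fq R (s+1, ε) h ∈ LZ Fq R N w := by
    intro s
    induction s using Nat.strong_induction_on with
    | _ s ihs =>
    intro a hw ε hε h hh
    have h1 : prep Fq R (s+1, ε) h = prepF Fq R ε ((fun d => Pw Fq d (s+1)) * h) -
      prepF Fq R ε (((fun d => Pw Fq d (s+1)) - ei Fq ^ (s+1)) * h) := by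
      rw [prepF_Pw]; ring
    rw [h1]
    refine Submodule.sub_mem _ ?_ ?_
    · have h2 := ih a (by omega) hh
      have : (LZ Fq R N a).map (prepF Fq R ε ∘ₗ LinearMap.mulLeft R (fun d => Pw Fq d (s+1))) ≤ LZ Fq R N w := by
        rw [LZ, Submodule.map_span_le]
        rintro _ ⟨v, hv, rfl, rfl⟩
        refine Submodule.subset_span ⟨(s+1, ε) :: v, List.forall_mem_cons.2 ⟨⟨by simp, hε⟩, hv⟩, by simp; omega, ?_⟩
        rw [SSZ_eq Fq R]; rfl
      exact this (Submodule.mem_map_of_mem h2)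
    · refine Low_prepF Fq R _ ?_ (Pw_low Fq R s) hh
      intro r h1 h2 g hg
      obtain ⟨r, rfl⟩ : ∃ m, r = m + 1 := ⟨r - 1, by omega⟩
      exact ihs r (by omega) _ (by omega) ε hε g hg
  refine Submodule.span_le.2 ?_
  rintro _ ⟨v, hv, hw, rfl⟩
  cases v with
  | nil =>
    exact Submodule.subset_span ⟨[], by simp, hw, rfl⟩
  | cons l t =>
    rw [List.forall_mem_cons] at hv
    obtain ⟨⟨s, ε⟩, hs, hε⟩ : ∃ l' : Let Fq, 0 < l'.1 ∧ l = l' := ⟨l, hv.1.1, rfl⟩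
    subst hε
    obtain ⟨s, rfl⟩ : ∃ m, s = m + 1 := ⟨s - 1, by simp at hs; omega⟩
    exact key s (wtw t) (by simpa using hw) ε hv.1.2 _ (SS_mem_LL Fq R hv.2)

end

section
open Filter Topology
set_option linter.unusedSectionVars false

variable (R : Type) [CommRing R] [Algebra R (Kinf Fq)] (N : ℕ)

/-- good letters -/
def GdL (l : Let Fq) : Prop := VL Fq N l ∧ ¬ qc Fq ∣ l.1

/-- good sums together with boundary terms -/
def GP (w : ℕ) : Submodule R (ℕ → Kinf Fq) :=
  Submodule.span R ({f | ∃ v : List (Let Fq), (∀ l ∈ v, GdL Fq N l) ∧ wtw v = w ∧ f = SS (eL Fq) v} ∪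
    {f | ∃ (l : Let Fq) (v : List (Let Fq)), VL Fq N l ∧ (∀ l ∈ v, GdL Fq N l) ∧ l.1 + wtw v = w ∧
      f = eL Fq l * SS (eL Fq) v})

variable {N}

lemma mul_GP {l : Let Fq} (hl : VL Fq N l) {a : ℕ} {h : ℕ → Kinf Fq} (hh : h ∈ GP Fq R N a) :
    eL Fq l * h ∈ GP Fq R N (l.1 + a) := by
  have : (GP Fq R N a).map (LinearMap.mulLeft R (eL Fq l)) ≤ GP Fq R N (l.1 + a) := by
    rw [GP, Submodule.map_span_le]
    rintro _ (⟨v, hv, rfl, rfl⟩ | ⟨m, v, hm, hv, rfl, rfl⟩)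
    · exact Submodule.subset_span (Or.inr ⟨l, v, hl, hv, rfl, rfl⟩)
    · refine Submodule.subset_span (Or.inr ⟨_, v, hl.mul hm, hv, by simp; ring, ?_⟩)
      rw [LinearMap.mulLeft_apply, ← mul_assoc]
      congr 1
      funext d
      rw [eL_mul]; rfl
  exact this (Submodule.mem_map_of_mem hh)

variable (N) in
/-- sums whose tail is good -/
def HH (w : ℕ) : Submodule R (ℕ → Kinf Fq) :=
  Submodule.span R {f | ∃ (l : Let Fq) (v : List (Let Fq)), VL Fq N l ∧ (∀ l ∈ v, GdL Fq N l) ∧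
    l.1 + wtw v = w ∧ f = SS (eL Fq) (l :: v)}

lemma prep_GP {l : Let Fq} (hl : VL Fq N l) {a : ℕ} {h : ℕ → Kinf Fq} (hh : h ∈ GP Fq R N a) :
    prep Fq R l h ∈ HH Fq R N (l.1 + a) := by
  have : (GP Fq R N a).map (prep Fq R l) ≤ HH Fq R N (l.1 + a) := by
    rw [GP, Submodule.map_span_le]
    rintro _ (⟨v, hv, rfl, rfl⟩ | ⟨m, v, hm, hv, rfl, rfl⟩)
    · exact Submodule.subset_span ⟨l, v, hl, hv, rfl, rfl⟩
    · refine Submodule.subset_span ⟨_, v, hl.mul hm, hv, by simp; ring, ?_⟩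
      funext D
      rw [SS_cons, prep_apply]
      refine Finset.sum_congr rfl fun d _ => ?_
      rw [eL_mul, Pi.mul_apply, mul_assoc]
  exact this (Submodule.mem_map_of_mem hh)

/-- the auxiliary sum -/
def tt : ℕ → Kinf Fq := prep Fq R (qc Fq - 1, 1) 1

lemma tt_succ (d : ℕ) : tt Fq R (d+1) = tt Fq R d + ei Fq d ^ (qc Fq - 1) := by
  simp [tt, prep_apply, Finset.sum_range_succ, eL_one]

lemma tt_zero : tt Fq R 0 = 0 := by simp [tt, prep_apply]

lemma tt_mem : tt Fq R ∈ LL Fq R N (qc Fq - 1) := by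
  have := prep_mem_LL Fq R (N := N) (l := (qc Fq - 1, 1)) ⟨by have := qc_gt Fq; simp; omega, by simp⟩ (one_mem_LL Fq R)
  rw [tt]; simpa using this

lemma ei_pow_q (d : ℕ) : ei Fq d ^ qc Fq = ell Fq 1 * ei Fq (d+1) * tt Fq R (d+1) := by
  have hq := qc_gt Fq
  have hb := brk_ne Fq
  induction d with
  | zero =>
    have : ei Fq 1 = (ell Fq 1)⁻¹ := rfl
    rw [tt_succ, tt_zero, ei_zero, this, mul_inv_cancel₀ (ell_ne Fq 1)]; simp
  | succ d ih =>
    rw [tt_succ]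
    have h2 := ei_succ Fq (d+1)
    have h1 := ei_succ Fq d
    have hl : ell Fq 1 = theta Fq - theta Fq ^ qc Fq := by simp [ell]
    have hfr : (theta Fq - theta Fq ^ qc Fq ^ (d+1)) ^ qc Fq = theta Fq ^ qc Fq - theta Fq ^ qc Fq ^ (d+1+1) := by
      rw [← fr_apply, map_sub, fr_apply, fr_apply, ← pow_mul, ← pow_succ]
    have h3 : ei Fq (d+1) ^ qc Fq = ei Fq (d+1) * ei Fq (d+1) ^ (qc Fq - 1) := by
      rw [← pow_succ']; congr 1; omega
    rw [← h1, mul_pow, hfr] at ih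
    have hne : theta Fq - theta Fq ^ qc Fq ^ (d+1+1) ≠ 0 := by
      intro h0; rw [h0, mul_zero] at h2; exact ei_ne Fq _ h2.symm
    apply mul_right_cancel₀ hne
    rw [hl] at ih ⊢
    linear_combination ih + (theta Fq - theta Fq ^ qc Fq) * h3
      - (theta Fq - theta Fq ^ qc Fq) * (tt Fq R (d+1) + ei Fq (d+1) ^ (qc Fq - 1)) * h2

lemma key_sum (m : ℕ) (hm : 0 < m) (ε ε' : Fb Fq) (hε : ε' * ε = 1) (g : ℕ → Kinf Fq) (D : ℕ) :
    prep Fq R (m * qc Fq, ε) g D = cst Fq ε' * ell Fq 1 ^ m * (prep Fq R (m, ε) (tt Fq R ^ m * g) D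
      + eL Fq (m, ε) D * (tt Fq R ^ m * g) D) - prep Fq R (m * qc Fq, ε) (fun d => g (d+1) - g d) D := by
  have h0 : prep Fq R (m, ε) (tt Fq R ^ m * g) D + eL Fq (m, ε) D * (tt Fq R ^ m * g) D =
    ∑ d ∈ Finset.range D, eL Fq (m, ε) (d+1) * (tt Fq R ^ m * g) (d+1) := by
    rw [prep_apply, ← Finset.sum_range_succ, Finset.sum_range_succ']
    simp [tt_zero, hm.ne']
  rw [h0, prep_apply, prep_apply, Finset.mul_sum, ← Finset.sum_sub_distrib]
  refine Finset.sum_congr rfl fun d _ => ?_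
  have h1 : cst Fq ε' * cst Fq ε = 1 := by rw [← map_mul, hε, map_one]
  simp only [eL_eq, Pi.mul_apply, Pi.pow_apply]
  have h2 : ei Fq d ^ (m * qc Fq) = ell Fq 1 ^ m * ei Fq (d+1) ^ m * tt Fq R (d+1) ^ m := by
    rw [mul_comm m, pow_mul, ei_pow_q Fq R, mul_pow, mul_pow]
  rw [h2]
  simp only [pow_succ, map_mul]
  linear_combination (- ell Fq 1 ^ m * ei Fq (d+1) ^ m * tt Fq R (d+1) ^ m * cst Fq (ε ^ d) * g (d+1)) * h1

lemma step (hNpos : 0 < N) (lam : R) (hlam : algebraMap R (Kinf Fq) lam = ell Fq 1)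
    (hcst : ∀ ε : Fb Fq, ε ^ N = 1 → ∃ c : R, algebraMap R (Kinf Fq) c = cst Fq ε) (w : ℕ)
    (ih : ∀ a < w, LL Fq R N a ≤ GP Fq R N a) :
    HH Fq R N w ≤ GP Fq R N w ⊔ (Ideal.span {lam}) • LL Fq R N w := by
  rw [HH, Submodule.span_le]
  rintro _ ⟨⟨s, ε⟩, v, hl, hv, hw, rfl⟩
  simp only at hw
  by_cases hq : qc Fq ∣ s
  swap
  · refine Submodule.mem_sup_left (Submodule.subset_span (Or.inl ⟨_, List.forall_mem_cons.2 ⟨⟨hl, hq⟩, hv⟩, ?_, rfl⟩))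
    simpa using hw
  obtain ⟨m, rfl⟩ := hq
  have hqg := qc_gt Fq
  have hm : 0 < m := by rcases Nat.eq_zero_or_pos m with rfl | h; · simpa using hl.1
                        · exact h
  have hε0 : ε ^ N = 1 := hl.2
  have hε : ε ^ (N-1) * ε = 1 := by rw [← pow_succ, ← hε0]; congr 1; omega
  obtain ⟨c, hc⟩ := hcst (ε ^ (N-1)) (by rw [← pow_mul, mul_comm, pow_mul, hε0, one_pow])
  have hvL : ∀ l ∈ v, VL Fq N l := fun l h => (hv l h).1
  set g := SS (eL Fq) v with hg
  have hgL : g ∈ LL Fq R N (wtw v) := SS_mem_LL Fq R hvL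
  have htg : tt Fq R ^ m * g ∈ LL Fq R N (m * (qc Fq - 1) + wtw v) := mul_mem_LL Fq R (pow_mem_LL Fq R (tt_mem Fq R) m) hgL
  have hmw : m + (m * (qc Fq - 1) + wtw v) = w := by
    rw [← hw]
    obtain ⟨q', hq'⟩ : ∃ q', qc Fq = q' + 1 := ⟨qc Fq - 1, by omega⟩
    rw [hq']; simp; ring
  have hVm : VL Fq N ((m, ε) : Let Fq) := ⟨hm, hε0⟩
  have e1 : SS (eL Fq) ((qc Fq * m, ε) :: v) = (c * lam ^ m) • prep Fq R (m, ε) (tt Fq R ^ m * g)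
     + (c * lam ^ m) • (eL Fq (m, ε) * (tt Fq R ^ m * g)) - prep Fq R (m * qc Fq, ε) (fun d => g (d+1) - g d) := by
    rw [← prep_SS Fq R, mul_comm (qc Fq)]
    funext D
    rw [key_sum Fq R m hm ε _ hε]
    simp only [Pi.add_apply, Pi.sub_apply, Pi.smul_apply]
    have hcl : algebraMap R (Kinf Fq) (c * lam ^ m) = cst Fq (ε ^ (N-1)) * ell Fq 1 ^ m := by
      rw [map_mul, map_pow, hc, hlam]
    rw [Algebra.smul_def, Algebra.smul_def, hcl, ← hg]
    simp only [Pi.mul_apply]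
    ring
  rw [SetLike.mem_coe, e1]
  refine Submodule.sub_mem _ (Submodule.add_mem _ ?_ ?_) ?_
  · refine Submodule.mem_sup_right (Submodule.smul_mem_smul ?_ ?_)
    · obtain ⟨m, rfl⟩ : ∃ m', m = m' + 1 := ⟨m - 1, by omega⟩
      exact Ideal.mem_span_singleton.2 ⟨c * lam ^ m, by ring⟩
    · have := prep_mem_LL Fq R hVm htg
      simpa only [hmw] using this
  · refine Submodule.mem_sup_left (Submodule.smul_mem _ _ ?_)
    have := mul_GP Fq R hVm (ih _ (by omega) htg)
    simpa only [hmw] using this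
  · refine Submodule.mem_sup_left ?_
    cases v with
    | nil =>
      have : (fun d => g (d+1) - g d) = 0 := by funext d; simp [hg]
      rw [this, map_zero]; exact Submodule.zero_mem _
    | cons p t =>
      rw [List.forall_mem_cons] at hv
      obtain ⟨r, δ⟩ := p
      refine Submodule.subset_span (Or.inl ⟨(m * qc Fq + r, ε * δ) :: t, List.forall_mem_cons.2 ⟨⟨?_, ?_⟩, hv.2⟩, ?_, ?_⟩)
      · exact VL.mul (l := (m * qc Fq, ε)) (m := (r, δ)) ⟨by positivity, hε0⟩ hv.1.1
      · intro h
        exact hv.1.2 ((Nat.dvd_add_right (Dvd.intro_left m rfl)).1 h)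
      · rw [← hw, wtw_cons, wtw_cons]; simp only; ring
      · funext D
        rw [prep_apply, SS_cons]
        refine Finset.sum_congr rfl fun d _ => ?_
        rw [hg, SS_cons_succ, eL_mul Fq (m * qc Fq, ε) (r, δ)]
        ring

lemma words_finite (hNpos : 0 < N) (w : ℕ) :
    {v : List (Let Fq) | (∀ l ∈ v, VL Fq N l) ∧ wtw v = w}.Finite := by
  induction w using Nat.strong_induction_on with
  | _ w ih =>
  have hfin : {x : Fb Fq | x ^ N = 1}.Finite := by
    refine ((Polynomial.nthRoots N (1 : Fb Fq)).toFinset.finite_toSet).subset ?_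
    intro x hx
    simpa [Polynomial.mem_nthRoots hNpos] using hx
  have hS : {l : Let Fq | (0 < l.1 ∧ l.1 ≤ w) ∧ l.2 ^ N = 1}.Finite := by
    refine (((Set.finite_Icc 1 w)).prod hfin).subset ?_
    rintro ⟨s, ε⟩ ⟨⟨h1, h2⟩, h3⟩
    exact ⟨⟨h1, h2⟩, h3⟩
  refine ((Set.finite_singleton []).union (hS.biUnion (t := fun l => (List.cons l) '' {v : List (Let Fq) | (∀ l ∈ v, VL Fq N l) ∧ wtw v = w - l.1}) ?_)).subset ?_
  · rintro l ⟨⟨h1, h2⟩, h3⟩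
    exact (ih _ (by omega)).image _
  · rintro (_ | ⟨l, v⟩) ⟨h1, h2⟩
    · exact Or.inl rfl
    · right
      rw [List.forall_mem_cons] at h1
      rw [wtw_cons] at h2
      refine Set.mem_biUnion (x := l) ⟨⟨h1.1.1, by omega⟩, h1.1.2⟩ ⟨v, ⟨h1.2, by omega⟩, rfl⟩

lemma LL_fg (hNpos : 0 < N) (w : ℕ) : (LL Fq R N w).FG := by
  refine Submodule.fg_span (((words_finite Fq hNpos w).image (SS (eL Fq))).subset ?_)
  rintro _ ⟨v, h1, h2, rfl⟩
  exact ⟨v, ⟨h1, h2⟩, rfl⟩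

lemma LL_le_GP (hNpos : 0 < N) (lam : R) (hlam : algebraMap R (Kinf Fq) lam = ell Fq 1)
    (hJ : Ideal.span {lam} ≤ Ideal.jacobson ⊥)
    (hcst : ∀ ε : Fb Fq, ε ^ N = 1 → ∃ c : R, algebraMap R (Kinf Fq) c = cst Fq ε) (w : ℕ) :
    LL Fq R N w ≤ GP Fq R N w := by
  induction w using Nat.strong_induction_on with
  | _ w ih =>
  refine Submodule.le_of_le_smul_of_le_jacobson_bot (LL_fg Fq R hNpos w) hJ ?_
  refine le_trans ?_ (sup_le le_sup_left (step Fq R hNpos lam hlam hcst w ih))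
  rw [LL, Submodule.span_le]
  rintro _ ⟨(_ | ⟨l, v⟩), h1, h2, rfl⟩
  · exact Submodule.mem_sup_left (Submodule.subset_span (Or.inl ⟨[], by simp, h2, rfl⟩))
  · rw [List.forall_mem_cons] at h1
    rw [wtw_cons] at h2
    have hl := h1.1.1
    have := prep_GP Fq R h1.1 (ih (wtw v) (by omega) (SS_mem_LL Fq R h1.2))
    rw [h2, prep_SS] at this
    exact Submodule.mem_sup_right this

end

section
open Filter Topology
set_option linter.unusedSectionVars false


/-- evaluation of polynomials at theta -/
def pK : Polynomial (Fb Fq) →+* Kinf Fq := Polynomial.eval₂RingHom (cst Fq) (theta Fq)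

lemma pK_C (c : Fb Fq) : pK Fq (Polynomial.C c) = cst Fq c := by simp [pK]
lemma pK_X : pK Fq Polynomial.X = theta Fq := by simp [pK]

lemma pK_coeff (p : Polynomial (Fb Fq)) (n : ℤ) :
    (pK Fq p).coeff n = if n ≤ 0 then p.coeff (-n).toNat else 0 := by
  induction p using Polynomial.induction_on' with
  | add p q hp hq =>
    rw [map_add, HahnSeries.coeff_add, hp, hq]
    split_ifs <;> simp
  | monomial m a =>
    have : pK Fq (Polynomial.monomial m a) = HahnSeries.single (-(m:ℤ)) a := by
      rw [← Polynomial.C_mul_X_pow_eq_monomial, map_mul, map_pow, pK_C, pK_X, theta_pow, cst,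
        HahnSeries.C_apply, HahnSeries.single_mul_single, zero_add, mul_one]
    rw [this, HahnSeries.coeff_single, Polynomial.coeff_monomial]
    by_cases h : n = -(m:ℤ)
    · subst h; simp
    · rw [if_neg h]
      split_ifs with h1 h2
      · omega
      · rfl
      · rfl

lemma pK_inj : Function.Injective (pK Fq) := by
  rw [injective_iff_map_eq_zero]
  intro p hp
  ext n
  have := pK_coeff Fq p (-(n:ℤ))
  rw [hp] at this
  simpa using this.symm

lemma theta_mem_KNf (N : ℕ) : theta Fq ∈ KNf Fq N := Subfield.subset_closure (Or.inr rfl)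
lemma cst_mem_KNf {N : ℕ} {x : Fb Fq} (h : x ∈ kN Fq N) : cst Fq x ∈ KNf Fq N :=
  Subfield.subset_closure (Or.inl ⟨x, h, rfl⟩)

variable (N : ℕ)
/-- constants into the function field -/
def gc : kN Fq N →+* KNf Fq N :=
  ((cst Fq).comp (kN Fq N).subtype).codRestrict (KNf Fq N) (fun x => cst_mem_KNf Fq x.2)

/-- polynomial ring into function field -/
def gA : Polynomial (kN Fq N) →+* KNf Fq N := Polynomial.eval₂RingHom (gc Fq N) ⟨theta Fq, theta_mem_KNf Fq N⟩

lemma gA_coe (p : Polynomial (kN Fq N)) : (gA Fq N p : Kinf Fq) = pK Fq (p.map (kN Fq N).subtype) := by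
  have : (KNf Fq N).subtype.comp (gA Fq N) = (pK Fq).comp (Polynomial.mapRingHom (kN Fq N).subtype) := by
    apply Polynomial.ringHom_ext
    · intro a; simp [gA, pK_C, gc]
    · simp [gA, pK_X]
  exact congrArg (fun f => f p) this

lemma gA_inj : Function.Injective (gA Fq N) := by
  intro p q h
  have := congrArg (fun x : KNf Fq N => (x : Kinf Fq)) h
  simp only [gA_coe] at this
  exact Polynomial.map_injective _ (Subfield.subtype_injective _) (pK_inj Fq this)

instance : (Ideal.span {(Polynomial.X : Polynomial (kN Fq N))}).IsPrime :=
  (Ideal.span_singleton_prime Polynomial.X_ne_zero).2 Polynomial.prime_X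

/-- local ring -/
abbrev OO := Localization.AtPrime (Ideal.span {(Polynomial.X : Polynomial (kN Fq N))})

/-- local ring into function field -/
def gO : OO Fq N →+* KNf Fq N :=
  IsLocalization.lift (M := (Ideal.span {(Polynomial.X : Polynomial (kN Fq N))}).primeCompl) (g := gA Fq N) (by
    rintro ⟨y, hy⟩
    rw [isUnit_iff_ne_zero, map_ne_zero_iff _ (gA_inj Fq N)]
    rintro rfl
    exact hy (Submodule.zero_mem _))

lemma gO_map (p : Polynomial (kN Fq N)) : gO Fq N (algebraMap _ _ p) = gA Fq N p := IsLocalization.lift_eq _ _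

instance algOO : Algebra (OO Fq N) (Kinf Fq) := ((KNf Fq N).subtype.comp (gO Fq N)).toAlgebra

lemma algOO_mem (r : OO Fq N) : algebraMap (OO Fq N) (Kinf Fq) r ∈ KNf Fq N := (gO Fq N r).2

lemma algOO_map (p : Polynomial (kN Fq N)) :
    algebraMap (OO Fq N) (Kinf Fq) (algebraMap _ _ p) = pK Fq (p.map (kN Fq N).subtype) := by
  rw [← gA_coe, ← gO_map]; rfl

variable {N}

lemma LL_le_GP' (hN : 0 < N) (w : ℕ) : LL Fq (OO Fq N) N w ≤ GP Fq (OO Fq N) N w := by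
  have hq := qc_gt Fq
  refine LL_le_GP Fq (OO Fq N) hN (algebraMap (Polynomial (kN Fq N)) _ (Polynomial.X - Polynomial.X ^ qc Fq)) ?_ ?_ ?_ w
  · rw [algOO_map]; simp [pK_X, ell]
  · rw [Ideal.span_singleton_le_iff_mem, IsLocalRing.jacobson_eq_maximalIdeal _ bot_ne_top,
      IsLocalization.AtPrime.to_map_mem_maximal_iff _ (Ideal.span {(Polynomial.X : Polynomial (kN Fq N))})]
    refine Submodule.sub_mem _ (Ideal.mem_span_singleton_self _) (Ideal.mem_span_singleton.2 (dvd_pow_self _ (by omega)))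
  · intro ε hε
    have : ε ∈ kN Fq N := Subfield.subset_closure (Or.inr hε)
    refine ⟨algebraMap _ _ (Polynomial.C (⟨ε, this⟩ : kN Fq N)), ?_⟩
    rw [algOO_map]; simp [pK_C]

/-- the array of a word -/
def arr (v : List (Let Fq)) : PArr (Fb Fq) := ⟨v.length, fun i => (v.get i).1, fun i => (v.get i).2⟩

lemma word_arr (v : List (Let Fq)) : word (arr Fq v) = v := by
  simp [word, arr]

lemma arr_wt (v : List (Let Fq)) : (arr Fq v).wt = wtw v := by
  rw [PArr.wt, arr, wtw]
  simp only
  conv_rhs => rw [← List.ofFn_get v]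
  rw [List.map_ofFn, List.sum_ofFn]; rfl

lemma wt_word (A : PArr (Fb Fq)) : wtw (word A) = A.wt := by
  rw [wtw, word, List.map_ofFn, List.sum_ofFn]; rfl

lemma mem_word (A : PArr (Fb Fq)) (l : Let Fq) : l ∈ word A ↔ ∃ i, (A.s i, A.eps i) = l := by
  simp [word, List.mem_ofFn]

lemma arr_pos {v : List (Let Fq)} (h : ∀ l ∈ v, VL Fq N l) : (arr Fq v).Positive N :=
  ⟨fun i => (h _ (List.get_mem v i)).1, fun i => (h _ (List.get_mem v i)).2⟩

lemma VL_word {A : PArr (Fb Fq)} (h : A.Positive N) : ∀ l ∈ word A, VL Fq N l := by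
  intro l hl
  obtain ⟨i, rfl⟩ := (mem_word Fq A l).1 hl
  exact ⟨h.1 i, h.2 i⟩

lemma tendsto_arr {v : List (Let Fq)} (h : ∀ l ∈ v, VL Fq N l) :
    Tendsto (SS (eL Fq) v) atTop (𝓝 (Li Fq (arr Fq v))) := by
  have := tendsto_Li Fq (arr Fq v) (arr_pos Fq h).1
  rwa [word_arr] at this

lemma CZ_eq_CL {w : ℕ} (hw : 0 < w) : CZ Fq N w = CL Fq N w := by
  have hdep : ∀ A : PArr (Fb Fq), A.wt = w → 0 < A.depth := by
    intro A hA
    rcases Nat.eq_zero_or_pos A.depth with h | h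
    · obtain ⟨n, s, e⟩ := A
      simp only at h
      subst h
      simp [PArr.wt] at hA; omega
    · exact h
  apply le_antisymm
  · rw [CZ, Submodule.span_le]
    rintro _ ⟨A, hA, hAw, rfl⟩
    have h1 : LL Fq (OO Fq N) N w ≤ limSub Fq (OO Fq N) (KNf Fq N) (algOO_mem Fq N) (CL Fq N w) := by
      rw [LL, Submodule.span_le]
      rintro _ ⟨v, hv, rfl, rfl⟩
      exact ⟨_, Submodule.subset_span ⟨arr Fq v, arr_pos Fq hv, arr_wt Fq v, rfl⟩, tendsto_arr Fq hv⟩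
    obtain ⟨L, hL, hT⟩ := h1 (LZ_le_LL Fq (OO Fq N) w (Submodule.subset_span ⟨word A, VL_word Fq hA, by rw [wt_word, hAw], rfl⟩))
    rwa [SetLike.mem_coe, tendsto_nhds_unique (tendsto_zeta Fq A hA.1 (hdep A hAw)) hT]
  · rw [CL, Submodule.span_le]
    rintro _ ⟨A, hA, hAw, rfl⟩
    have h1 : LZ Fq (OO Fq N) N w ≤ limSub Fq (OO Fq N) (KNf Fq N) (algOO_mem Fq N) (CZ Fq N w) := by
      rw [LZ, Submodule.span_le]
      rintro _ ⟨v, hv, hvw, rfl⟩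
      refine ⟨_, Submodule.subset_span ⟨arr Fq v, arr_pos Fq hv, (arr_wt Fq v).trans hvw, rfl⟩, ?_⟩
      have := tendsto_zeta Fq (arr Fq v) (arr_pos Fq hv).1 (hdep _ ((arr_wt Fq v).trans hvw))
      rwa [word_arr] at this
    obtain ⟨L, hL, hT⟩ := h1 (LL_le_LZ Fq (OO Fq N) w (Submodule.subset_span ⟨word A, VL_word Fq hA, by rw [wt_word, hAw], rfl⟩))
    rwa [SetLike.mem_coe, tendsto_nhds_unique (tendsto_Li Fq A hA.1) hT]

lemma span_eq (hN : 0 < N) {w : ℕ} (hw : 0 < w) :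
    Submodule.span (KNf Fq N) (Set.range fun A : SwIdx Fq N w => Li Fq A.1) = CZ Fq N w := by
  rw [CZ_eq_CL Fq hw]
  apply le_antisymm
  · rw [Submodule.span_le]
    rintro _ ⟨A, rfl⟩
    exact Submodule.subset_span ⟨A.1, A.2.1, A.2.2.2.1, rfl⟩
  · rw [CL, Submodule.span_le]
    rintro _ ⟨A, hA, hAw, rfl⟩
    have h1 : GP Fq (OO Fq N) N w ≤ limSub Fq (OO Fq N) (KNf Fq N) (algOO_mem Fq N)
        (Submodule.span (KNf Fq N) (Set.range fun A : SwIdx Fq N w => Li Fq A.1)) := by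
      rw [GP, Submodule.span_le]
      rintro _ (⟨v, hv, hvw, rfl⟩ | ⟨l, v, hl, hv, hvw, rfl⟩)
      · have hvL : ∀ l ∈ v, VL Fq N l := fun l h => (hv l h).1
        refine ⟨_, Submodule.subset_span ⟨⟨arr Fq v, arr_pos Fq hvL, ?_, (arr_wt Fq v).trans hvw, ?_⟩, rfl⟩, tendsto_arr Fq hvL⟩
        · cases v with
          | nil => simp at hvw; omega
          | cons a t => simp [arr]
        · exact fun i => (hv _ (List.get_mem v i)).2
      · have hvL : ∀ l ∈ v, VL Fq N l := fun l h => (hv l h).1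
        refine ⟨0, Submodule.zero_mem _, ?_⟩
        have := (tendsto_zero_oo (eL Fq l) (eL_oo Fq hl.1)).mul (tendsto_arr Fq hvL)
        rwa [zero_mul] at this
    obtain ⟨L, hL, hT⟩ := h1 (LL_le_GP' Fq hN w (Submodule.subset_span ⟨word A, VL_word Fq hA, by rw [wt_word, hAw], rfl⟩))
    rwa [SetLike.mem_coe, tendsto_nhds_unique (tendsto_Li Fq A hA.1) hT]

end

section
open Filter Topology
set_option linter.unusedSectionVars false

section FI
open Polynomial
variable {k : Type*} [Field k] {α : Type*} [Fintype α] (q : ℕ) (s : α → ℕ) (ε : α → k)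

/-- Cartier section -/
def La (r : ℕ) (f : k[X]) : k[X] := ∑ i ∈ Finset.range (f.natDegree + 1), monomial i (f.coeff (q * i + r))

variable {q}
lemma La_coeff (hq : 1 < q) (r : ℕ) (f : k[X]) (i : ℕ) : (La q r f).coeff i = f.coeff (q * i + r) := by
  rw [La, finsetSum_coeff]
  simp only [coeff_monomial]
  rw [Finset.sum_ite_eq' (Finset.range (f.natDegree + 1)) i]
  split_ifs with h
  · rfl
  · rw [coeff_eq_zero_of_natDegree_lt]
    rw [Finset.mem_range] at h
    nlinarith

lemma La_add (hq : 1 < q) (r : ℕ) (f g : k[X]) : La q r (f + g) = La q r f + La q r g := by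
  ext i; simp [La_coeff hq]

lemma La_zero (r : ℕ) : La q r (0 : k[X]) = 0 := by simp [La]

lemma La_sum (hq : 1 < q) (r : ℕ) {ι : Type*} (S : Finset ι) (f : ι → k[X]) :
    La q r (∑ i ∈ S, f i) = ∑ i ∈ S, La q r (f i) := by
  ext i; simp [La_coeff hq]

lemma La_C_mul (hq : 1 < q) (r : ℕ) (c : k) (f : k[X]) : La q r (C c * f) = C c * La q r f := by
  ext i; simp [La_coeff hq]

lemma La_expand (hq : 1 < q) {r : ℕ} (hr : r < q) (a b : k[X]) : La q r (a * expand k q b) = La q r a * b := by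
  induction b using Polynomial.induction_on' with
  | add f g hf hg => rw [map_add, mul_add, La_add hq, hf, hg, mul_add]
  | monomial m c =>
    ext i
    rw [La_coeff hq, expand_monomial, ← C_mul_X_pow_eq_monomial, ← C_mul_X_pow_eq_monomial, ← mul_assoc, ← mul_assoc,
      coeff_mul_X_pow', coeff_mul_X_pow', coeff_mul_C, coeff_mul_C, La_coeff hq]
    by_cases h : m ≤ i
    · obtain ⟨j, rfl⟩ := Nat.exists_eq_add_of_le h
      rw [if_pos h, if_pos (by nlinarith)]
      congr 2
      have : q * (m + j) + r = m * q + (q * j + r) := by ring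
      rw [this, Nat.add_sub_cancel_left, Nat.add_sub_cancel_left]
    · rw [if_neg h, if_neg]
      push Not at h ⊢
      nlinarith

lemma La_deg (hq : 1 < q) (r : ℕ) (f : k[X]) (b : ℕ) (h : f.natDegree ≤ b) : (La q r f).natDegree ≤ b / q := by
  rw [natDegree_le_iff_coeff_eq_zero]
  intro i hi
  rw [La_coeff hq]
  apply coeff_eq_zero_of_natDegree_lt
  have := (Nat.div_lt_iff_lt_mul (by omega)).1 hi
  nlinarith

variable (q)
/-- words of bounded length -/
def Wd : ℕ → Finset (List α)
  | 0 => {[]}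
  | n+1 => insert [] ((Finset.univ ×ˢ Wd n).image fun x => x.1 :: x.2)

lemma mem_Wd (n : ℕ) (v : List α) : v ∈ Wd n ↔ v.length ≤ n := by
  induction n generalizing v with
  | zero => simp [Wd]
  | succ n ih =>
    cases v <;> simp [Wd, ih]

lemma sum_Wd {M : Type*} [AddCommMonoid M] (n : ℕ) (f : List α → M) :
    ∑ v ∈ Wd (n+1), f v = f [] + ∑ t ∈ Wd n, ∑ l, f (l :: t) := by
  rw [Wd, Finset.sum_insert (by simp), Finset.sum_image (by
    rintro ⟨a, b⟩ _ ⟨c, d⟩ _ h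
    simpa using h), Finset.sum_product_right]

/-- the basic letters -/
def eP (l : α) (d : ℕ) : k[X] := C (ε l ^ d) * X ^ (s l * q ^ d)

/-- reversed sums -/
def GG (v : List α) (D : ℕ) : k[X] := SS (eP q s ε) v.reverse D

/-- total character -/
def ch (v : List α) : k := (v.map ε).prod

lemma eP_succ (l : α) (d : ℕ) : eP q s ε l (d+1) = C (ε l) * expand k q (eP q s ε l d) := by
  simp only [eP, map_mul, expand_C, map_pow, expand_X]
  ring

lemma SS_snoc {R : Type*} [CommRing R] (e : α → ℕ → R) (t : List α) (l : α) (D : ℕ) :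
    SS e (t ++ [l]) (D+1) = SS (fun l d => e l (d+1)) (t ++ [l]) D + SS (fun l d => e l (d+1)) t D * e l 0 := by
  induction t generalizing D with
  | nil => simp [SS_cons, Finset.sum_range_succ']
  | cons m t ih =>
    rw [List.cons_append, SS_cons, Finset.sum_range_succ', SS_cons, SS_cons, Finset.sum_mul, ← Finset.sum_add_distrib]
    have : SS e (t ++ [l]) 0 = 0 := by
      cases t <;> simp [SS_cons_zero]
    rw [this, mul_zero, add_zero]
    refine Finset.sum_congr rfl fun d _ => ?_
    rw [ih]; ring

lemma SS_shift (v : List α) (D : ℕ) : SS (fun l d => eP q s ε l (d+1)) v D = C (ch ε v) * expand k q (SS (eP q s ε) v D) := by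
  have : SS (fun l d => eP q s ε l (d+1)) v D = SS (fun l d => C (ε l) * expand k q (eP q s ε l d)) v D :=
    SS_congr v (fun l _ d => eP_succ q s ε l d) D
  rw [this, SS_scale (fun l d => expand k q (eP q s ε l d)) (fun l => C (ε l))]
  congr 1
  · rw [ch, map_list_prod, List.map_map]; rfl
  · exact (SS_map ((expand k q : k[X] →ₐ[k] k[X]) : k[X] →+* k[X]) (eP q s ε) v D).symm

lemma ch_rev (v : List α) : ch ε v.reverse = ch ε v := by
  rw [ch, ch, List.map_reverse, List.prod_reverse]

lemma GG_succ (l : α) (t : List α) (D : ℕ) : GG q s ε (l :: t) (D+1) =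
    C (ch ε (l :: t)) * expand k q (GG q s ε (l :: t) D) + C (ch ε t) * X ^ s l * expand k q (GG q s ε t D) := by
  simp only [GG]
  rw [List.reverse_cons, SS_snoc, SS_shift, SS_shift, ← List.reverse_cons, ch_rev, ch_rev]
  simp [eP]; ring

lemma GG_nil (D : ℕ) : GG q s ε [] D = 1 := rfl

/-- relation functional -/
def Er (n : ℕ) (p : List α → k[X]) (D : ℕ) : k[X] := ∑ v ∈ Wd n, p v * GG q s ε v D

/-- next relation -/
def nx (r : ℕ) (p : List α → k[X]) (t : List α) : k[X] := C (ch ε t) * La q r (p t + ∑ l, X ^ s l * p (l :: t))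

/-- null sequences -/
def Nul (h : ℕ → k[X]) : Prop := ∀ m, ∀ᶠ D in atTop, (h D).coeff m = 0

/-- length bound -/
def Ln (n : ℕ) (p : List α → k[X]) : Prop := ∀ v, n < v.length → p v = 0

variable {q}

lemma Er_succ (n : ℕ) (p : List α → k[X]) (hp : Ln n p) (D : ℕ) :
    Er q s ε n p (D+1) = ∑ t ∈ Wd n, (C (ch ε t) * (p t + ∑ l, X ^ s l * p (l :: t))) * expand k q (GG q s ε t D) := by
  have hext : ∀ F : List α → k[X], (∀ v, p v = 0 → F v = 0) → ∑ v ∈ Wd n, F v = ∑ v ∈ Wd (n+1), F v := by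
    intro F hF
    refine Finset.sum_subset (fun v hv => ?_) fun v hv hv' => hF v (hp v ?_)
    · rw [mem_Wd] at hv ⊢; omega
    · rw [mem_Wd] at hv'; omega
  have h1 : Er q s ε n p (D+1) = ∑ v ∈ Wd (n+1), p v * (C (ch ε v) * expand k q (GG q s ε v D)) +
     ∑ t ∈ Wd n, ∑ l, p (l :: t) * (C (ch ε t) * X ^ s l * expand k q (GG q s ε t D)) := by
    rw [Er, hext _ (fun v hv => by rw [hv, zero_mul]), sum_Wd, sum_Wd, add_assoc, ← Finset.sum_add_distrib]
    congr 1
    · simp [GG_nil, ch]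
    · refine Finset.sum_congr rfl fun t _ => ?_
      rw [← Finset.sum_add_distrib]
      refine Finset.sum_congr rfl fun l _ => ?_
      rw [GG_succ, mul_add]
  rw [h1, ← hext _ (fun v hv => by rw [hv, zero_mul]), ← Finset.sum_add_distrib]
  refine Finset.sum_congr rfl fun t _ => ?_
  rw [mul_add, add_mul, Finset.mul_sum, Finset.sum_mul]
  congr 1
  · ring
  · refine Finset.sum_congr rfl fun l _ => ?_
    ring

lemma nx_Ln (r n : ℕ) (p : List α → k[X]) (hp : Ln n p) : Ln n (nx q s ε r p) := by
  intro v hv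
  rw [nx, hp v hv, Finset.sum_eq_zero, add_zero, La_zero, mul_zero]
  intro l _
  rw [hp _ (by simp; omega), mul_zero]

lemma nx_Nul (hq : 1 < q) {r : ℕ} (hr : r < q) (n : ℕ) (p : List α → k[X]) (hp : Ln n p) (h : Nul (Er q s ε n p)) :
    Nul (Er q s ε n (nx q s ε r p)) := by
  intro m
  have h1 := (tendsto_add_atTop_nat 1).eventually (h (q * m + r))
  filter_upwards [h1] with D hD
  rw [Er_succ s ε n p hp, ← La_coeff hq, La_sum hq] at hD
  rw [← hD, Er]
  congr 1
  refine Finset.sum_congr rfl fun t _ => ?_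
  rw [La_expand hq hr, La_C_mul hq, nx]

lemma Er_lin (n : ℕ) (p p' : List α → k[X]) (c : k) (h : Nul (Er q s ε n p)) (h' : Nul (Er q s ε n p')) :
    Nul (Er q s ε n (fun v => p' v - C c * p v)) := by
  intro m
  filter_upwards [h m, h' m] with D h1 h2
  have : Er q s ε n (fun v => p' v - C c * p v) D = Er q s ε n p' D - C c * Er q s ε n p D := by
    rw [Er, Er, Er, Finset.mul_sum, ← Finset.sum_sub_distrib]
    refine Finset.sum_congr rfl fun t _ => ?_
    ring
  rw [this, coeff_sub, coeff_C_mul, h1, h2]; simp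

lemma Er_pred (n : ℕ) (p : List α → k[X]) (hp : Ln n p) : Er q s ε (n+1) p = Er q s ε n p := by
  funext D
  symm
  refine Finset.sum_subset (fun v hv => ?_) fun v hv hv' => ?_
  · rw [mem_Wd] at hv ⊢; omega
  · rw [mem_Wd] at hv'; rw [hp v (by omega), zero_mul]

end FI

end

section
open Filter Topology
set_option linter.unusedSectionVars false

section FI
open Polynomial
variable {k : Type*} [Field k] {α : Type*} [Fintype α] {q : ℕ} (s : α → ℕ) (ε : α → k)

lemma La_X_C (hq : 1 < q) {r : ℕ} (hr : r < q) (m : ℕ) (c : k) :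
    La q r (X ^ m * C c) = if m % q = r then monomial (m / q) c else 0 := by
  ext i
  rw [La_coeff hq, coeff_mul_C, coeff_X_pow]
  have : q * i + r = m ↔ (m % q = r ∧ i = m / q) := by
    constructor
    · rintro rfl
      refine ⟨by rw [Nat.mul_add_mod, Nat.mod_eq_of_lt hr], ?_⟩
      rw [Nat.mul_add_div (by omega), Nat.div_eq_of_lt hr, add_zero]
    · rintro ⟨h1, h2⟩
      rw [h2, ← h1]; exact Nat.div_add_mod m q
  by_cases h1 : m % q = r
  · by_cases h2 : i = m / q
    · rw [if_pos (this.2 ⟨h1, h2⟩), if_pos h1, coeff_monomial, if_pos h2.symm, one_mul]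
    · rw [if_neg (fun h => h2 (this.1 h).2), if_pos h1, coeff_monomial, if_neg (Ne.symm h2), zero_mul]
  · rw [if_neg (fun h => h1 (this.1 h).1), if_neg h1, zero_mul, coeff_zero]

lemma La_C (hq : 1 < q) {r : ℕ} (hr : r < q) (c : k) :
    La q r (C c) = if r = 0 then C c else 0 := by
  have := La_X_C hq hr 0 c
  rw [pow_zero, one_mul] at this
  rw [this]
  by_cases h : r = 0
  · subst h; simp
  · rw [if_neg h, if_neg]; simpa using Ne.symm h

lemma nx_top (r n : ℕ) (p : List α → k[X]) (hp : Ln n p) (v : List α) (hv : v.length = n) :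
    nx q s ε r p v = C (ch ε v) * La q r (p v) := by
  rw [nx, Finset.sum_eq_zero, add_zero]
  intro l _
  rw [hp _ (by simp; omega), mul_zero]

lemma nx_mid (hq : 1 < q) {r : ℕ} (hr : r < q) (n : ℕ) (p : List α → k[X])
    (hc : ∀ v, v.length = n + 1 → (p v).natDegree = 0) (t : List α) (ht : t.length = n) :
    nx q s ε r p t = C (ch ε t) * (La q r (p t) +
      ∑ l, if s l % q = r then monomial (s l / q) ((p (l :: t)).coeff 0) else 0) := by
  rw [nx, La_add hq, La_sum hq]
  congr 2
  refine Finset.sum_congr rfl fun l _ => ?_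
  conv_lhs => rw [eq_C_of_natDegree_eq_zero (hc (l :: t) (by simp [ht]))]
  rw [La_X_C hq hr]

variable (q) in
/-- relations with nonzero top part -/
def Rl (n : ℕ) (p : List α → k[X]) : Prop :=
  Ln n p ∧ Nul (Er q s ε n p) ∧ ∃ v, v.length = n ∧ p v ≠ 0

lemma ch_ne (hε : ∀ l, ε l ≠ 0) (v : List α) : ch ε v ≠ 0 := by
  rw [ch, Ne, List.prod_eq_zero_iff]
  simp [hε]

lemma FI_L1 (hq : 1 < q) (hε : ∀ l, ε l ≠ 0) (n b : ℕ) : ∀ p : List α → k[X], Rl q s ε n p →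
    (∀ v, v.length = n → (p v).natDegree ≤ b) →
    ∃ p', Rl q s ε n p' ∧ ∀ v, v.length = n → (p' v).natDegree = 0 := by
  induction b using Nat.strong_induction_on with
  | _ b ih =>
  intro p hp hb
  rcases Nat.eq_zero_or_pos b with rfl | hbp
  · exact ⟨p, hp, fun v hv => by have := hb v hv; omega⟩
  obtain ⟨h1, h2, v, hv, hne⟩ := hp
  obtain ⟨j, hj⟩ : ∃ j, (p v).coeff j ≠ 0 := by
    by_contra! h
    exact hne (Polynomial.ext (by simpa using h))
  have hr : j % q < q := Nat.mod_lt _ (by omega)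
  refine ih (b / q) (Nat.div_lt_self hbp hq) (nx q s ε (j % q) p)
    ⟨nx_Ln s ε _ n p h1, nx_Nul s ε hq hr n p h1 h2, v, hv, ?_⟩ ?_
  · rw [nx_top s ε _ n p h1 v hv]
    intro h0
    have := congrArg (fun f => coeff f (j / q)) h0
    simp only [coeff_C_mul, La_coeff hq, Nat.div_add_mod, coeff_zero] at this
    exact (mul_ne_zero (ch_ne ε hε v) hj) this
  · intro u hu
    rw [nx_top s ε _ n p h1 u hu]
    exact (natDegree_C_mul_le _ _).trans (La_deg hq _ _ _ (hb u hu))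

lemma nx0_top (hq : 1 < q) (n : ℕ) (p : List α → k[X]) (h1 : Ln n p) (v : List α) (hv : v.length = n)
    (hc : (p v).natDegree = 0) : nx q s ε 0 p v = C (ch ε v) * p v := by
  rw [nx_top s ε 0 n p h1 v hv]
  conv_lhs => rw [eq_C_of_natDegree_eq_zero hc, La_C hq (by omega), if_pos rfl]
  rw [← eq_C_of_natDegree_eq_zero hc]

lemma nx0_Rl (hq : 1 < q) (hε : ∀ l, ε l ≠ 0) (n : ℕ) (p : List α → k[X]) (h : Rl q s ε n p)
    (hc : ∀ v, v.length = n → (p v).natDegree = 0) :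
    Rl q s ε n (nx q s ε 0 p) ∧ ∀ v, v.length = n → (nx q s ε 0 p v).natDegree = 0 := by
  obtain ⟨h1, h2, v, hv, hne⟩ := h
  refine ⟨⟨nx_Ln s ε _ n p h1, nx_Nul s ε hq (by omega) n p h1 h2, v, hv, ?_⟩, ?_⟩
  · rw [nx0_top s ε hq n p h1 v hv (hc v hv)]
    exact mul_ne_zero (by simpa using ch_ne ε hε v) hne
  · intro u hu
    rw [nx0_top s ε hq n p h1 u hu (hc u hu)]
    have := natDegree_C_mul_le (ch ε u) (p u)
    rw [hc u hu] at this; omega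

lemma nx0_mid (hq : 1 < q) (hs : ∀ l, ¬ q ∣ s l) (n : ℕ) (p : List α → k[X])
    (hc : ∀ v, v.length = n + 1 → (p v).natDegree = 0) (t : List α) (ht : t.length = n) :
    nx q s ε 0 p t = C (ch ε t) * La q 0 (p t) := by
  rw [nx_mid s ε hq (by omega) n p hc t ht, Finset.sum_eq_zero, add_zero]
  intro l _
  rw [if_neg fun h => hs l (Nat.dvd_of_mod_eq_zero h)]

lemma FI_L2 (hq : 1 < q) (hε : ∀ l, ε l ≠ 0) (hs : ∀ l, ¬ q ∣ s l) (n b : ℕ) : ∀ p : List α → k[X], Rl q s ε (n+1) p →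
    (∀ v, v.length = n+1 → (p v).natDegree = 0) →
    (∀ v, v.length = n → (p v).natDegree ≤ b) →
    ∃ p', Rl q s ε (n+1) p' ∧ (∀ v, v.length = n+1 → (p' v).natDegree = 0) ∧ ∀ v, v.length = n → (p' v).natDegree = 0 := by
  induction b using Nat.strong_induction_on with
  | _ b ih =>
  intro p hp hc hb
  rcases Nat.eq_zero_or_pos b with rfl | hbp
  · exact ⟨p, hp, hc, fun v hv => by have := hb v hv; omega⟩
  obtain ⟨h1, h2⟩ := nx0_Rl s ε hq hε (n+1) p hp hc
  refine ih (b / q) (Nat.div_lt_self hbp hq) (nx q s ε 0 p) h1 h2 ?_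
  intro t ht
  rw [nx0_mid s ε hq hs n p hc t ht]
  exact (natDegree_C_mul_le _ _).trans (La_deg hq _ _ _ (hb t ht))

lemma FI_L3 (hq : 1 < q) (hε : ∀ l, ε l ≠ 0) (hs : ∀ l, ¬ q ∣ s l) (n b : ℕ) : ∀ p : List α → k[X], Rl q s ε (n+1) p →
    (∀ v, v.length = n+1 → (p v).natDegree = 0) →
    (∀ v, v.length = n → (p v).natDegree = 0) →
    ((Wd (n+1)).filter fun v => v.length = n+1 ∧ p v ≠ 0).card ≤ b →
    ∃ p', Rl q s ε (n+1) p' ∧ (∀ v, v.length = n+1 → (p' v).natDegree = 0) ∧ (∀ v, v.length = n → (p' v).natDegree = 0) ∧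
      ∀ u v, u.length = n+1 → v.length = n+1 → p' u ≠ 0 → p' v ≠ 0 → ch ε u = ch ε v := by
  induction b with
  | zero =>
    intro p hp hc hc' hb
    obtain ⟨-, -, v, hv, hne⟩ := hp
    exfalso
    have := Finset.card_eq_zero.1 (Nat.le_zero.1 hb)
    have hm : v ∈ (Wd (n+1)).filter fun v => v.length = n+1 ∧ p v ≠ 0 :=
      Finset.mem_filter.2 ⟨(mem_Wd _ _).2 hv.le, hv, hne⟩
    rw [this] at hm
    simp at hm
  | succ b ih =>
    intro p hp hc hc' hb
    by_cases H : ∀ u v, u.length = n+1 → v.length = n+1 → p u ≠ 0 → p v ≠ 0 → ch ε u = ch ε v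
    · exact ⟨p, hp, hc, hc', H⟩
    push Not at H
    obtain ⟨u, v, hu, hv, hpu, hpv, hne⟩ := H
    set p' : List α → k[X] := fun t => nx q s ε 0 p t - C (ch ε v) * p t with hp'
    obtain ⟨h1, h2⟩ := nx0_Rl s ε hq hε (n+1) p hp hc
    have htop : ∀ t, t.length = n+1 → p' t = C (ch ε t - ch ε v) * p t := by
      intro t ht
      rw [hp']; simp only
      rw [nx0_top s ε hq (n+1) p hp.1 t ht (hc t ht), map_sub]; ring
    refine ih p' ⟨?_, ?_, u, hu, ?_⟩ ?_ ?_ ?_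
    · intro t ht
      rw [hp']; simp only
      rw [h1.1 t ht, hp.1 t ht]; simp
    · exact Er_lin s ε (n+1) p _ _ hp.2.1 h1.2.1
    · rw [htop u hu]
      exact mul_ne_zero (by simpa [sub_eq_zero] using hne) hpu
    · intro t ht
      rw [htop t ht]
      have := natDegree_C_mul_le (ch ε t - ch ε v) (p t)
      rw [hc t ht] at this; omega
    · intro t ht
      have e1 : p' t = C (ch ε t) * La q 0 (p t) - C (ch ε v) * p t := by
        rw [hp']; simp only; rw [nx0_mid s ε hq hs n p hc t ht]
      rw [e1, eq_C_of_natDegree_eq_zero (hc' t ht), La_C hq (by omega), if_pos rfl, ← C_mul, ← C_mul, ← C_sub, natDegree_C]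
    · have : ((Wd (n+1)).filter fun t => t.length = n+1 ∧ p' t ≠ 0) ⊂ ((Wd (n+1)).filter fun v => v.length = n+1 ∧ p v ≠ 0) := by
        rw [Finset.ssubset_iff_of_subset]
        · refine ⟨v, Finset.mem_filter.2 ⟨(mem_Wd _ _).2 hv.le, hv, hpv⟩, ?_⟩
          intro hm
          have := (Finset.mem_filter.1 hm).2.2
          rw [htop v hv] at this
          simp at this
        · intro t ht
          rw [Finset.mem_filter] at ht ⊢
          refine ⟨ht.1, ht.2.1, ?_⟩
          intro h0
          apply ht.2.2
          rw [htop t ht.2.1, h0, mul_zero]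
      have := Finset.card_lt_card this
      omega

theorem FI_main (hq : 1 < q) (hε : ∀ l, ε l ≠ 0) (hs : ∀ l, ¬ q ∣ s l)
    (hinj : ∀ l l', s l = s l' → ε l = ε l' → l = l') (n : ℕ) :
    ∀ p : List α → k[X], Ln n p → Nul (Er q s ε n p) → ∀ v, p v = 0 := by
  induction n with
  | zero =>
    intro p h1 h2 v
    cases v with
    | cons a t => exact h1 _ (by simp)
    | nil =>
      ext m
      obtain ⟨D, hD⟩ := (h2 m).exists
      simpa [Er, Wd, GG_nil] using hD
  | succ n IH =>
    intro p h1 h2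
    by_contra hne
    push Not at hne
    have hR : Rl q s ε (n+1) p := by
      refine ⟨h1, h2, ?_⟩
      by_contra! h
      have hL : Ln n p := by
        intro v hv
        rcases Nat.lt_or_ge (n+1) v.length with h' | h'
        · exact h1 v h'
        · exact h v (by omega)
      rw [Er_pred s ε n p hL] at h2
      obtain ⟨v, hv⟩ := hne
      exact hv (IH p hL h2 v)
    obtain ⟨p1, hR1, hc1⟩ := FI_L1 s ε hq hε (n+1) ((Wd (n+1)).sup fun v => (p v).natDegree) p hR
      (fun v hv => Finset.le_sup (f := fun v => (p v).natDegree) ((mem_Wd _ _).2 hv.le))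
    obtain ⟨p2, hR2, hc2, hc2'⟩ := FI_L2 s ε hq hε hs n ((Wd (n+1)).sup fun v => (p1 v).natDegree) p1 hR1 hc1
      (fun v hv => Finset.le_sup (f := fun v => (p1 v).natDegree) ((mem_Wd _ _).2 (by omega)))
    obtain ⟨p3, hR3, hc3, hc3', hch⟩ := FI_L3 s ε hq hε hs n _ p2 hR2 hc2 hc2' le_rfl
    obtain ⟨g1, g2, v, hv, hpv⟩ := hR3
    obtain ⟨l0, t0, rfl⟩ : ∃ l0 t0, v = l0 :: t0 := by
      cases v with
      | nil => simp at hv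
      | cons a t => exact ⟨a, t, rfl⟩
    have ht0 : t0.length = n := by simpa using hv
    set r := s l0 % q with hr
    have hrq : r < q := Nat.mod_lt _ (by omega)
    have hr0 : r ≠ 0 := fun h => hs l0 (Nat.dvd_of_mod_eq_zero h)
    have hL : Ln n (nx q s ε r p3) := by
      intro u hu
      rcases Nat.lt_or_ge (n+1) u.length with h' | h'
      · exact nx_Ln s ε r (n+1) p3 g1 u h'
      · rw [nx_top s ε r (n+1) p3 g1 u (by omega), eq_C_of_natDegree_eq_zero (hc3 u (by omega)), La_C hq hrq,
          if_neg hr0, mul_zero]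
    have hN := nx_Nul s ε hq hrq (n+1) p3 g1 g2
    rw [Er_pred s ε n _ hL] at hN
    have hz := IH _ hL hN t0
    rw [nx_mid s ε hq hrq n p3 hc3 t0 ht0, eq_C_of_natDegree_eq_zero (hc3' t0 ht0), La_C hq hrq, if_neg hr0, zero_add] at hz
    have hz2 := (mul_eq_zero.1 hz).resolve_left (by simpa using ch_ne ε hε t0)
    have hz3 := congrArg (fun f => coeff f (s l0 / q)) hz2
    simp only [finsetSum_coeff, coeff_zero] at hz3
    rw [Finset.sum_eq_single l0] at hz3
    · rw [if_pos rfl, coeff_monomial, if_pos rfl] at hz3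
      apply hpv
      rw [eq_C_of_natDegree_eq_zero (hc3 _ hv), hz3, C_0]
    · intro l _ hl
      by_cases h : s l % q = r
      · rw [if_pos h, coeff_monomial]
        split_ifs with h2
        · have hsl : s l = s l0 := by
            rw [← Nat.div_add_mod (s l) q, ← Nat.div_add_mod (s l0) q, h, h2]
          by_contra h3
          have h4 : p3 (l :: t0) ≠ 0 := by intro h5; rw [h5] at h3; simp at h3
          have h6 := hch (l :: t0) (l0 :: t0) (by simp [ht0]) hv h4 hpv
          simp only [ch, List.map_cons, List.prod_cons] at h6
          have h7 := mul_right_cancel₀ (ch_ne ε hε t0) h6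
          exact hl (hinj l l0 hsl h7)
        · rfl
      · rw [if_neg h, coeff_zero]
    · intro h; exact absurd (Finset.mem_univ _) h

theorem FI_words (hq : 1 < q) (hε : ∀ l, ε l ≠ 0) (hs : ∀ l, ¬ q ∣ s l)
    (hinj : ∀ l l', s l = s l' → ε l = ε l' → l = l') (V : Finset (List α)) (p : List α → k[X])
    (h : Nul (fun D => ∑ v ∈ V, p v * SS (eP q s ε) v D)) : ∀ v ∈ V, p v = 0 := by
  set n := V.sup List.length with hn
  set p' : List α → k[X] := fun v => if v.reverse ∈ V then p v.reverse else 0 with hp'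
  have hL : Ln n p' := by
    intro v hv
    rw [hp']; simp only
    rw [if_neg]
    intro hm
    have := Finset.le_sup (f := List.length) hm
    simp at this; omega
  have hE : Er q s ε n p' = fun D => ∑ v ∈ V, p v * SS (eP q s ε) v D := by
    funext D
    rw [Er]
    have hsub : V.image List.reverse ⊆ Wd n := by
      intro v hv
      obtain ⟨u, hu, rfl⟩ := Finset.mem_image.1 hv
      rw [mem_Wd, List.length_reverse]; exact Finset.le_sup (f := List.length) hu
    rw [← Finset.sum_subset hsub, Finset.sum_image (by intro a _ b _ h; simpa using h)]
    · refine Finset.sum_congr rfl fun v hv => ?_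
      simp [hp', hv, GG]
    · intro v _ hv
      rw [hp']; simp only
      rw [if_neg, zero_mul]
      intro hm
      exact hv (Finset.mem_image.2 ⟨_, hm, List.reverse_reverse v⟩)
  rw [← hE] at h
  intro v hv
  have := FI_main s ε hq hε hs hinj n p' hL h v.reverse
  simpa [hp', hv] using this

end FI

end

section
open Filter Topology
set_option linter.unusedSectionVars false

open Polynomial

/-- inverse power of theta -/
def yy (Q : ℕ) : Kinf Fq := HahnSeries.single (Q : ℤ) 1

lemma yy_theta (Q : ℕ) : yy Fq Q * theta Fq ^ Q = 1 := by
  rw [yy, theta_pow, HahnSeries.single_mul_single]; simp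

lemma yy_oo (Q : ℕ) : yy Fq Q ∈ oo (Q : ℤ) := oo_single _ _

/-- two variable evaluation -/
def ev (Q : ℕ) : (Fb Fq)[X][X] →+* Kinf Fq := eval₂RingHom (pK Fq) (yy Fq Q)

lemma ev_C (Q : ℕ) (p : (Fb Fq)[X]) : ev Fq Q (C p) = pK Fq p := by simp [ev]
lemma ev_X (Q : ℕ) : ev Fq Q X = yy Fq Q := by simp [ev]

lemma pK_oo (p : (Fb Fq)[X]) (m : ℕ) (h : p.natDegree ≤ m) : pK Fq p ∈ oo (-(m:ℤ)) := by
  rw [mem_oo]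
  intro n hn
  rw [pK_coeff]
  split_ifs
  · apply coeff_eq_zero_of_natDegree_lt; omega
  · rfl

lemma natDegree_of_oo (p : (Fb Fq)[X]) (m : ℕ) (h : pK Fq p ∈ oo (-(m:ℤ))) : p.natDegree ≤ m := by
  rw [natDegree_le_iff_coeff_eq_zero]
  intro n hn
  rw [mem_oo] at h
  have := h (-(n:ℤ)) (by omega)
  rw [pK_coeff] at this
  simpa using this

/-- degree bounded two variable polynomials -/
def Bd {k : Type*} [Field k] (P : k[X][X]) : Prop := ∀ m, (P.coeff m).natDegree ≤ m

lemma term_oo (Q m : ℕ) (c : (Fb Fq)[X]) (h : c.natDegree ≤ m) : pK Fq c * yy Fq Q ^ m ∈ oo (((Q:ℤ) - 1) * m) := by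
  refine oo_mono ?_ (oo_mul (pK_oo Fq c m h) (oo_pow (yy_oo Fq Q) m))
  ring_nf; rfl

lemma ev_sum (Q : ℕ) (P : (Fb Fq)[X][X]) (n : ℕ) (h : P.natDegree < n) :
    ev Fq Q P = ∑ i ∈ Finset.range n, pK Fq (P.coeff i) * yy Fq Q ^ i := by
  rw [ev, coe_eval₂RingHom, eval₂_eq_sum_range' _ h]

lemma ev_Bd (Q : ℕ) (hQ : 0 < Q) (P : (Fb Fq)[X][X]) (h : Bd P) : ev Fq Q P ∈ oo (0:ℤ) := by
  rw [ev_sum Fq Q P _ (Nat.lt_succ_self _)]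
  refine AddSubgroup.sum_mem _ fun i _ => oo_mono ?_ (term_oo Fq Q i _ (h i))
  have : (1:ℤ) ≤ Q := by exact_mod_cast hQ
  have : (0:ℤ) ≤ Q - 1 := by omega
  positivity

lemma digits {k : Type*} [Field k] (Q : ℕ) (hQ : 0 < Q) (n : ℕ) : ∀ B : k[X], (∀ i, n * Q ≤ i → B.coeff i = 0) →
    ∃ b : ℕ → k[X], (∀ j, (b j).natDegree < Q) ∧ B = ∑ j ∈ Finset.range n, b j * X ^ (Q * j) := by
  induction n with
  | zero =>
    intro B hB
    refine ⟨fun _ => 0, by simpa using hQ, ?_⟩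
    ext i; simpa using hB i
  | succ n ih =>
    intro B hB
    obtain ⟨b, hb, hb'⟩ := ih (B /ₘ X ^ Q) (by
      intro i hi
      have : (X ^ Q : k[X]) * (B /ₘ X ^ Q) = B - B %ₘ X ^ Q := by
        rw [eq_sub_iff_add_eq, add_comm, modByMonic_add_div B]
      have h2 := congrArg (fun f => coeff f (i + Q)) this
      simp only [coeff_X_pow_mul, coeff_sub] at h2
      rw [h2, hB _ (by nlinarith), zero_sub, neg_eq_zero]
      apply coeff_eq_zero_of_degree_lt
      refine (degree_modByMonic_lt B (monic_X_pow Q)).trans_le ?_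
      rw [degree_X_pow]; exact_mod_cast Nat.le_add_left Q i)
    refine ⟨fun j => if j = 0 then B %ₘ X ^ Q else b (j - 1), ?_, ?_⟩
    · intro j
      by_cases hj : j = 0
      · simp only [hj, if_true]
        have := natDegree_modByMonic_lt B (monic_X_pow Q) (by
          intro h; have := congrArg natDegree h; rw [natDegree_X_pow, natDegree_one] at this; omega)
        rwa [natDegree_X_pow] at this
      · simp only [hj, if_false]; exact hb _
    · rw [Finset.sum_range_succ']
      simp only [Nat.add_sub_cancel, Nat.add_eq_zero_iff, one_ne_zero, and_false, if_false, if_true, mul_zero, pow_zero, mul_one]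
      conv_lhs => rw [← modByMonic_add_div B (X ^ Q), add_comm, hb', Finset.mul_sum]
      congr 1
      refine Finset.sum_congr rfl fun j _ => ?_
      ring

lemma split_eq {k : Type*} [Field k] (Q : ℕ) (a b a' b' : k[X]) (ha : a.natDegree < Q) (ha' : a'.natDegree < Q)
    (h : a - X ^ Q * b = a' - X ^ Q * b') : a = a' ∧ b = b' := by
  have h1 : a - a' = (b - b') * X ^ Q := by linear_combination h
  by_cases hb : b - b' = 0
  · rw [hb, zero_mul] at h1
    exact ⟨sub_eq_zero.1 h1, sub_eq_zero.1 hb⟩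
  · exfalso
    have h2 := congrArg natDegree h1
    rw [natDegree_mul_X_pow Q hb] at h2
    have := natDegree_sub_le a a'
    have := max_lt ha ha'
    omega

/-- descent in theta -/
lemma descent {k : Type*} [Field k] {V : Type*} [Fintype V] (n M : ℕ) (P : V → k[X][X])
    (hInd : ∀ p : V → k[X], (∀ v, (p v).natDegree ≤ n) →
      (∀ m < M, (∑ v, p v * (P v).map (evalRingHom 0)).coeff m = 0) → ∀ v, p v = 0)
    (b : ℕ) : ∀ p : V → k[X][X], (∀ v, (p v).natDegree ≤ n) → (∀ v i, ((p v).coeff i).natDegree ≤ b) →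
      (∀ m < M, (∑ v, p v * P v).coeff m = 0) → ∀ v, p v = 0 := by
  have key : ∀ p : V → k[X][X], (∀ v, (p v).natDegree ≤ n) → (∀ m < M, (∑ v, p v * P v).coeff m = 0) →
      ∀ v i, ((p v).coeff i).coeff 0 = 0 := by
    intro p h1 h3 v i
    have := hInd (fun v => (p v).map (evalRingHom 0)) (fun v => (natDegree_map_le).trans (h1 v)) (by
      intro m hm
      have h4 := congrArg (evalRingHom (0:k)) (h3 m hm)
      rw [← coeff_map, Polynomial.map_sum, map_zero] at h4
      simpa only [Polynomial.map_mul] using h4) v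
    have h5 := congrArg (fun f => coeff f i) this
    simpa [coeff_map, coeff_zero_eq_eval_zero] using h5
  induction b with
  | zero =>
    intro p h1 h2 h3 v
    ext1 i
    rw [eq_C_of_natDegree_eq_zero (Nat.le_zero.1 (h2 v i)), key p h1 h3 v i]; simp
  | succ b ih =>
    intro p h1 h2 h3
    have hk := key p h1 h3
    set p' : V → k[X][X] := fun v => ∑ i ∈ Finset.range (n+1), monomial i (divX ((p v).coeff i)) with hp'
    have hc : ∀ v i, (p' v).coeff i = divX ((p v).coeff i) := by
      intro v i
      rw [hp']; simp only [finsetSum_coeff, coeff_monomial]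
      rw [Finset.sum_ite_eq']
      split_ifs with h
      · rfl
      · rw [Finset.mem_range] at h
        rw [coeff_eq_zero_of_natDegree_lt (lt_of_le_of_lt (h1 v) (by omega))]; simp
    have hpp : ∀ v, p v = C X * p' v := by
      intro v
      ext1 i
      rw [coeff_C_mul, hc]
      conv_lhs => rw [← divX_mul_X_add ((p v).coeff i), hk v i]
      rw [C_0, add_zero, mul_comm]
    have := ih p' ?_ ?_ ?_
    · intro v; rw [hpp v, this v, mul_zero]
    · intro v
      rw [natDegree_le_iff_coeff_eq_zero]
      intro i hi
      rw [hc, coeff_eq_zero_of_natDegree_lt (lt_of_le_of_lt (h1 v) hi)]; simp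
    · intro v i
      rw [hc, natDegree_divX_eq_natDegree_tsub_one]
      have := h2 v i; omega
    · intro m hm
      have h4 := h3 m hm
      have : ∑ v, p v * P v = C X * ∑ v, p' v * P v := by
        rw [Finset.mul_sum]
        refine Finset.sum_congr rfl fun v _ => ?_
        rw [hpp v, mul_assoc]
      rw [this, coeff_C_mul] at h4
      exact (mul_eq_zero.1 h4).resolve_left X_ne_zero

end

section
open Filter Topology
set_option linter.unusedSectionVars false

open Polynomial

lemma exists_bd2 {I J : Type*} [Fintype I] [Fintype J] (f : I → J → ℕ) : ∃ A, ∀ i j, f i j ≤ A := by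
  refine ⟨Finset.univ.sup fun p : I × J => f p.1 p.2, fun i j => ?_⟩
  exact Finset.le_sup (f := fun p : I × J => f p.1 p.2) (Finset.mem_univ (i,j))

lemma Q4_T {I : Type*} [Fintype I] (Q M : ℕ) (hQ : 0 < Q) (c : I → (Fb Fq)[X][X]) (hc : ∀ i, Bd (c i))
    (B : I → (Fb Fq)[X]) (hB : ∀ i, (B i).natDegree < Q)
    (h : ∑ i, pK Fq (B i) * ev Fq Q (c i) ∈ oo (((Q:ℤ)-1) * ((M:ℤ)-1))) :
    ∃ T : ℕ → (Fb Fq)[X], T 0 = 0 ∧ ∀ m < M, T (m+1) - X ^ Q * T m = ∑ i, B i * (c i).coeff m ∧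
      (T (m+1)).natDegree ≤ m := by
  have hQ1 : (0:ℤ) ≤ (Q:ℤ) - 1 := by omega
  set G : ℕ → (Fb Fq)[X] := fun m => ∑ i, B i * (c i).coeff m with hG
  have hGd : ∀ m : ℕ, (G m).natDegree ≤ Q - 1 + m := by
    intro m
    refine natDegree_sum_le_of_forall_le _ _ fun i _ => ?_
    refine natDegree_mul_le.trans ?_
    have := hB i; have := hc i m; omega
  have hGoo : ∀ m : ℕ, pK Fq (G m) * yy Fq Q ^ m ∈ oo (((Q:ℤ)-1) * ((m:ℤ)-1)) := by
    intro m
    refine oo_mono ?_ (oo_mul (pK_oo Fq _ _ (hGd m)) (oo_pow (yy_oo Fq Q) m))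
    push_cast [Nat.cast_sub (show 1 ≤ Q from hQ)]
    ring_nf; rfl
  obtain ⟨K, hK⟩ : ∃ K, (∀ i, (c i).natDegree < K) := by
    refine ⟨(Finset.univ.sup fun i => (c i).natDegree) + 1, fun i => ?_⟩
    exact Nat.lt_succ_of_le (Finset.le_sup (f := fun i => (c i).natDegree) (Finset.mem_univ i))
  have hev : ∀ K' ≥ K, ∑ i, pK Fq (B i) * ev Fq Q (c i) = ∑ m ∈ Finset.range K', pK Fq (G m) * yy Fq Q ^ m := by
    intro K' hK'
    simp_rw [fun i => ev_sum Fq Q (c i) K' ((hK i).trans_le hK'), hG, map_sum, Finset.sum_mul, Finset.mul_sum]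
    rw [Finset.sum_comm]
    refine Finset.sum_congr rfl fun m _ => Finset.sum_congr rfl fun i _ => ?_
    rw [map_mul]; ring
  have hpart : ∀ m < M, ∑ i ∈ Finset.range (m+1), pK Fq (G i) * yy Fq Q ^ i ∈ oo (((Q:ℤ)-1) * m) := by
    intro m hm
    have h1 := hev (K + (m+1)) (by omega)
    rw [add_comm, Finset.sum_range_add] at h1
    have h2 : ∑ i ∈ Finset.range (m+1), pK Fq (G i) * yy Fq Q ^ i =
      ∑ i, pK Fq (B i) * ev Fq Q (c i) - ∑ x ∈ Finset.range K, pK Fq (G (m+1+x)) * yy Fq Q ^ (m+1+x) := by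
      rw [h1]; ring
    rw [h2]
    refine AddSubgroup.sub_mem _ (oo_mono ?_ h) (AddSubgroup.sum_mem _ fun x _ => oo_mono ?_ (hGoo _))
    · apply mul_le_mul_of_nonneg_left _ hQ1; omega
    · apply mul_le_mul_of_nonneg_left _ hQ1; push_cast; omega
  let T : ℕ → (Fb Fq)[X] := fun m => Nat.rec 0 (fun m t => G m + X ^ Q * t) m
  have hT : ∀ m, T (m+1) = G m + X ^ Q * T m := fun m => rfl
  have hT0 : T 0 = 0 := rfl
  have hTy : ∀ m, pK Fq (T (m+1)) * yy Fq Q ^ m = ∑ i ∈ Finset.range (m+1), pK Fq (G i) * yy Fq Q ^ i := by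
    intro m
    induction m with
    | zero => simp [hT, hT0]
    | succ m ih =>
      rw [Finset.sum_range_succ, ← ih, hT (m+1), map_add, map_mul, map_pow, pK_X, pow_succ]
      linear_combination (pK Fq (T (m+1)) * yy Fq Q ^ m) * yy_theta Fq Q
  refine ⟨T, hT0, fun m hm => ⟨by rw [hT]; ring, ?_⟩⟩
  apply natDegree_of_oo
  have h3 : pK Fq (T (m+1)) = (pK Fq (T (m+1)) * yy Fq Q ^ m) * pK Fq (X ^ (Q*m)) := by
    rw [map_pow, pK_X, mul_assoc, pow_mul, ← mul_pow, yy_theta, one_pow, mul_one]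
  rw [h3, hTy]
  refine oo_mono ?_ (oo_mul (hpart m hm) (pK_oo Fq (X ^ (Q*m)) (Q*m) (natDegree_X_pow_le _)))
  push_cast; ring_nf; rfl

lemma Q4_lin {k : Type*} [Field k] {I : Type*} [Fintype I] (M : ℕ) (c : I → k[X][X]) (hc : ∀ i, Bd (c i))
    (hinj : ∀ x : I → k, (∀ m < M, ∑ i, x i * ((c i).coeff m).coeff 0 = 0) → x = 0) :
    ∃ Q0 : ℕ, ∀ Q ≥ Q0, ∀ (B : I → k[X]) (T : ℕ → k[X]), (∀ m ≤ M, (T m).natDegree ≤ M) →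
      (∀ m < M, T (m+1) - X ^ Q * T m = ∑ i, B i * (c i).coeff m) →
      ∃ (Δ : k[X]) (H H' : I → k[X]), Δ ≠ 0 ∧ (∀ i, Δ * B i = H' i - X ^ Q * H i) ∧
        ∀ m < M, Δ * T (m+1) = ∑ i, H' i * (c i).coeff m ∧ Δ * T m = ∑ i, H i * (c i).coeff m := by
  let f : (I → k) →ₗ[k] (Fin M → k) :=
    { toFun := fun x m => ∑ i, x i * ((c i).coeff m).coeff 0
      map_add' := by intro x y; ext m; simp [add_mul, Finset.sum_add_distrib]
      map_smul' := by intro a x; ext m; simp [Finset.mul_sum, mul_assoc] }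
  have hf : LinearMap.ker f = ⊥ := by
    rw [LinearMap.ker_eq_bot']
    intro x hx
    apply hinj
    intro m hm
    exact congrFun hx ⟨m, hm⟩
  obtain ⟨g, hg⟩ := LinearMap.exists_leftInverse_of_injective f hf
  let E : Fin M → I → k := fun m j => g (Pi.single m 1) j
  have hE : ∀ i j, ∑ m : Fin M, ((c i).coeff m).coeff 0 * E m j = if i = j then 1 else 0 := by
    intro i j
    have h1 : g (f (Pi.single i 1)) = Pi.single i 1 := by
      have := congrArg (fun h => h (Pi.single i (1:k))) hg
      simpa using this
    have h2 : f (Pi.single i 1) = ∑ m : Fin M, ((c i).coeff m).coeff 0 • (Pi.single m 1 : Fin M → k) := by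
      ext m
      simp [f, Pi.single_apply]
    rw [h2, map_sum] at h1
    have h3 := congrFun h1 j
    simp only [map_smul, Finset.sum_apply, Pi.smul_apply, smul_eq_mul] at h3
    rw [h3, Pi.single_apply]
    simp [eq_comm]
  let U : Matrix I I k[X] := Matrix.of fun i j => ∑ m : Fin M, (c i).coeff m * C (E m j)
  have hU : U.map (evalRingHom (0:k)) = 1 := by
    ext i j
    rw [Matrix.map_apply, Matrix.one_apply, ← hE i j]
    simp [U, coeff_zero_eq_eval_zero]
  have hΔ : U.det ≠ 0 := by
    intro h0
    have := RingHom.map_det (evalRingHom (0:k)) U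
    rw [RingHom.mapMatrix_apply, hU, h0] at this
    simp at this
  obtain ⟨A, hA⟩ : ∃ A, ∀ i j, (U.adjugate i j).natDegree ≤ A := by
    exact exists_bd2 fun i j => (U.adjugate i j).natDegree
  refine ⟨2 * M + A + U.det.natDegree + 1, fun Q hQ B T hTd hT => ?_⟩
  let h' : I → k[X] := fun j => ∑ m : Fin M, T (m+1) * C (E m j)
  let h : I → k[X] := fun j => ∑ m : Fin M, T m * C (E m j)
  have hh' : ∀ j, (h' j).natDegree ≤ M := fun j =>
    natDegree_sum_le_of_forall_le _ _ fun m _ => (natDegree_mul_C_le _ _).trans (hTd _ (by omega))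
  have hBU : Matrix.vecMul B U = fun j => h' j - X ^ Q * h j := by
    ext1 j
    simp only [Matrix.vecMul, dotProduct, U, Matrix.of_apply, h, h', Finset.mul_sum]
    rw [Finset.sum_comm, ← Finset.sum_sub_distrib]
    refine Finset.sum_congr rfl fun m _ => ?_
    simp_rw [← mul_assoc]
    rw [← Finset.sum_mul, ← hT m m.2]; ring
  have hBd : ∀ i, U.det * B i = (∑ j, h' j * U.adjugate j i) - X ^ Q * ∑ j, h j * U.adjugate j i := by
    intro i
    have h1 : Matrix.vecMul (Matrix.vecMul B U) U.adjugate = U.det • B := by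
      rw [Matrix.vecMul_vecMul, Matrix.mul_adjugate, Matrix.vecMul_smul, Matrix.vecMul_one]
    have h2 := congrFun h1 i
    rw [hBU] at h2
    simp only [Matrix.vecMul, dotProduct, Pi.smul_apply, smul_eq_mul] at h2
    rw [← h2, Finset.mul_sum, ← Finset.sum_sub_distrib]
    refine Finset.sum_congr rfl fun j _ => ?_
    ring
  refine ⟨U.det, fun i => ∑ j, h j * U.adjugate j i, fun i => ∑ j, h' j * U.adjugate j i, hΔ, hBd, fun m hm => ?_⟩
  apply split_eq Q
  · have := natDegree_mul_le (p := U.det) (q := T (m+1))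
    have := hTd (m+1) hm
    omega
  · refine lt_of_le_of_lt (natDegree_sum_le_of_forall_le (n := M + A + M) _ _ fun i _ => ?_) (by omega)
    refine natDegree_mul_le.trans ?_
    refine Nat.add_le_add (natDegree_sum_le_of_forall_le _ _ fun j _ => ?_) ((hc i m).trans hm.le)
    exact natDegree_mul_le.trans (Nat.add_le_add (hh' j) (hA j i))
  · rw [Finset.mul_sum, ← Finset.sum_sub_distrib]
    have : U.det * (T (m+1) - X ^ Q * T m) = U.det * ∑ i, B i * (c i).coeff m := by rw [hT m hm]
    calc _ = U.det * (T (m+1) - X ^ Q * T m) := by ring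
      _ = _ := by
        rw [this, Finset.mul_sum]
        refine Finset.sum_congr rfl fun i _ => ?_
        rw [← mul_assoc, hBd i]; ring

lemma Bd_X_mul {k : Type*} [Field k] (j : ℕ) (P : k[X][X]) (h : Bd P) : Bd (X ^ j * P) := by
  intro m
  rw [coeff_X_pow_mul']
  split_ifs
  · exact (h _).trans (Nat.sub_le _ _)
  · simp

theorem lemL {V : Type*} [Fintype V] (n M : ℕ) (P : V → (Fb Fq)[X][X]) (hP : ∀ v, Bd (P v))
    (hInd : ∀ p : V → (Fb Fq)[X], (∀ v, (p v).natDegree ≤ n) →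
      (∀ m < M, (∑ v, p v * (P v).map (evalRingHom 0)).coeff m = 0) → ∀ v, p v = 0) :
    ∃ Q0 : ℕ, ∀ Q ≥ Q0, ∀ g : V → Kinf Fq, (∀ v, g v - ev Fq Q (P v) ∈ oo (((Q:ℤ)-1) * M)) →
      ∀ B : V → (Fb Fq)[X], (∀ v i, n * Q ≤ i → (B v).coeff i = 0) →
      ∑ v, pK Fq (B v) * g v = 0 → ∀ v, B v = 0 := by
  let c : V × Fin n → (Fb Fq)[X][X] := fun i => X ^ (n - 1 - i.2) * P i.1
  have hc : ∀ i, Bd (c i) := fun i => Bd_X_mul _ _ (hP _)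
  have hinj : ∀ x : V × Fin n → Fb Fq, (∀ m < M, ∑ i, x i * ((c i).coeff m).coeff 0 = 0) → x = 0 := by
    intro x hx
    have h0 := hInd (fun v => ∑ j : Fin n, C (x (v,j)) * X ^ (n-1-(j:ℕ))) (fun v =>
      natDegree_sum_le_of_forall_le _ _ fun j _ => (natDegree_C_mul_X_pow_le _ _).trans (by omega)) (by
      intro m hm
      refine Eq.trans ?_ (hx m hm)
      rw [finsetSum_coeff, Fintype.sum_prod_type]
      refine Finset.sum_congr rfl fun v _ => ?_
      rw [Finset.sum_mul, finsetSum_coeff]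
      refine Finset.sum_congr rfl fun j _ => ?_
      simp only [c]
      rw [mul_assoc, coeff_C_mul, coeff_X_pow_mul', coeff_X_pow_mul']
      split_ifs
      · simp [coeff_zero_eq_eval_zero]
      · simp)
    ext ⟨v, j⟩
    have h1 := congrArg (fun p => p.coeff (n-1-(j:ℕ))) (h0 v)
    simp only [finsetSum_coeff, coeff_C_mul, coeff_X_pow, coeff_zero] at h1
    rw [Finset.sum_eq_single j] at h1
    · simpa using h1
    · intro b _ hb
      rw [if_neg, mul_zero]
      have : (b:ℕ) ≠ j := fun h => hb (Fin.ext h)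
      omega
    · simp
  obtain ⟨Q0, hQ0⟩ := Q4_lin M c hc hinj
  refine ⟨Q0 + 1, fun Q hQ g hg B hB hBg => ?_⟩
  have hQp : 0 < Q := by omega
  choose b hbd hbs using fun v => digits Q hQp n (B v) (hB v)
  let B' : V × Fin n → (Fb Fq)[X] := fun i => b i.1 i.2
  have hy : ∀ j : Fin n, yy Fq Q ^ (n-1-(j:ℕ)) = yy Fq Q ^ (n-1) * theta Fq ^ (Q * (j:ℕ)) := by
    intro j
    have : n - 1 = (n-1-(j:ℕ)) + j := by omega
    conv_rhs => rw [this, pow_add, mul_assoc, pow_mul, ← mul_pow, yy_theta, one_pow, mul_one]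
  have hsum : ∑ i, pK Fq (B' i) * (yy Fq Q ^ (n-1-(i.2:ℕ)) * g i.1) = 0 := by
    rw [Fintype.sum_prod_type]
    calc _ = ∑ v, yy Fq Q ^ (n-1) * (pK Fq (B v) * g v) := by
          refine Finset.sum_congr rfl fun v _ => ?_
          conv_rhs => rw [hbs v, map_sum, ← Fin.sum_univ_eq_sum_range (fun j => pK Fq (b v j * X ^ (Q*j))),
            Finset.sum_mul, Finset.mul_sum]
          refine Finset.sum_congr rfl fun j _ => ?_
          rw [hy, map_mul, map_pow, pK_X]; ring
      _ = 0 := by rw [← Finset.mul_sum, hBg, mul_zero]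
  obtain ⟨T, hT0, hT⟩ := Q4_T Fq Q M hQp c hc B' (fun i => hbd _ _) (by
    have : ∑ i, pK Fq (B' i) * ev Fq Q (c i) =
        - ∑ i, pK Fq (B' i) * (yy Fq Q ^ (n-1-(i.2:ℕ)) * (g i.1 - ev Fq Q (P i.1))) := by
      rw [← sub_eq_zero, sub_neg_eq_add, ← Finset.sum_add_distrib, ← hsum]
      refine Finset.sum_congr rfl fun i _ => ?_
      simp only [c, map_mul, map_pow, ev_X]; ring
    rw [this]
    refine AddSubgroup.neg_mem _ (AddSubgroup.sum_mem _ fun i _ => ?_)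
    have h1 := pK_oo Fq (B' i) (Q-1) (by have := hbd i.1 i.2; simp only [B']; omega)
    refine oo_mono ?_ (oo_mul h1 (oo_mul (oo_pow (yy_oo Fq Q) _) (hg i.1)))
    push_cast [Nat.cast_sub (show 1 ≤ Q from hQp)]
    have : (0:ℤ) ≤ ((n-1-(i.2:ℕ) : ℕ):ℤ) * Q := by positivity
    nlinarith)
  obtain ⟨Δ, H, H', hΔ, h1, h2⟩ := hQ0 Q (by omega) B' T (by
    intro m hm
    rcases m with _ | m
    · simp [hT0]
    · exact (hT m hm).2.trans (by omega)) (fun m hm => (hT m hm).1)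
  let p : V → (Fb Fq)[X][X] := fun v => ∑ j : Fin n, (C (H (v,j)) - C (H' (v,j)) * X) * X ^ (n-1-(j:ℕ))
  have hpdeg : ∀ v, (p v).natDegree ≤ n := by
    intro v
    refine natDegree_sum_le_of_forall_le _ _ fun j _ => ?_
    refine natDegree_mul_le.trans ?_
    have h1 : (C (H (v,j)) - C (H' (v,j)) * X).natDegree ≤ 1 := by
      refine (natDegree_sub_le _ _).trans (max_le (by simp) ((natDegree_C_mul_le _ _).trans natDegree_X_le))
    have h2 := natDegree_X_pow_le (R := (Fb Fq)[X]) (n-1-(j:ℕ))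
    omega
  have hp := descent n M P hInd (Finset.univ.sup fun v => (Finset.range (n+1)).sup fun i => ((p v).coeff i).natDegree)
    p hpdeg (by
      intro v i
      by_cases hi : i < n + 1
      · refine le_trans ?_ (Finset.le_sup (f := fun v => (Finset.range (n+1)).sup fun i => ((p v).coeff i).natDegree) (Finset.mem_univ v))
        exact Finset.le_sup (f := fun i => ((p v).coeff i).natDegree) (Finset.mem_range.2 hi)
      · rw [coeff_eq_zero_of_natDegree_lt (by have := hpdeg v; omega)]; simp) (by
      intro m hm
      have e1 : ∑ v, p v * P v = ∑ i, (C (H i) * c i - X * (C (H' i) * c i)) := by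
        rw [Fintype.sum_prod_type]
        refine Finset.sum_congr rfl fun v _ => ?_
        rw [Finset.sum_mul]
        refine Finset.sum_congr rfl fun j _ => ?_
        simp only [c]; ring
      rw [e1, finsetSum_coeff]
      rcases m with _ | m
      · have := (h2 0 hm).2
        rw [hT0, mul_zero] at this
        simp only [coeff_sub, coeff_C_mul, coeff_X_mul_zero, sub_zero]
        exact this.symm
      · have h3 := (h2 (m+1) hm).2
        have h4 := (h2 m (by omega)).1
        simp only [coeff_sub, coeff_C_mul, coeff_X_mul, Finset.sum_sub_distrib]
        rw [← h3, ← h4, sub_self])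
  intro v
  have h5 := congrArg (fun z => ev Fq Q z * theta Fq ^ (Q * n)) (hp v)
  simp only [p, map_sum, map_mul, map_sub, map_pow, ev_C, ev_X, map_zero, zero_mul, Finset.sum_mul] at h5
  have h6 : ∑ j : Fin n, - (pK Fq (Δ * (b v j * X ^ (Q * (j:ℕ))))) = 0 := by
    rw [← h5]
    refine Finset.sum_congr rfl fun j _ => ?_
    have e : theta Fq ^ (Q * n) = theta Fq ^ Q * theta Fq ^ (Q * (n-1-(j:ℕ))) * theta Fq ^ (Q * (j:ℕ)) := by
      rw [← pow_add, ← pow_add]; congr 1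
      have := j.2
      have : n = 1 + (n-1-(j:ℕ)) + j := by omega
      conv_lhs => rw [this]
      ring
    have e2 : yy Fq Q ^ (n-1-(j:ℕ)) * theta Fq ^ (Q * (n-1-(j:ℕ))) = 1 := by
      rw [pow_mul, ← mul_pow, yy_theta, one_pow]
    have e3 := h1 (v,j)
    simp only [B'] at e3
    rw [← mul_assoc, e3, e]
    simp only [map_mul, map_sub, map_pow, pK_X]
    linear_combination ((pK Fq (H' (v,j)) * yy Fq Q - pK Fq (H (v,j))) * theta Fq ^ Q * theta Fq ^ (Q * (j:ℕ))) * e2 + pK Fq (H' (v,j)) * theta Fq ^ (Q * (j:ℕ)) * yy_theta Fq Q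
  rw [Finset.sum_neg_distrib, neg_eq_zero, ← map_sum, ← Finset.mul_sum,
    Fin.sum_univ_eq_sum_range (fun j => b v j * X ^ (Q*j)), ← hbs v] at h6
  have h7 := (map_eq_zero_iff _ (pK_inj Fq)).1 h6
  exact (mul_eq_zero.1 h7).resolve_left hΔ

end

section
open Filter Topology
set_option linter.unusedSectionVars false

section EI
open Polynomial
variable {k : Type*} [Field k] {α : Type*} [Fintype α] (q : ℕ) (s : α → ℕ) (ε : α → k)

/-- reduced letters -/
def e0 (l : α) (d : ℕ) : k[X] := C (ε l ^ d) * (∏ i ∈ Finset.range d, (- X ^ (q ^ i))) ^ s l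

lemma e0_prod (d : ℕ) (hq : 1 < q) :
    X * expand k (q-1) (∏ i ∈ Finset.range d, (- X ^ (q ^ i) : k[X])) = C ((-1)^d) * X ^ (q ^ d) := by
  induction d with
  | zero => simp
  | succ d ih =>
    rw [Finset.prod_range_succ, map_mul, ← mul_assoc, ih, map_neg, map_pow (expand k (q-1)), expand_X, ← pow_mul]
    have : q ^ (d+1) = q ^ d + (q-1) * q^d := by
      obtain ⟨r, rfl⟩ : ∃ r, q = r + 1 := ⟨q - 1, by omega⟩
      simp only [Nat.add_sub_cancel]; ring
    rw [this, pow_add X, pow_succ (-1 : k)]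
    simp only [C_mul, C_neg, C_1]
    ring

lemma e0_eP (l : α) (d : ℕ) (hq : 1 < q) :
    X ^ s l * expand k (q-1) (e0 q s ε l d) = eP q s (fun l => (-1) ^ s l * ε l) l d := by
  rw [e0, eP, map_mul, map_pow (expand k (q-1)), expand_C]
  have h := congrArg (fun z => z ^ s l) (e0_prod (k := k) q d hq)
  simp only [mul_pow] at h
  calc _ = C (ε l ^ d) * (X ^ s l * (expand k (q-1)) (∏ i ∈ Finset.range d, (- X ^ (q ^ i) : k[X])) ^ s l) := by ring
    _ = _ := by
      rw [h, mul_pow, ← pow_mul, ← pow_mul, C_mul, ← C_pow, ← pow_mul, mul_comm d, mul_comm (q^d)]; ring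

lemma e0_SS (v : List α) (D : ℕ) (hq : 1 < q) :
    SS (eP q s (fun l => (-1) ^ s l * ε l)) v D =
      X ^ (v.map s).sum * expand k (q-1) (SS (e0 q s ε) v D) := by
  have h1 := SS_map (expand k (q-1)).toRingHom (e0 q s ε) v D
  simp only [AlgHom.toRingHom_eq_coe, RingHom.coe_coe] at h1
  have h2 := SS_scale (fun l d => expand k (q-1) (e0 q s ε l d)) (fun l => (X:k[X]) ^ s l) v D
  simp only [e0_eP q s ε _ _ hq] at h2
  have h3 : (v.map fun l => (X:k[X]) ^ s l).prod = X ^ (v.map s).sum := by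
    clear h1 h2
    induction v with
    | nil => simp
    | cons a t ih => simp [pow_add, ih]
  rw [h1, ← h3, ← h2]

lemma e0_ind (hq : 1 < q) (hε : ∀ l, ε l ≠ 0) (hs : ∀ l, ¬ q ∣ s l)
    (hinj : ∀ l l', s l = s l' → ε l = ε l' → l = l') (V : Finset (List α)) (p : List α → k[X])
    (h : Nul (fun D => ∑ v ∈ V, p v * SS (e0 q s ε) v D)) : ∀ v ∈ V, p v = 0 := by
  set W := V.sup fun v => (v.map s).sum with hW
  have hWv : ∀ v ∈ V, (v.map s).sum ≤ W := fun v hv => Finset.le_sup (f := fun v : List α => (v.map s).sum) hv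
  have key := FI_words s (fun l => (-1) ^ s l * ε l) hq (fun l => mul_ne_zero (by simp) (hε l)) hs
    (by
      intro l l' h1 h2
      apply hinj l l' h1
      simp only [h1] at h2
      exact mul_left_cancel₀ (by simp) h2) V (fun v => X ^ (W - (v.map s).sum) * expand k (q-1) (p v)) (by
      have e : ∀ D, ∑ v ∈ V, X ^ (W - (v.map s).sum) * expand k (q-1) (p v) *
          SS (eP q s (fun l => (-1) ^ s l * ε l)) v D =
          X ^ W * expand k (q-1) (∑ v ∈ V, p v * SS (e0 q s ε) v D) := by
        intro D
        rw [map_sum, Finset.mul_sum]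
        refine Finset.sum_congr rfl fun v hv => ?_
        rw [e0_SS q s ε v D hq, map_mul]
        have : (X:k[X]) ^ W = X ^ (W - (v.map s).sum) * X ^ (v.map s).sum := by
          rw [← pow_add, Nat.sub_add_cancel (hWv v hv)]
        rw [this]; ring
      intro m
      filter_upwards [h ((m - W) / (q-1))] with D hD
      rw [e, coeff_X_pow_mul']
      split_ifs
      · rw [coeff_expand (by omega)]
        split_ifs
        · exact hD
        · rfl
      · rfl)
  intro v hv
  have h1 := key v hv
  rw [mul_eq_zero] at h1
  have h2 := h1.resolve_left (pow_ne_zero _ X_ne_zero)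
  rwa [expand_eq_zero (by omega)] at h2

lemma e0_dvd (hq : 1 < q) (l : α) (hl : s l ≠ 0) (d : ℕ) : (X:k[X]) ^ d ∣ e0 q s ε l d := by
  rw [e0]
  apply Dvd.dvd.mul_left
  refine dvd_trans ?_ (dvd_pow_self _ hl)
  have h : (X:k[X]) ^ d = ∏ i ∈ Finset.range d, X := by simp
  rw [h]
  refine Finset.prod_dvd_prod_of_dvd _ _ fun i _ => ?_
  rw [dvd_neg]
  exact dvd_pow_self _ (pow_ne_zero _ (by omega))

lemma e0_stab (hq : 1 < q) (hs : ∀ l, s l ≠ 0) (v : List α) (D : ℕ) :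
    (X:k[X]) ^ D ∣ SS (e0 q s ε) v (D+1) - SS (e0 q s ε) v D := by
  cases v with
  | nil => simp
  | cons l t =>
    rw [SS_cons_succ, add_sub_cancel_left]
    exact (e0_dvd q s ε hq l (hs l) D).mul_right _

lemma e0_coeff {V : Type*} [Fintype V] (w : V → List α) (hq : 1 < q) (hs : ∀ l, s l ≠ 0) (p : V → k[X]) (m D : ℕ) (h : m < D) :
    (∑ v, p v * SS (e0 q s ε) (w v) D).coeff m = (∑ v, p v * SS (e0 q s ε) (w v) (m+1)).coeff m := by
  induction D, h using Nat.le_induction with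
  | base => rfl
  | succ D hD ih =>
    rw [← ih, ← sub_eq_zero, ← coeff_sub, ← Finset.sum_sub_distrib]
    have : (X:k[X]) ^ D ∣ ∑ v, (p v * SS (e0 q s ε) (w v) (D+1) - p v * SS (e0 q s ε) (w v) D) := by
      refine Finset.dvd_sum fun v _ => ?_
      rw [← mul_sub]
      exact (e0_stab q s ε hq hs _ D).mul_left _
    exact (X_pow_dvd_iff.1 this) m hD

theorem hInd_exists (hq : 1 < q) (hε : ∀ l, ε l ≠ 0) (hs : ∀ l, ¬ q ∣ s l)
    (hinj : ∀ l l', s l = s l' → ε l = ε l' → l = l') (V : Finset (List α)) (n : ℕ) :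
    ∃ M, 0 < M ∧ ∀ p : V → k[X], (∀ v, (p v).natDegree ≤ n) →
      (∀ m < M, (∑ v, p v * SS (e0 q s ε) v.1 M).coeff m = 0) → ∀ v, p v = 0 := by
  have hs0 : ∀ l, s l ≠ 0 := fun l h => hs l (h ▸ dvd_zero q)
  let f : ℕ → ((V → degreeLT k (n+1)) →ₗ[k] k) := fun m =>
    { toFun := fun p => (∑ v, (p v : k[X]) * SS (e0 q s ε) v.1 (m+1)).coeff m
      map_add' := by intro x y; simp [add_mul, Finset.sum_add_distrib]
      map_smul' := by intro a x; simp [Finset.mul_sum] }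
  let F : ℕ →o (Submodule k (V → degreeLT k (n+1)))ᵒᵈ :=
    ⟨fun M => OrderDual.toDual (⨅ m : Fin M, LinearMap.ker (f m)), by
      intro a b hab
      change (⨅ m : Fin b, LinearMap.ker (f m)) ≤ (⨅ m : Fin a, LinearMap.ker (f m))
      refine le_iInf fun m => ?_
      exact iInf_le (fun m : Fin b => LinearMap.ker (f m)) (Fin.castLE hab m)⟩
  have hF : ∀ M x, x ∈ OrderDual.ofDual (F M) ↔ ∀ m < M, f m x = 0 := by
    intro M x
    change x ∈ (⨅ m : Fin M, LinearMap.ker (f m)) ↔ _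
    simp only [Submodule.mem_iInf, LinearMap.mem_ker]
    exact ⟨fun h m hm => h ⟨m, hm⟩, fun h m => h m m.2⟩
  have : Module.Finite k (degreeLT k (n+1)) := Module.Finite.equiv (degreeLTEquiv k (n+1)).symm
  obtain ⟨M, hM⟩ := IsArtinian.monotone_stabilizes F
  refine ⟨M + 1, by omega, fun p hp h => ?_⟩
  let x : V → degreeLT k (n+1) := fun v => ⟨p v, by
    rw [mem_degreeLT]
    exact (degree_le_of_natDegree_le (hp v)).trans_lt (by exact_mod_cast Nat.lt_succ_self n)⟩
  have hx : x ∈ OrderDual.ofDual (F M) := by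
    rw [hF]
    intro m hm
    have := h m (by omega)
    rw [e0_coeff q s ε (fun v : V => v.1) hq hs0 p m (M+1) (by omega)] at this
    exact this
  have hall : ∀ m, (∑ v, p v * SS (e0 q s ε) v.1 (m+1)).coeff m = 0 := by
    intro m
    have h1 : x ∈ OrderDual.ofDual (F (M + (m+1))) := by
      rw [← hM (M + (m+1)) (by omega)]; exact hx
    rw [hF] at h1
    exact h1 m (by omega)
  let p' : List α → k[X] := fun v => if h : v ∈ V then p ⟨v, h⟩ else 0
  have := e0_ind q s ε hq hε hs hinj V p' (by
    intro m
    filter_upwards [eventually_gt_atTop m] with D hD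
    rw [← hall m, ← e0_coeff q s ε (fun v : V => v.1) hq hs0 p m D hD, ← Finset.sum_coe_sort]
    congr 1
    refine Finset.sum_congr rfl fun v _ => ?_
    simp [p'])
  intro v
  simpa [p'] using this v.1 v.2

end EI

end

section
open Filter Topology
set_option linter.unusedSectionVars false

open Polynomial

lemma Bd_mul {k : Type*} [Field k] {P R : k[X][X]} (hP : Bd P) (hR : Bd R) : Bd (P * R) := by
  intro m
  rw [coeff_mul]
  refine natDegree_sum_le_of_forall_le _ _ fun x hx => ?_
  have := Finset.HasAntidiagonal.mem_antidiagonal.1 hx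
  have h1 := hP x.1
  have h2 := hR x.2
  have h3 := natDegree_mul_le (p := P.coeff x.1) (q := R.coeff x.2)
  omega

lemma Bd_add {k : Type*} [Field k] {P R : k[X][X]} (hP : Bd P) (hR : Bd R) : Bd (P + R) := by
  intro m
  rw [coeff_add]
  exact (natDegree_add_le _ _).trans (max_le (hP m) (hR m))

lemma Bd_neg {k : Type*} [Field k] {P : k[X][X]} (hP : Bd P) : Bd (-P) := by
  intro m
  rw [coeff_neg, natDegree_neg]; exact hP m

lemma Bd_CC {k : Type*} [Field k] (c : k) : Bd (C (C c) : k[X][X]) := by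
  intro m
  rw [coeff_C]
  split_ifs <;> simp

/-- approximation ring -/
def ApR (Q M : ℕ) (hQ : 0 < Q) : Subring (Kinf Fq × (Fb Fq)[X][X]) where
  carrier := {x | x.1 ∈ oo (0:ℤ) ∧ Bd x.2 ∧ x.1 - ev Fq Q x.2 ∈ oo (((Q:ℤ)-1) * M)}
  zero_mem' := ⟨by simp, by intro m; simp, by simp⟩
  one_mem' := ⟨oo_one, by have := Bd_CC (1 : Fb Fq); simpa using this, by simp⟩
  add_mem' := by
    rintro x y ⟨h1, h2, h3⟩ ⟨h1', h2', h3'⟩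
    refine ⟨AddSubgroup.add_mem _ h1 h1', Bd_add h2 h2', ?_⟩
    have := AddSubgroup.add_mem _ h3 h3'
    convert this using 1
    simp only [Prod.fst_add, Prod.snd_add, map_add]; ring
  neg_mem' := by
    rintro x ⟨h1, h2, h3⟩
    refine ⟨AddSubgroup.neg_mem _ h1, Bd_neg h2, ?_⟩
    have := AddSubgroup.neg_mem _ h3
    convert this using 1
    simp only [Prod.fst_neg, Prod.snd_neg, map_neg]; ring
  mul_mem' := by
    rintro x y ⟨h1, h2, h3⟩ ⟨h1', h2', h3'⟩
    refine ⟨by simpa using oo_mul h1 h1', Bd_mul h2 h2', ?_⟩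
    have a1 := oo_mul h1 h3'
    have a2 := oo_mul h3 (ev_Bd Fq Q hQ y.2 h2')
    rw [zero_add] at a1
    rw [add_zero] at a2
    have := AddSubgroup.add_mem _ a1 a2
    convert this using 1
    simp only [Prod.fst_mul, Prod.snd_mul, map_mul]; ring

lemma mem_ApR {Q M : ℕ} (hQ : 0 < Q) (g : Kinf Fq) (P : (Fb Fq)[X][X]) :
    (g, P) ∈ ApR Fq Q M hQ ↔ g ∈ oo (0:ℤ) ∧ Bd P ∧ g - ev Fq Q P ∈ oo (((Q:ℤ)-1) * M) := Iff.rfl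

/-- truncated geometric factor -/
def tau {k : Type*} [Field k] (M b : ℕ) : k[X][X] := - X ^ b * ∑ n ∈ Finset.range M, (C X * X ^ b) ^ n

lemma tau_red {k : Type*} [Field k] (M b : ℕ) (hM : 0 < M) : (tau M b : k[X][X]).map (evalRingHom 0) = - X ^ b := by
  obtain ⟨r, rfl⟩ : ∃ r, M = r + 1 := ⟨M - 1, by omega⟩
  rw [tau, Finset.sum_range_succ']
  simp [Polynomial.map_sum, Polynomial.map_mul, Polynomial.map_pow]

lemma CXX_Bd {k : Type*} [Field k] (b : ℕ) (hb : 0 < b) : Bd (C X * X ^ b : k[X][X]) := by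
  intro m
  rw [coeff_C_mul, coeff_X_pow]
  split_ifs with h
  · subst h; simp; omega
  · simp

lemma tau_mem (Q M b : ℕ) (hQ : 1 < Q) (hb : 0 < b) :
    ((theta Fq - theta Fq ^ (Q * b))⁻¹, tau M b) ∈ ApR Fq Q M (by omega) := by
  have hlt : 1 < Q * b := by nlinarith
  have hr := br_oo Fq hlt
  have hne := br_ne Fq hlt
  rw [pow_one] at hr hne
  have hb1 : (1:ℤ) ≤ b := by exact_mod_cast hb
  have hQ1 : (1:ℤ) < Q := by exact_mod_cast hQ
  rw [mem_ApR]
  refine ⟨oo_mono (by positivity) hr, ?_, ?_⟩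
  · rw [tau]
    have hX : Bd (X ^ b : (Fb Fq)[X][X]) := by
      have := Bd_X_mul b (1 : (Fb Fq)[X][X]) (by simpa using Bd_CC (1 : Fb Fq))
      simpa using this
    refine Bd_mul (Bd_neg hX) ?_
    have : ∀ n, Bd ((C X * X ^ b : (Fb Fq)[X][X]) ^ n) := by
      intro n
      induction n with
      | zero => simpa using Bd_CC (1 : Fb Fq)
      | succ n ih => rw [pow_succ]; exact Bd_mul ih (CXX_Bd b hb)
    have hs : ∀ n, Bd (∑ i ∈ Finset.range n, (C X * X ^ b : (Fb Fq)[X][X]) ^ i) := by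
      intro n
      induction n with
      | zero => intro m; simp
      | succ n ih => rw [Finset.sum_range_succ]; exact Bd_add ih (this n)
    exact hs M
  · set t := theta Fq * yy Fq Q ^ b with ht
    have hev : ev Fq Q (tau M b) = - yy Fq Q ^ b * ∑ n ∈ Finset.range M, t ^ n := by
      simp [tau, ev_C, ev_X, pK_X, ht]
    have hgeom := geom_sum_mul_neg t M
    have hyt : yy Fq Q ^ b * theta Fq ^ (Q * b) = 1 := by rw [pow_mul, ← mul_pow, yy_theta, one_pow]
    have e : (theta Fq - theta Fq ^ (Q * b))⁻¹ - ev Fq Q (tau M b) = (theta Fq - theta Fq ^ (Q * b))⁻¹ * t ^ M := by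
      apply mul_left_cancel₀ hne
      rw [mul_sub, ← mul_assoc, mul_inv_cancel₀ hne, one_mul, hev]
      have : (theta Fq - theta Fq ^ (Q * b)) * (-yy Fq Q ^ b * ∑ n ∈ Finset.range M, t ^ n) = (∑ n ∈ Finset.range M, t ^ n) * (1 - t) := by
        rw [ht]
        linear_combination (∑ n ∈ Finset.range M, (theta Fq * yy Fq Q ^ b) ^ n) * hyt
      rw [this, hgeom]; ring
    rw [e]
    have htoo : t ∈ oo (-1 + (b:ℤ) * Q) := by
      rw [ht]
      refine oo_mul ?_ (oo_pow (yy_oo Fq Q) b)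
      have := theta_pow_oo Fq 1
      simpa using this
    refine oo_mono ?_ (oo_mul hr (oo_pow htoo M))
    have : (0:ℤ) ≤ M := by positivity
    have h2 : (Q:ℤ) - 1 ≤ -1 + b * Q := by nlinarith
    have h3 : (0:ℤ) ≤ ((Q * b : ℕ):ℤ) := by positivity
    nlinarith [mul_le_mul_of_nonneg_left h2 this]

section
variable {α : Type*} [Fintype α] (s : α → ℕ) (ε : α → Fb Fq)

/-- approximating letters -/
def eA (M : ℕ) (l : α) (d : ℕ) : (Fb Fq)[X][X] :=
  C (C (ε l ^ d)) * (∏ i ∈ Finset.range d, tau M (qc Fq ^ i)) ^ s l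

/-- shifted letters -/
def eG (k : ℕ) (l : α) (d : ℕ) : Kinf Fq :=
  cst Fq (ε l ^ d) * (∏ i ∈ Finset.range d, (theta Fq - theta Fq ^ (qc Fq ^ (k+1) * qc Fq ^ i))⁻¹) ^ s l

lemma Qgt (k : ℕ) : 1 < qc Fq ^ (k+1) := Nat.one_lt_pow (Nat.succ_ne_zero k) (qc_gt Fq)

lemma SS_mem {R : Type*} [CommRing R] (S : Subring R) (e : α → ℕ → R) (he : ∀ l d, e l d ∈ S) (v : List α) (D : ℕ) :
    SS e v D ∈ S := by
  induction v generalizing D with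
  | nil => rw [SS_nil]; exact S.one_mem
  | cons l t ih => rw [SS_cons]; exact S.sum_mem fun d _ => S.mul_mem (he l d) (ih d)

lemma let_mem (k M : ℕ) (l : α) (d : ℕ) :
    (eG Fq s ε k l d, eA Fq s ε M l d) ∈ ApR Fq (qc Fq ^ (k+1)) M (by have := Qgt Fq k; omega) := by
  have h1 : (cst Fq (ε l ^ d), C (C (ε l ^ d))) ∈ ApR Fq (qc Fq ^ (k+1)) M (by have := Qgt Fq k; omega) := by
    rw [mem_ApR]
    refine ⟨cst_oo Fq _, Bd_CC _, ?_⟩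
    rw [ev_C, pK_C, sub_self]; exact AddSubgroup.zero_mem _
  have h2 := Subring.pow_mem _ (Subring.prod_mem (ApR Fq (qc Fq ^ (k+1)) M (by have := Qgt Fq k; omega)) (t := Finset.range d)
    (f := fun i => ((theta Fq - theta Fq ^ (qc Fq ^ (k+1) * qc Fq ^ i))⁻¹, tau M (qc Fq ^ i)))
    fun i _ => tau_mem Fq (qc Fq ^ (k+1)) M (qc Fq ^ i) (Qgt Fq k) (pow_pos (by have := qc_gt Fq; omega) i)) (s l)
  have h3 := Subring.mul_mem _ h1 h2
  convert h3 using 1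
  ext1
  · simp [eG, Prod.fst_prod]
  · simp [eA, Prod.snd_prod]

lemma app_SS (k M : ℕ) (v : List α) (D : ℕ) :
    Bd (SS (eA Fq s ε M) v D) ∧
    SS (eG Fq s ε k) v D - ev Fq (qc Fq ^ (k+1)) (SS (eA Fq s ε M) v D) ∈ oo ((((qc Fq ^ (k+1) : ℕ):ℤ)-1) * M) := by
  have h := SS_mem (ApR Fq (qc Fq ^ (k+1)) M (by have := Qgt Fq k; omega)) (fun l d => (eG Fq s ε k l d, eA Fq s ε M l d))
    (let_mem Fq s ε k M) v D
  have h1 := SS_map (RingHom.fst (Kinf Fq) ((Fb Fq)[X][X])) (fun l d => (eG Fq s ε k l d, eA Fq s ε M l d)) v D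
  have h2 := SS_map (RingHom.snd (Kinf Fq) ((Fb Fq)[X][X])) (fun l d => (eG Fq s ε k l d, eA Fq s ε M l d)) v D
  obtain ⟨-, a2, a3⟩ := h
  simp only [RingHom.coe_fst, RingHom.coe_snd] at h1 h2
  rw [h1, h2] at a3
  rw [h2] at a2
  exact ⟨a2, a3⟩

lemma eA_red (M : ℕ) (hM : 0 < M) (v : List α) (D : ℕ) :
    (SS (eA Fq s ε M) v D).map (evalRingHom 0) = SS (e0 (qc Fq) s ε) v D := by
  have := SS_map (mapRingHom (evalRingHom (0 : Fb Fq))) (eA Fq s ε M) v D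
  rw [coe_mapRingHom] at this
  rw [this]
  refine SS_congr v (fun l _ d => ?_) D
  rw [eA, e0, Polynomial.map_mul, Polynomial.map_pow, Polynomial.map_prod]
  simp_rw [tau_red M _ hM]
  simp

lemma eG_oo (k : ℕ) (l : α) (hl : 0 < s l) (d : ℕ) : eG Fq s ε k l d ∈ oo (((qc Fq ^ (k+1) : ℕ):ℤ) * d) := by
  have h1 : (∏ i ∈ Finset.range d, (theta Fq - theta Fq ^ (qc Fq ^ (k+1) * qc Fq ^ i))⁻¹) ∈
      oo (∑ i ∈ Finset.range d, ((qc Fq ^ (k+1) : ℕ):ℤ)) := by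
    refine oo_prod _ _ _ fun i _ => ?_
    have hb : 1 ≤ qc Fq ^ i := Nat.one_le_pow _ _ (by have := qc_gt Fq; omega)
    have := br_oo Fq (a := 1) (b := qc Fq ^ (k+1) * qc Fq ^ i) (by have := Qgt Fq k; nlinarith)
    rw [pow_one] at this
    refine oo_mono ?_ this
    exact_mod_cast Nat.le_mul_of_pos_right _ hb
  rw [Finset.sum_const, Finset.card_range, nsmul_eq_mul] at h1
  rw [eG]
  refine oo_mono ?_ (oo_mul (cst_oo Fq _) (oo_pow h1 (s l)))
  have h2 : (1:ℤ) ≤ s l := by exact_mod_cast hl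
  have h3 : (0:ℤ) ≤ (d:ℤ) * ((qc Fq ^ (k+1) : ℕ):ℤ) := by positivity
  nlinarith

lemma SS_tail (e : α → ℕ → Kinf Fq) (c : ℤ) (hc : 0 ≤ c) (he : ∀ l d, e l d ∈ oo (c * (d:ℕ))) (v : List α) (M D : ℕ) (h : M ≤ D) :
    SS e v D - SS e v M ∈ oo (c * M) := by
  have h0 : ∀ (v : List α) (D : ℕ), SS e v D ∈ oo 0 := by
    intro v
    induction v with
    | nil => intro D; rw [SS_nil]; exact oo_one
    | cons l t ih =>
      intro D
      rw [SS_cons]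
      refine AddSubgroup.sum_mem _ fun d _ => oo_mono ?_ (oo_mul (he l d) (ih d))
      positivity
  induction D, h using Nat.le_induction with
  | base => rw [sub_self]; exact AddSubgroup.zero_mem _
  | succ D hD ih =>
    cases v with
    | nil => simp
    | cons l t =>
      rw [SS_cons_succ, add_sub_right_comm]
      refine AddSubgroup.add_mem _ ih (oo_mono ?_ (oo_mul (he l D) (h0 t D)))
      rw [add_zero]
      apply mul_le_mul_of_nonneg_left _ hc; exact_mod_cast hD

theorem main5 (hε : ∀ l, ε l ≠ 0) (hs : ∀ l, ¬ qc Fq ∣ s l)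
    (hinj : ∀ l l', s l = s l' → ε l = ε l' → l = l') (V : Finset (List α)) (n : ℕ) :
    ∃ k0, ∀ k ≥ k0, ∀ g : List α → Kinf Fq, (∀ v ∈ V, Tendsto (SS (eG Fq s ε k) v) atTop (𝓝 (g v))) →
      ∀ B : List α → (Fb Fq)[X], (∀ v ∈ V, ∀ i, n * qc Fq ^ (k+1) ≤ i → (B v).coeff i = 0) →
      ∑ v ∈ V, pK Fq (B v) * g v = 0 → ∀ v ∈ V, B v = 0 := by
  have hs0 : ∀ l, 0 < s l := fun l => Nat.pos_of_ne_zero fun h => hs l (h ▸ dvd_zero _)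
  obtain ⟨M, hM, hInd⟩ := hInd_exists (qc Fq) s ε (qc_gt Fq) hε hs hinj V n
  obtain ⟨Q0, hQ0⟩ := lemL Fq n M (fun v : V => SS (eA Fq s ε M) v.1 M) (fun v => (app_SS Fq s ε 0 M v.1 M).1) (by
    intro p h1 h2
    apply hInd p h1
    intro m hm
    have := h2 m hm
    simp_rw [eA_red Fq s ε M hM] at this
    exact this)
  refine ⟨Q0, fun k hk g hg B hB hsum v hv => ?_⟩
  have hQ : Q0 ≤ qc Fq ^ (k+1) := by
    have := Nat.lt_pow_self (n := k+1) (qc_gt Fq)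
    omega
  refine hQ0 _ hQ (fun v => g v.1) ?_ (fun v => B v.1) (fun v => hB v.1 v.2) ?_ ⟨v, hv⟩
  · rintro ⟨v, hv⟩
    have h1 : g v - SS (eG Fq s ε k) v M ∈ oo ((((qc Fq ^ (k+1) : ℕ):ℤ)-1) * M) := by
      refine lim_mem_oo ((hg v hv).sub_const _) ?_
      filter_upwards [eventually_ge_atTop M] with D hD
      refine oo_mono ?_ (SS_tail Fq (eG Fq s ε k) ((qc Fq ^ (k+1) : ℕ):ℤ) (by positivity) (fun l d => eG_oo Fq s ε k l (hs0 l) d) v M D hD)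
      have : (0:ℤ) ≤ M := by positivity
      nlinarith
    have h2 := (app_SS Fq s ε k M v M).2
    have := AddSubgroup.add_mem _ h1 h2
    simpa using this
  · rw [← hsum]
    exact Finset.sum_coe_sort V (fun v => pK Fq (B v) * g v)
end

end

section
open Filter Topology
set_option linter.unusedSectionVars false

open Polynomial

/-- polynomial elements of bounded degree -/
def IP (n : ℕ) (x : Kinf Fq) : Prop := ∃ p : (Fb Fq)[X], p.natDegree ≤ n ∧ pK Fq p = x

variable {Fq}
lemma IP_mono {n m : ℕ} {x : Kinf Fq} (h : n ≤ m) (hx : IP Fq n x) : IP Fq m x := by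
  obtain ⟨p, h1, h2⟩ := hx
  exact ⟨p, h1.trans h, h2⟩
lemma IP_mul {n m : ℕ} {x y : Kinf Fq} (hx : IP Fq n x) (hy : IP Fq m y) : IP Fq (n + m) (x * y) := by
  obtain ⟨p, h1, h2⟩ := hx
  obtain ⟨r, h3, h4⟩ := hy
  exact ⟨p * r, natDegree_mul_le.trans (by omega), by rw [map_mul, h2, h4]⟩
lemma IP_pow {n : ℕ} {x : Kinf Fq} (hx : IP Fq n x) (m : ℕ) : IP Fq (m * n) (x ^ m) := by
  obtain ⟨p, h1, h2⟩ := hx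
  exact ⟨p ^ m, natDegree_pow_le.trans (Nat.mul_le_mul_left _ h1), by rw [map_pow, h2]⟩
lemma IP_sum {ι : Type*} (S : Finset ι) {n : ℕ} (f : ι → Kinf Fq) (h : ∀ i ∈ S, IP Fq n (f i)) :
    IP Fq n (∑ i ∈ S, f i) := by
  choose! p h1 h2 using h
  refine ⟨∑ i ∈ S, p i, natDegree_sum_le_of_forall_le _ _ h1, ?_⟩
  rw [map_sum]
  exact Finset.sum_congr rfl h2
variable (Fq)
lemma IP_cst (c : Fb Fq) : IP Fq 0 (cst Fq c) := ⟨C c, by simp, pK_C Fq c⟩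
lemma IP_one : IP Fq 0 1 := ⟨1, by simp, by simp⟩

lemma IP_ell (d k : ℕ) (h : d ≤ k) : IP Fq (2 * qc Fq ^ k) (ell Fq k / ell Fq d) := by
  have hq := qc_gt Fq
  induction k, h using Nat.le_induction with
  | base => rw [div_self (ell_ne Fq d)]; exact IP_mono (by omega) (IP_one Fq)
  | succ k hk ih =>
    rw [ell_succ, mul_div_right_comm]
    have h1 : IP Fq (qc Fq ^ (k+1)) (theta Fq - theta Fq ^ qc Fq ^ (k+1)) := by
      refine ⟨X - X ^ qc Fq ^ (k+1), ?_, by simp [pK_X]⟩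
      refine (natDegree_sub_le _ _).trans (max_le ?_ (by simp))
      rw [natDegree_X]; exact Nat.one_le_pow _ _ (by omega)
    refine IP_mono ?_ (IP_mul ih h1)
    have : 2 * qc Fq ^ k ≤ qc Fq ^ (k+1) := by rw [pow_succ, mul_comm]; exact Nat.mul_le_mul_left _ hq
    omega

lemma IP_ell' (k : ℕ) : IP Fq (2 * qc Fq ^ k) (ell Fq k) := by
  have := IP_ell Fq 0 k (Nat.zero_le k)
  rwa [ell_zero, div_one] at this

section
variable {α : Type*} [Fintype α] (s : α → ℕ) (ε : α → Fb Fq)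

/-- real letters -/
def eR (l : α) (d : ℕ) : Kinf Fq := eL Fq (s l, ε l) d

lemma IP_SS (k : ℕ) (v : List α) (D : ℕ) (hD : D ≤ k) :
    IP Fq ((v.map s).sum * (2 * qc Fq ^ k)) (ell Fq k ^ (v.map s).sum * SS (eR Fq s ε) v D) := by
  induction v generalizing D with
  | nil => simpa using IP_one Fq
  | cons l t ih =>
    rw [SS_cons, Finset.mul_sum]
    refine IP_sum _ _ fun d hd => ?_
    have hd' := Finset.mem_range.1 hd
    have h1 := IP_mul (IP_mul (IP_cst Fq (ε l ^ d)) (IP_pow (IP_ell Fq d k (by omega)) (s l))) (ih d (by omega))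
    have e : ell Fq k ^ ((l :: t).map s).sum * (eR Fq s ε l d * SS (eR Fq s ε) t d) =
      cst Fq (ε l ^ d) * (ell Fq k / ell Fq d) ^ s l * (ell Fq k ^ (t.map s).sum * SS (eR Fq s ε) t d) := by
      rw [List.map_cons, List.sum_cons, pow_add, div_pow]
      simp only [eR, eL]; ring
    rw [e]
    refine IP_mono ?_ h1
    rw [List.map_cons, List.sum_cons, zero_add, add_mul]

/-- shift factor -/
def gam (k : ℕ) (l : α) : Kinf Fq := cst Fq (ε l ^ k) / ell Fq k ^ s l

lemma ell_add (k d : ℕ) : ell Fq (k + d) = ell Fq k * ∏ i ∈ Finset.range d, (theta Fq - theta Fq ^ (qc Fq ^ (k+1) * qc Fq ^ i)) := by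
  induction d with
  | zero => simp
  | succ d ih =>
    rw [← add_assoc, ell_succ, ih, Finset.prod_range_succ, ← pow_add, mul_assoc]
    congr 5; ring_nf

lemma eR_shift (k : ℕ) (l : α) (d : ℕ) : eR Fq s ε l (k + d) = gam Fq s ε k l * eG Fq s ε k l d := by
  rw [eR, eL, gam, eG, ell_add, Finset.prod_inv_distrib, pow_add, map_mul, mul_pow, inv_pow]
  field_simp

lemma gam_ne (hε : ∀ l, ε l ≠ 0) (k : ℕ) (v : List α) : (v.map (gam Fq s ε k)).prod ≠ 0 := by
  apply List.prod_ne_zero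
  intro h
  obtain ⟨l, -, hl⟩ := List.mem_map.1 h
  rw [gam, div_eq_zero_iff] at hl
  rcases hl with hl | hl
  · rw [map_eq_zero] at hl
    exact hε l (eq_zero_of_pow_eq_zero hl)
  · exact pow_ne_zero _ (ell_ne Fq k) hl

lemma IP_gam (k : ℕ) (v : List α) : IP Fq 0 (ell Fq k ^ (v.map s).sum * (v.map (gam Fq s ε k)).prod) := by
  induction v with
  | nil => simpa using IP_one Fq
  | cons l t ih =>
    have h1 := IP_mul (IP_cst Fq (ε l ^ k)) ih
    have e : ell Fq k ^ ((l :: t).map s).sum * ((l :: t).map (gam Fq s ε k)).prod =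
        cst Fq (ε l ^ k) * (ell Fq k ^ (t.map s).sum * (t.map (gam Fq s ε k)).prod) := by
      have := pow_ne_zero (s l) (ell_ne Fq k)
      rw [List.map_cons, List.sum_cons, List.map_cons, List.prod_cons, pow_add, gam]
      field_simp
    rw [e]; exact h1

lemma IP_full (k W : ℕ) (u : List α) (hu : (u.map s).sum ≤ W) (i : ℕ) :
    IP Fq (W * (2 * qc Fq ^ k)) (ell Fq k ^ W * (((u.take i).map (gam Fq s ε k)).prod * SS (eR Fq s ε) (u.drop i) k)) := by
  have hsum : (u.map s).sum = ((u.take i).map s).sum + ((u.drop i).map s).sum := by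
    rw [← List.sum_append, ← List.map_append, List.take_append_drop]
  have h1 := IP_mul (IP_pow (IP_ell' Fq k) (W - (u.map s).sum)) (IP_mul (IP_gam Fq s ε k (u.take i)) (IP_SS Fq s ε k (u.drop i) k le_rfl))
  have hW : W = (W - (u.map s).sum) + (((u.take i).map s).sum + ((u.drop i).map s).sum) := by omega
  have e : ell Fq k ^ W = ell Fq k ^ (W - (u.map s).sum) * (ell Fq k ^ ((u.take i).map s).sum * ell Fq k ^ ((u.drop i).map s).sum) := by
    rw [← pow_add, ← pow_add, ← hW]
  rw [e]
  have h2 := IP_mono (m := W * (2 * qc Fq ^ k)) (by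
    rw [zero_add, ← add_mul]
    exact Nat.mul_le_mul_right _ (by omega)) h1
  convert h2 using 1
  ring

theorem main7 (hε : ∀ l, ε l ≠ 0) (hs : ∀ l, ¬ qc Fq ∣ s l)
    (hinj : ∀ l l', s l = s l' → ε l = ε l' → l = l') {ι : Type*} (S : Finset ι) (u : ι → List α)
    (hu : Set.InjOn u S) (L : ι → Kinf Fq) (hL : ∀ j ∈ S, Tendsto (SS (eR Fq s ε) (u j)) atTop (𝓝 (L j)))
    (a : ι → (Fb Fq)[X]) (h0 : ∑ j ∈ S, pK Fq (a j) * L j = 0) : ∀ j ∈ S, a j = 0 := by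
  have hs0 : ∀ l, 0 < s l := fun l => Nat.pos_of_ne_zero fun h => hs l (h ▸ dvd_zero _)
  have hq := qc_gt Fq
  set W := S.sup fun j => ((u j).map s).sum with hWdef
  have hW : ∀ j ∈ S, ((u j).map s).sum ≤ W := fun j hj => Finset.le_sup (f := fun j => ((u j).map s).sum) hj
  set A := S.sup fun j => (a j).natDegree with hAdef
  have hA : ∀ j ∈ S, (a j).natDegree ≤ A := fun j hj => Finset.le_sup (f := fun j => (a j).natDegree) hj
  let V : Finset (List α) := S.biUnion fun j => (Finset.range ((u j).length + 1)).image fun i => (u j).take i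
  have hV : ∀ j ∈ S, ∀ i ∈ Finset.range ((u j).length + 1), (u j).take i ∈ V := fun j hj i hi =>
    Finset.mem_biUnion.2 ⟨j, hj, Finset.mem_image.2 ⟨i, hi, rfl⟩⟩
  obtain ⟨k0, hk0⟩ := main5 Fq s ε hε hs hinj V (W + 1)
  set k := max k0 A with hk
  have hqk : A < qc Fq ^ k := lt_of_le_of_lt (le_max_right k0 A) (Nat.lt_pow_self hq)
  have hlim : ∀ v : List α, ∃ g, Tendsto (SS (eG Fq s ε k) v) atTop (𝓝 g) := by
    intro v
    obtain ⟨g, hg, -⟩ := SS_lim (eG Fq s ε k) v (fun l _ d => oo_mono (by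
      have : (1:ℤ) ≤ ((qc Fq ^ (k+1) : ℕ) : ℤ) := by exact_mod_cast (Qgt Fq k).le
      have : (0:ℤ) ≤ d := by positivity
      nlinarith) (eG_oo Fq s ε k l (hs0 l) d))
    exact ⟨g, hg⟩
  choose g hg using hlim
  have hLd : ∀ j ∈ S, L j = ∑ i ∈ Finset.range ((u j).length + 1),
      (((u j).take i).map (gam Fq s ε k)).prod * g ((u j).take i) * SS (eR Fq s ε) ((u j).drop i) k := by
    intro j hj
    have h1 : Tendsto (fun D => SS (eR Fq s ε) (u j) (k + D)) atTop (𝓝 (L j)) :=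
      (hL j hj).comp (tendsto_atTop_mono (fun D => Nat.le_add_left D k) tendsto_id)
    refine tendsto_nhds_unique h1 ?_
    simp_rw [SS_decon, eR_shift]
    refine tendsto_finsetSum _ fun i _ => ?_
    simp_rw [SS_scale]
    exact ((hg _).const_mul _).mul_const _
  have hb : ∀ j i, ∃ p : (Fb Fq)[X], j ∈ S → (p.natDegree ≤ W * (2 * qc Fq ^ k) ∧ pK Fq p =
      ell Fq k ^ W * ((((u j).take i).map (gam Fq s ε k)).prod * SS (eR Fq s ε) ((u j).drop i) k)) := by
    intro j i
    by_cases hj : j ∈ S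
    · obtain ⟨p, h1, h2⟩ := IP_full Fq s ε k W (u j) (hW j hj) i
      exact ⟨p, fun _ => ⟨h1, h2⟩⟩
    · exact ⟨0, fun h => absurd h hj⟩
  choose b hb using hb
  let B : List α → (Fb Fq)[X] := fun v => ∑ j ∈ S, ∑ i ∈ Finset.range ((u j).length + 1),
    if (u j).take i = v then a j * b j i else 0
  have hB := hk0 k (le_max_left _ _) g (fun v _ => hg v) B (by
    intro v _ i hi
    apply coeff_eq_zero_of_natDegree_lt
    refine lt_of_le_of_lt (?_ : _ ≤ A + W * (2 * qc Fq ^ k)) ?_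
    · refine natDegree_sum_le_of_forall_le _ _ fun j hj => natDegree_sum_le_of_forall_le _ _ fun i _ => ?_
      split_ifs
      · exact natDegree_mul_le.trans (Nat.add_le_add (hA j hj) (hb j i hj).1)
      · simp
    · refine lt_of_lt_of_le ?_ hi
      have h2 : 2 * qc Fq ^ k ≤ qc Fq ^ (k+1) := by rw [pow_succ, mul_comm]; exact Nat.mul_le_mul_left _ hq
      have h3 := Nat.mul_le_mul_left W h2
      rw [add_mul, one_mul]
      omega) (by
    have e : ∑ v ∈ V, pK Fq (B v) * g v = ell Fq k ^ W * ∑ j ∈ S, pK Fq (a j) * L j := by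
      simp only [B, map_sum, Finset.sum_mul]
      rw [Finset.sum_comm, Finset.mul_sum]
      refine Finset.sum_congr rfl fun j hj => ?_
      rw [Finset.sum_comm, hLd j hj, Finset.mul_sum, Finset.mul_sum]
      refine Finset.sum_congr rfl fun i hi => ?_
      rw [Finset.sum_eq_single ((u j).take i)]
      · rw [if_pos rfl, map_mul, (hb j i hj).2]; ring
      · intro v _ hv
        rw [if_neg hv.symm, map_zero, zero_mul]
      · intro h; exact absurd (hV j hj i hi) h
    rw [e, h0, mul_zero])
  by_contra hcon
  push Not at hcon
  obtain ⟨j0, hj0, ha0⟩ := hcon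
  obtain ⟨j, hj, hmax⟩ := Finset.exists_max_image (S.filter fun j => a j ≠ 0) (fun j => (u j).length) ⟨j0, by simp [hj0, ha0]⟩
  rw [Finset.mem_filter] at hj
  have hBj := hB (u j) (by
    have := hV j hj.1 (u j).length (by simp)
    rwa [List.take_length] at this)
  have e : B (u j) = a j * b j (u j).length := by
    simp only [B]
    rw [Finset.sum_eq_single j]
    · rw [Finset.sum_eq_single (u j).length]
      · rw [if_pos (List.take_length)]
      · intro i hi hne
        rw [if_neg]
        intro h
        have := congrArg List.length h
        rw [List.length_take] at this
        have := Finset.mem_range.1 hi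
        omega
      · intro h; simp at h
    · intro j' hj' hne
      refine Finset.sum_eq_zero fun i hi => ?_
      split_ifs with h
      · by_cases ha : a j' = 0
        · rw [ha, zero_mul]
        · exfalso
          have h1 := hmax j' (Finset.mem_filter.2 ⟨hj', ha⟩)
          have h2 := congrArg List.length h
          rw [List.length_take] at h2
          have h3 := Finset.mem_range.1 hi
          have h4 : (u j').take i = u j' := List.take_of_length_le (by omega)
          rw [h4] at h
          exact hne (hu hj' hj.1 h)
      · rfl
    · intro h; exact absurd hj.1 h
  rw [e, mul_eq_zero] at hBj
  have h5 := hBj.resolve_left hj.2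
  have h6 := (hb j (u j).length hj.1).2
  rw [h5, map_zero, List.take_length, List.drop_length, SS_nil, mul_one] at h6
  exact mul_ne_zero (pow_ne_zero _ (ell_ne Fq k)) (gam_ne Fq s ε hε k (u j)) h6.symm
end

end

section
open Filter Topology
set_option linter.unusedSectionVars false

open Polynomial

lemma KNf_frac (N : ℕ) (x : Kinf Fq) (hx : x ∈ KNf Fq N) : ∃ a b : (Fb Fq)[X], b ≠ 0 ∧ x * pK Fq b = pK Fq a := by
  have hne : ∀ b : (Fb Fq)[X], b ≠ 0 → pK Fq b ≠ 0 := fun b hb => (map_ne_zero_iff _ (pK_inj Fq)).2 hb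
  induction hx using Subfield.closure_induction with
  | mem x hx =>
    rcases hx with ⟨c, -, rfl⟩ | rfl
    · exact ⟨C c, 1, one_ne_zero, by simp [pK_C]⟩
    · exact ⟨X, 1, one_ne_zero, by simp [pK_X]⟩
  | one => exact ⟨1, 1, one_ne_zero, by simp⟩
  | add x y _ _ hx hy =>
    obtain ⟨a, b, hb, h⟩ := hx
    obtain ⟨a', b', hb', h'⟩ := hy
    refine ⟨a * b' + a' * b, b * b', mul_ne_zero hb hb', ?_⟩
    rw [map_add, map_mul, map_mul, map_mul, ← h, ← h']; ring
  | neg x _ hx =>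
    obtain ⟨a, b, hb, h⟩ := hx
    exact ⟨-a, b, hb, by rw [map_neg, ← h]; ring⟩
  | inv x _ hx =>
    obtain ⟨a, b, hb, h⟩ := hx
    by_cases h0 : x = 0
    · exact ⟨0, 1, one_ne_zero, by simp [h0]⟩
    · refine ⟨b, a, ?_, ?_⟩
      · rintro rfl
        rw [map_zero] at h
        exact mul_ne_zero h0 (hne b hb) h
      · rw [← h, inv_mul_cancel_left₀ h0]
  | mul x y _ _ hx hy =>
    obtain ⟨a, b, hb, h⟩ := hx
    obtain ⟨a', b', hb', h'⟩ := hy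
    refine ⟨a * a', b * b', mul_ne_zero hb hb', ?_⟩
    rw [map_mul, map_mul, ← h, ← h']; ring

lemma word_inj {F : Type} : Function.Injective (word : PArr F → List (ℕ × F)) := by
  rintro ⟨n, s, e⟩ ⟨n', s', e'⟩ h
  have hl := congrArg List.length h
  simp only [word, List.length_ofFn] at hl
  subst hl
  simp only [word] at h
  have := List.ofFn_injective h
  have h1 : s = s' := by ext i; exact congrArg Prod.fst (congrFun this i)
  have h2 : e = e' := by ext i; exact congrArg Prod.snd (congrFun this i)
  rw [h1, h2]

theorem lin_ind (N w : ℕ) (hN : 0 < N) : LinearIndependent (KNf Fq N) (fun A : SwIdx Fq N w => Li Fq A.1) := by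
  rw [linearIndependent_iff']
  intro S c hc
  let Lt : Finset (Let Fq) := S.biUnion fun A => (word A.1).toFinset
  have hLt : ∀ l ∈ Lt, l.2 ≠ 0 ∧ ¬ qc Fq ∣ l.1 := by
    intro l hl
    obtain ⟨A, -, hA⟩ := Finset.mem_biUnion.1 hl
    obtain ⟨i, rfl⟩ := (mem_word Fq A.1 l).1 (List.mem_toFinset.1 hA)
    refine ⟨?_, A.2.2.2.2 i⟩
    intro h
    have := A.2.1.2 i
    simp only at h
    rw [h, zero_pow hN.ne'] at this
    exact zero_ne_one this
  have hlift : ∀ A : SwIdx Fq N w, ∃ v : List Lt, A ∈ S → v.map Subtype.val = word A.1 := by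
    intro A
    by_cases hA : A ∈ S
    · refine ⟨(word A.1).attachWith (fun l => l ∈ Lt) (fun l hl => Finset.mem_biUnion.2 ⟨A, hA, List.mem_toFinset.2 hl⟩), fun _ => ?_⟩
      simp only [List.map_attachWith]
      exact List.attach_map_subtype_val _
    · exact ⟨[], fun h => absurd h hA⟩
  choose u hu using hlift
  choose a b hb hab using fun A => KNf_frac Fq N (c A : Kinf Fq) (c A).2
  have key := main7 Fq (fun l : Lt => l.1.1) (fun l : Lt => l.1.2) (fun l => (hLt l.1 l.2).1) (fun l => (hLt l.1 l.2).2)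
    (fun l l' h1 h2 => Subtype.ext (Prod.ext h1 h2)) S u (by
      intro A hA A' hA' h
      have h1 := hu A hA
      rw [h, hu A' hA'] at h1
      exact (Subtype.ext (word_inj h1)).symm) (fun A => Li Fq A.1) (by
      intro A hA
      have h1 := tendsto_Li Fq A.1 A.2.1.1
      rw [← hu A hA] at h1
      have h2 : SS (eR Fq (fun l : Lt => l.1.1) (fun l : Lt => l.1.2)) (u A) = SS (eL Fq) ((u A).map Subtype.val) := by
        ext1 D
        rw [SS_mapword]; rfl
      rw [h2]; exact h1) (fun A => a A * ∏ A' ∈ S.erase A, b A') (by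
      have e : ∑ A ∈ S, pK Fq (a A * ∏ A' ∈ S.erase A, b A') * Li Fq A.1 =
          pK Fq (∏ A ∈ S, b A) * ∑ A ∈ S, c A • Li Fq A.1 := by
        rw [Finset.mul_sum]
        refine Finset.sum_congr rfl fun A hA => ?_
        rw [← Finset.mul_prod_erase S b hA, map_mul, map_mul, ← hab A, Subfield.smul_def, smul_eq_mul]
        ring
      rw [e, hc, mul_zero])
  intro A hA
  have h1 := key A hA
  rw [mul_eq_zero] at h1
  have h2 := h1.resolve_right (Finset.prod_ne_zero_iff.2 fun A' _ => hb A')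
  have h3 := hab A
  rw [h2, map_zero, mul_eq_zero] at h3
  have h4 := h3.resolve_right ((map_ne_zero_iff _ (pK_inj Fq)).2 (hb A))
  exact_mod_cast h4

end

/-- **Hoffman's conjecture in positive characteristic** (Theorem A):
for every `N ∈ ℕ` and weight `w ∈ ℕ`, the family of Carlitz multiple polylogarithms at
`N`-th roots of unity `Li(𝛆;𝔰)` with `𝔰 ∈ S_w` and `𝛆 ∈ Γ_N^{depth 𝔰}` is a basis of the
`K_N`-vector space `CZ_{N,w}`: it is `K_N`-linearly independent and its `K_N`-span is
`CZ_{N,w}`. -/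
theorem hoffman_conjecture_positive_characteristic
    (Fq : Type) [Field Fq] [Fintype Fq] (N w : ℕ) (hN : 0 < N) (hw : 0 < w) :
    LinearIndependent (KNf Fq N) (fun A : SwIdx Fq N w => Li Fq A.1) ∧
    Submodule.span (KNf Fq N) (Set.range fun A : SwIdx Fq N w => Li Fq A.1)
      = CZ Fq N w := by
  exact ⟨lin_ind Fq N w hN, span_eq Fq hN hw⟩

end ZHPC
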